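/- Let n ≥ 2 and let S ⊆ ℝⁿ be a set of Hausdorff dimension strictly greater than 1. If B ⊆ ℝⁿ contains a sphere centered at every point of S, i.e. for every x ∈ S there exists r > 0 with Metric.sphere x r ⊆ B, then B has positive Lebesgue (outer) measure. (Mitsis–Wolff theorem.) -/

import Mathlib

namespace MW
open MeasureTheory Metric Set

/-- mean value bound -/
lemma mvt_abs {f f' : ℝ → ℝ} {p q C : ℝ}
    (hf : ∀ u ∈ Icc p q, HasDerivAt f (f' u) u) (hb : ∀ u ∈ Icc p q, |f' u| ≤ C)
    {u v : ℝ} (hu : u ∈ Icc p q) (hv : v ∈ Icc p q) : |f v - f u| ≤ C * |v - u| := by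
  have := Convex.norm_image_sub_le_of_norm_hasDerivWithin_le (f := f) (f' := f') (s := Icc p q)
    (C := C) (fun x hx => (hf x hx).hasDerivWithinAt) (fun x hx => hb x hx) (convex_Icc p q) hu hv
  simpa [Real.norm_eq_abs] using this

/-- mean value lower bound -/
lemma mvt_abs_ge {f f' : ℝ → ℝ} {p q c : ℝ}
    (hf : ∀ u ∈ Icc p q, HasDerivAt f (f' u) u) (hb : ∀ u ∈ Icc p q, c ≤ |f' u|)
    {u v : ℝ} (hu : u ∈ Icc p q) (hv : v ∈ Icc p q) : c * |v - u| ≤ |f v - f u| := by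
  wlog huv : u < v generalizing u v
  · rcases eq_or_lt_of_le (not_lt.1 huv) with h | h
    · subst h; simp
    · have := this hv hu h
      rwa [abs_sub_comm, abs_sub_comm (f v)]
  have hsub : Icc u v ⊆ Icc p q := Icc_subset_Icc hu.1 hv.2
  obtain ⟨x, hx, hx'⟩ := exists_hasDerivAt_eq_slope f f' huv
    (fun x hx => (hf x (hsub hx)).continuousAt.continuousWithinAt)
    (fun x hx => hf x (hsub (Ioo_subset_Icc_self hx)))
  have h1 := hb x (hsub (Ioo_subset_Icc_self hx))
  have h2 : 0 < v - u := sub_pos.2 huv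
  rw [hx', abs_div, le_div_iff₀ (abs_pos.2 h2.ne')] at h1
  exact h1

structure Jet (d0 d1 d2 d3 : ℝ → ℝ) (p q : ℝ) : Prop where
  h0 : ∀ u ∈ Icc p q, HasDerivAt d0 (d1 u) u
  h1 : ∀ u ∈ Icc p q, HasDerivAt d1 (d2 u) u
  h2 : ∀ u ∈ Icc p q, HasDerivAt d2 (d3 u) u
  h3 : ∀ u ∈ Icc p q, |d3 u| ≤ (1/100) * (|d1 u| + |d2 u|)

section
variable {d0 d1 d2 d3 : ℝ → ℝ} {p q : ℝ}

lemma Jet.bounds (J : Jet d0 d1 d2 d3 p q) {α D c : ℝ} (hα : q - p = α) (hα0 : 0 < α) (hα1 : α ≤ 1)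
    (hc : c ∈ Icc p q) (hD1 : α * |d1 c| ≤ D) (hD2 : α^2 * |d2 c| ≤ D) :
    ∀ u ∈ Icc p q, α^2 * |d2 u| ≤ 2 * D ∧ α * |d1 u| ≤ 3 * D ∧ |d0 u - d0 c| ≤ 3 * D ∧
      α ^ 2 * |d2 u - d2 c| ≤ D / 20 := by
  have hcont : ContinuousOn (fun u => |d2 u|) (Icc p q) :=
    fun u hu => ((J.h2 u hu).continuousAt.abs).continuousWithinAt
  obtain ⟨us, hus, hmax⟩ := isCompact_Icc.exists_isMaxOn ⟨c, hc⟩ hcont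
  set X := |d2 us| with hX
  have hX0 : 0 ≤ X := abs_nonneg _
  have hmax' : ∀ u ∈ Icc p q, |d2 u| ≤ X := fun u hu => hmax hu
  have hdist : ∀ u ∈ Icc p q, |u - c| ≤ α := by
    intro u hu; rw [abs_le]; constructor <;> linarith [hu.1, hu.2, hc.1, hc.2]
  have hD0 : 0 ≤ D := le_trans (by positivity) hD1
  have hb1 : ∀ u ∈ Icc p q, |d1 u| ≤ |d1 c| + α * X := by
    intro u hu
    have h := mvt_abs J.h1 hmax' hc hu
    have h2 := hdist u hu
    have h3 : |d1 u| ≤ |d1 c| + |d1 u - d1 c| := by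
      have := abs_add_le (d1 c) (d1 u - d1 c); simpa using this
    nlinarith
  have hb3 : ∀ u ∈ Icc p q, |d3 u| ≤ (1/100) * (|d1 c| + α * X + X) := by
    intro u hu
    have := J.h3 u hu
    have := hb1 u hu
    have := hmax' u hu
    linarith
  have hd2 : ∀ u ∈ Icc p q, |d2 u - d2 c| ≤ (1/100) * (|d1 c| + α * X + X) * α := by
    intro u hu
    have h := mvt_abs J.h2 hb3 hc hu
    refine h.trans (mul_le_mul_of_nonneg_left (hdist u hu) ?_)
    have := abs_nonneg (d1 c)
    positivity
  have hA : α^2 * ((1/100) * (|d1 c| + α * X + X) * α) ≤ (1/100) * (D + 2 * (α^2 * X)) := by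
    have e1 : α^2 * (α * |d1 c|) ≤ 1 * D := by
      apply mul_le_mul _ hD1 (by positivity) (by norm_num)
      nlinarith
    have e2 : α^2 * (α^2 * X) ≤ 1 * (α^2 * X) := by
      apply mul_le_mul_of_nonneg_right _ (by positivity)
      nlinarith
    have e3 : α * (α^2 * X) ≤ 1 * (α^2 * X) := by
      apply mul_le_mul_of_nonneg_right hα1 (by positivity)
    nlinarith
  have hXb : α^2 * X ≤ (101/98) * D := by
    have h := hd2 us hus
    have h3 : X ≤ |d2 c| + |d2 us - d2 c| := by
      have := abs_add_le (d2 c) (d2 us - d2 c); simpa [hX] using this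
    have h4 : α^2 * X ≤ α^2 * |d2 c| + α^2 * |d2 us - d2 c| := by
      rw [← mul_add]; exact mul_le_mul_of_nonneg_left h3 (by positivity)
    have h5 : α^2 * |d2 us - d2 c| ≤ _ := mul_le_mul_of_nonneg_left h (by positivity)
    linarith
  have hk1 : ∀ u ∈ Icc p q, α * |d1 u| ≤ 3 * D := by
    intro u hu
    have := hb1 u hu
    have h5 : α * |d1 u| ≤ _ := mul_le_mul_of_nonneg_left this hα0.le
    nlinarith
  intro u hu
  refine ⟨?_, hk1 u hu, ?_, ?_⟩
  · have : α^2 * |d2 u| ≤ α^2 * X := mul_le_mul_of_nonneg_left (hmax' u hu) (by positivity)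
    linarith
  · have := mvt_abs (C := 3 * D / α) J.h0 (fun x hx => by
      rw [le_div_iff₀ hα0, mul_comm]; exact hk1 x hx) hc hu
    refine this.trans ?_
    calc 3 * D / α * |u - c| ≤ 3 * D / α * α := mul_le_mul_of_nonneg_left (hdist u hu) (by positivity)
      _ = 3 * D := by field_simp
  · have h5 : α^2 * |d2 u - d2 c| ≤ _ := mul_le_mul_of_nonneg_left (hd2 u hu) (by positivity)
    linarith

lemma Jet.dichotomy (J : Jet d0 d1 d2 d3 p q) {α D : ℝ} (hα : q - p = α) (hα0 : 0 < α) (hα1 : α ≤ 1)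
    (hD : D = max (α * |d1 p|) (α^2 * |d2 p|)) :
    (∀ u ∈ Icc p q, D / 4 ≤ α^2 * |d2 u|) ∨ (∀ u ∈ Icc p q, D / 4 ≤ α * |d1 u|) := by
  have hp : p ∈ Icc p q := ⟨le_rfl, by linarith⟩
  have hb := J.bounds hα hα0 hα1 hp (D := D) (by rw [hD]; exact le_max_left _ _)
    (by rw [hD]; exact le_max_right _ _)
  have hD0 : 0 ≤ D := by rw [hD]; exact le_trans (by positivity) (le_max_left _ _)
  by_cases hc : D / 2 ≤ α^2 * |d2 p|
  · left
    intro u hu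
    obtain ⟨-, -, -, h⟩ := hb u hu
    have h3 : |d2 p| ≤ |d2 u| + |d2 u - d2 p| := by
      have := abs_sub_abs_le_abs_sub (d2 p) (d2 u); rw [abs_sub_comm] at this; linarith
    have : α^2 * |d2 p| ≤ α^2 * (|d2 u| + |d2 u - d2 p|) := mul_le_mul_of_nonneg_left h3 (by positivity)
    nlinarith
  · right
    push Not at hc
    have h1 : α * |d1 p| = D := by
      rcases max_choice (α * |d1 p|) (α^2 * |d2 p|) with h | h
      · rw [hD, h]
      · rw [h] at hD; linarith
    have hk : ∀ u ∈ Icc p q, |d2 u| ≤ (11/20) * D / α^2 := by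
      intro u hu
      rw [le_div_iff₀ (by positivity)]
      obtain ⟨-, -, -, h⟩ := hb u hu
      have h3 : |d2 u| ≤ |d2 p| + |d2 u - d2 p| := by
        have := abs_add_le (d2 p) (d2 u - d2 p); simpa using this
      have : α^2 * |d2 u| ≤ α^2 * (|d2 p| + |d2 u - d2 p|) := mul_le_mul_of_nonneg_left h3 (by positivity)
      nlinarith
    intro u hu
    have h := mvt_abs J.h1 hk hp hu
    have hdist : |u - p| ≤ α := by rw [abs_le]; constructor <;> linarith [hu.1, hu.2]
    have h3 : |d1 p| ≤ |d1 u| + |d1 u - d1 p| := by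
      have := abs_sub_abs_le_abs_sub (d1 p) (d1 u); rw [abs_sub_comm] at this; linarith
    have h4 : |d1 u - d1 p| ≤ (11/20) * D / α^2 * α := h.trans (mul_le_mul_of_nonneg_left hdist (by positivity))
    have h5 : α * ((11/20) * D / α^2 * α) = (11/20) * D := by field_simp
    have h6 : α * |d1 p| ≤ α * (|d1 u| + (11/20) * D / α^2 * α) :=
      mul_le_mul_of_nonneg_left (by linarith) hα0.le
    rw [mul_add, h5] at h6
    linarith

/-- integration by parts -/
lemma vdc_ibp {φ φ1 φ2 φ3 : ℝ → ℝ} {a b μ N : ℝ} (hab : a ≤ b) (hμ : 0 < μ)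
    (h0 : ∀ u ∈ Icc a b, HasDerivAt φ (φ1 u) u)
    (h1 : ∀ u ∈ Icc a b, HasDerivAt φ1 (φ2 u) u)
    (h2 : ∀ u ∈ Icc a b, HasDerivAt φ2 (φ3 u) u)
    (hl : ∀ u ∈ Icc a b, μ ≤ |φ1 u|) (hN : ∀ u ∈ Icc a b, |φ2 u| ≤ N) :
    ‖∫ u in a..b, Complex.exp (Complex.I * φ u)‖ ≤ 2 / μ + (b - a) * N / μ^2 := by
  have hI : Complex.I ≠ 0 := Complex.I_ne_zero
  have hne : ∀ u ∈ Icc a b, φ1 u ≠ 0 := fun u hu h => by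
    have := hl u hu; rw [h, abs_zero] at this; linarith
  have hexp : ∀ u, ‖Complex.exp (Complex.I * φ u)‖ = 1 := fun u => by
    rw [mul_comm]; exact Complex.norm_exp_ofReal_mul_I _
  have hder : ∀ u ∈ uIcc a b, HasDerivAt
      (fun u => Complex.exp (Complex.I * φ u) / (Complex.I * φ1 u))
      (Complex.exp (Complex.I * φ u) -
        Complex.exp (Complex.I * φ u) * φ2 u / (Complex.I * (φ1 u)^2)) u := by
    intro u hu
    rw [uIcc_of_le hab] at hu
    have e0 := ((h0 u hu).ofReal_comp.const_mul Complex.I).cexp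
    have e1 := (h1 u hu).ofReal_comp.const_mul Complex.I
    have hn : ((φ1 u : ℝ) : ℂ) ≠ 0 := by exact_mod_cast hne u hu
    refine HasDerivAt.congr_deriv (f := fun u => Complex.exp (Complex.I * φ u) / (Complex.I * φ1 u))
      (e0.div e1 (mul_ne_zero hI hn)) ?_
    field_simp
  have hc0 : ContinuousOn φ (Icc a b) := fun u hu => (h0 u hu).continuousAt.continuousWithinAt
  have hc1 : ContinuousOn φ1 (Icc a b) := fun u hu => (h1 u hu).continuousAt.continuousWithinAt
  have hc2 : ContinuousOn φ2 (Icc a b) := fun u hu => (h2 u hu).continuousAt.continuousWithinAt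
  have ce : ContinuousOn (fun u => Complex.exp (Complex.I * φ u)) (Icc a b) := by
    apply Complex.continuous_exp.comp_continuousOn
    exact continuousOn_const.mul (Complex.continuous_ofReal.comp_continuousOn hc0)
  have ce2 : ContinuousOn (fun u => Complex.exp (Complex.I * φ u) * φ2 u / (Complex.I * (φ1 u)^2)) (Icc a b) := by
    apply (ce.mul (Complex.continuous_ofReal.comp_continuousOn hc2)).div
    · exact continuousOn_const.mul ((Complex.continuous_ofReal.comp_continuousOn hc1).pow 2)
    · intro u hu
      have hn : ((φ1 u : ℝ) : ℂ) ≠ 0 := by exact_mod_cast hne u hu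
      exact mul_ne_zero hI (pow_ne_zero _ hn)
  have i1 := ce.intervalIntegrable_of_Icc (μ := volume) hab
  have i2 := ce2.intervalIntegrable_of_Icc (μ := volume) hab
  have key := intervalIntegral.integral_eq_sub_of_hasDerivAt hder (i1.sub i2)
  rw [intervalIntegral.integral_sub i1 i2] at key
  have key2 := eq_add_of_sub_eq key
  rw [key2]
  have hbd : ∀ u ∈ Icc a b, ‖Complex.exp (Complex.I * φ u) / (Complex.I * φ1 u)‖ ≤ 1 / μ := by
    intro u hu
    rw [norm_div, hexp, norm_mul, Complex.norm_I, one_mul, Complex.norm_real, Real.norm_eq_abs]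
    exact one_div_le_one_div_of_le hμ (hl u hu)
  have ha : a ∈ Icc a b := ⟨le_rfl, hab⟩
  have hb : b ∈ Icc a b := ⟨hab, le_rfl⟩
  have h_int : ‖∫ u in a..b, Complex.exp (Complex.I * φ u) * φ2 u / (Complex.I * (φ1 u)^2)‖
      ≤ (N / μ^2) * |b - a| := by
    apply intervalIntegral.norm_integral_le_of_norm_le_const
    intro u hu
    rw [uIoc_of_le hab] at hu
    have hu' := Ioc_subset_Icc_self hu
    rw [norm_div, norm_mul, hexp, one_mul, norm_mul, Complex.norm_I, one_mul, norm_pow,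
      Complex.norm_real, Complex.norm_real, Real.norm_eq_abs, Real.norm_eq_abs]
    have := hl u hu'
    have hN0 : 0 ≤ N := (abs_nonneg _).trans (hN u hu')
    gcongr
    exact hN u hu'
  rw [abs_of_nonneg (by linarith)] at h_int
  calc _ ≤ _ + _ := norm_add_le _ _
    _ ≤ (1/μ + 1/μ) + (N / μ^2) * (b - a) := add_le_add ((norm_sub_le _ _).trans
        (add_le_add (hbd b hb) (hbd a ha))) h_int
    _ = _ := by ring

/-- oscillatory integral bound on subarc; phase ξ * d0, |ξ| t = 1. -/
lemma Jet.vdc (J : Jet d0 d1 d2 d3 p q) {α D t ξ K a b : ℝ} (hα : q - p = α) (hα0 : 0 < α)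
    (hα1 : α ≤ 1) (hD : D = max (α * |d1 p|) (α^2 * |d2 p|)) (ht : 0 < t) (hξ : |ξ| * t = 1)
    (hK : 1 ≤ K) (hDK : K^3 * t ≤ D) (hpa : p ≤ a) (hab : a ≤ b) (hbq : b ≤ q) :
    ‖∫ u in a..b, Complex.exp (Complex.I * ((ξ * d0 u : ℝ) : ℂ))‖ ≤ 290 * α / K := by
  have hp : p ∈ Icc p q := ⟨le_rfl, by linarith⟩
  have hbd := J.bounds hα hα0 hα1 hp (D := D) (by rw [hD]; exact le_max_left _ _)
    (by rw [hD]; exact le_max_right _ _)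
  have hK0 : 0 < K := by linarith
  have hD0 : 0 < D := lt_of_lt_of_le (by positivity) hDK
  have hξ' : |ξ| = 1 / t := by field_simp; exact hξ
  have hsub : Icc a b ⊆ Icc p q := Icc_subset_Icc hpa hbq
  have hN : ∀ u ∈ Icc p q, |ξ * d2 u| ≤ 2 * D / (α^2 * t) := by
    intro u hu
    rw [abs_mul, hξ', div_mul_eq_mul_div, one_mul, div_le_div_iff₀ ht (by positivity)]
    have := (hbd u hu).1
    nlinarith
  have g0 : ∀ u ∈ Icc p q, HasDerivAt (fun u => ξ * d0 u) (ξ * d1 u) u :=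
    fun u hu => (J.h0 u hu).const_mul ξ
  have g1 : ∀ u ∈ Icc p q, HasDerivAt (fun u => ξ * d1 u) (ξ * d2 u) u :=
    fun u hu => (J.h1 u hu).const_mul ξ
  have g2 : ∀ u ∈ Icc p q, HasDerivAt (fun u => ξ * d2 u) (ξ * d3 u) u :=
    fun u hu => (J.h2 u hu).const_mul ξ
  have htD : t * K^3 ≤ D := by linarith
  have htD' : t / D ≤ 1 / K^3 := by rw [div_le_div_iff₀ hD0 (by positivity)]; linarith
  -- general lower bound gives estimate
  have main : ∀ a' b', a ≤ a' → a' ≤ b' → b' ≤ b →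
      (∀ u ∈ Icc a' b', D / (8 * α * t * K) ≤ |ξ * d1 u|) →
      ‖∫ u in a'..b', Complex.exp (Complex.I * ((ξ * d0 u : ℝ) : ℂ))‖ ≤ 144 * α / K := by
    intro a' b' h1 h2 h3 hl
    have hs : Icc a' b' ⊆ Icc p q := Icc_subset_Icc (by linarith) (by linarith)
    have := vdc_ibp (φ := fun u => ξ * d0 u) h2 (μ := D / (8 * α * t * K)) (by positivity)
      (fun u hu => g0 u (hs hu)) (fun u hu => g1 u (hs hu)) (fun u hu => g2 u (hs hu)) hl
      (fun u hu => hN u (hs hu))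
    refine this.trans ?_
    have e1 : 2 / (D / (8 * α * t * K)) = 16 * α * K * (t / D) := by field_simp; norm_num
    have e2 : (b' - a') * (2 * D / (α^2 * t)) / (D / (8 * α * t * K))^2
        = (b' - a') * (128 * K^2 * (t / D)) := by field_simp; ring
    rw [e1, e2]
    have e3 : (b' - a') * (128 * K^2 * (t / D)) ≤ α * (128 * K^2 * (1 / K^3)) := by
      apply mul_le_mul (by linarith) _ (by positivity) hα0.le
      gcongr
    have e4 : 16 * α * K * (t / D) ≤ 16 * α * K * (1/K^3) := by gcongr
    have e5 : 16 * α * K * (1/K^3) ≤ 16 * α / K := by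
      rw [mul_one_div, div_le_div_iff₀ (by positivity) hK0]
      have : K^2 ≤ K^3 := pow_le_pow_right₀ hK (by norm_num)
      nlinarith
    have e6 : α * (128 * K^2 * (1 / K^3)) = 128 * α / K := by field_simp
    have : 144 * α / K = 16 * α / K + 128 * α / K := by ring
    linarith
  rcases J.dichotomy hα hα0 hα1 hD with hd | hd
  · have hc : ContinuousOn (fun u => |ξ * d1 u|) (Icc a b) :=
      fun u hu => ((g1 u (hsub hu)).continuousAt.abs).continuousWithinAt
    obtain ⟨s, hs, hmin⟩ := isCompact_Icc.exists_isMinOn ⟨a, le_rfl, hab⟩ hc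
    have hmin' : ∀ u ∈ Icc a b, |ξ * d1 s| ≤ |ξ * d1 u| := fun u hu => hmin hu
    have hlow : ∀ u ∈ Icc a b, D / (8 * α^2 * t) * |u - s| ≤ |ξ * d1 u| := by
      intro u hu
      have := mvt_abs_ge (c := D / (4 * α^2 * t)) g1 (fun x hx => by
        rw [abs_mul, hξ', div_mul_eq_mul_div, one_mul, div_le_div_iff₀ (by positivity) ht]
        have := hd x hx
        nlinarith) (hsub hs) (hsub hu)
      have h1 := hmin' u hu
      have h2 := abs_sub (ξ * d1 u) (ξ * d1 s)
      have e : D / (4 * α^2 * t) = 2 * (D / (8 * α^2 * t)) := by field_simp; norm_num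
      rw [e] at this
      linarith
    set s1 := max a (s - α / K) with hs1
    set s2 := min b (s + α / K) with hs2
    have hαK : 0 < α / K := by positivity
    have k1 : a ≤ s1 := le_max_left _ _
    have k2 : s1 ≤ s := max_le hs.1 (by linarith)
    have k3 : s ≤ s2 := le_min hs.2 (by linarith)
    have k4 : s2 ≤ b := min_le_left _ _
    have cont : ∀ x y, p ≤ x → x ≤ y → y ≤ q →
        IntervalIntegrable (fun u => Complex.exp (Complex.I * ((ξ * d0 u : ℝ) : ℂ))) volume x y := by
      intro x y hx hxy hy
      apply ContinuousOn.intervalIntegrable_of_Icc hxy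
      apply Complex.continuous_exp.comp_continuousOn
      refine continuousOn_const.mul (Complex.continuous_ofReal.comp_continuousOn ?_)
      intro u hu
      exact (g0 u ⟨hx.trans hu.1, hu.2.trans hy⟩).continuousAt.continuousWithinAt
    have far : ∀ u ∈ Icc a b, α / K ≤ |u - s| → D / (8 * α * t * K) ≤ |ξ * d1 u| := by
      intro u hu h
      refine le_trans ?_ (hlow u hu)
      calc D / (8 * α * t * K) = D / (8 * α^2 * t) * (α / K) := by field_simp
        _ ≤ _ := by gcongr
    have p1 : ‖∫ u in a..s1, Complex.exp (Complex.I * ((ξ * d0 u : ℝ) : ℂ))‖ ≤ 144 * α / K := by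
      rcases le_total (s - α / K) a with h | h
      · rw [hs1, max_eq_left h, intervalIntegral.integral_same, norm_zero]; positivity
      · have hs1' : s1 = s - α / K := max_eq_right h
        apply main a s1 le_rfl k1 (by linarith)
        intro u hu
        apply far u ⟨hu.1, by linarith [hu.2]⟩
        rw [abs_sub_comm]
        exact le_trans (by linarith [hu.2]) (le_abs_self _)
    have p3 : ‖∫ u in s2..b, Complex.exp (Complex.I * ((ξ * d0 u : ℝ) : ℂ))‖ ≤ 144 * α / K := by
      rcases le_total b (s + α / K) with h | h
      · rw [hs2, min_eq_left h, intervalIntegral.integral_same, norm_zero]; positivity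
      · have hs1' : s2 = s + α / K := min_eq_right h
        apply main s2 b (by linarith) k4 le_rfl
        intro u hu
        apply far u ⟨by linarith [hu.1], hu.2⟩
        exact le_trans (by linarith [hu.1]) (le_abs_self _)
    have p2 : ‖∫ u in s1..s2, Complex.exp (Complex.I * ((ξ * d0 u : ℝ) : ℂ))‖ ≤ 2 * α / K := by
      have := intervalIntegral.norm_integral_le_of_norm_le_const (C := 1) (a := s1) (b := s2)
        (f := fun u => Complex.exp (Complex.I * ((ξ * d0 u : ℝ) : ℂ))) (fun u _ => by
          rw [mul_comm]; exact (Complex.norm_exp_ofReal_mul_I _).le)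
      refine this.trans ?_
      rw [one_mul, abs_of_nonneg (by linarith)]
      have h1 : s - α / K ≤ s1 := le_max_right _ _
      have h2 : s2 ≤ s + α / K := min_le_right _ _
      have : 2 * α / K = 2 * (α / K) := by ring
      linarith
    rw [← intervalIntegral.integral_add_adjacent_intervals
        (cont a s1 hpa k1 (by linarith)) (cont s1 b (by linarith) (by linarith) hbq),
      ← intervalIntegral.integral_add_adjacent_intervals
        (cont s1 s2 (by linarith) (by linarith) (by linarith)) (cont s2 b (by linarith) k4 hbq)]
    calc _ ≤ _ + (_ + _) := (norm_add_le _ _).trans (add_le_add le_rfl (norm_add_le _ _))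
      _ ≤ 144 * α / K + (2 * α / K + 144 * α / K) := add_le_add p1 (add_le_add p2 p3)
      _ = _ := by ring
  · refine (main a b le_rfl hab le_rfl ?_).trans (by gcongr; norm_num)
    intro u hu
    have := hd u (hsub hu)
    rw [abs_mul, hξ', div_mul_eq_mul_div, one_mul, div_le_div_iff₀ (by positivity) ht]
    have h2 : t * D ≤ t * (4 * (α * |d1 u|)) := by
      apply mul_le_mul_of_nonneg_left _ ht.le; linarith
    have h3 : (α * |d1 u|) * t * 1 ≤ (α * |d1 u|) * t * K :=
      mul_le_mul_of_nonneg_left hK (by positivity)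
    have h4 : 0 ≤ (α * |d1 u|) * t * K := by positivity
    nlinarith
end
end MW

namespace MW
open MeasureTheory Metric Set

lemma Jet.mono {d0 d1 d2 d3 : ℝ → ℝ} {p q p' q' : ℝ} (J : Jet d0 d1 d2 d3 p q)
    (h : Icc p' q' ⊆ Icc p q) : Jet d0 d1 d2 d3 p' q' :=
  ⟨fun u hu => J.h0 u (h hu), fun u hu => J.h1 u (h hu), fun u hu => J.h2 u (h hu),
   fun u hu => J.h3 u (h hu)⟩

structure PD (ι : Type) where
  G0 : ι → ℝ → ℝ
  G1 : ι → ℝ → ℝ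
  G2 : ι → ℝ → ℝ
  G3 : ι → ℝ → ℝ
  g : ℕ → ℝ → ℝ → ℂ
  t : ℝ
  w : ℝ
  ξ : ℝ
  ep : ℝ
  Bd : ℝ
  M : ℕ
  L : ℕ
  jet : ∀ z z', Jet (fun u => G0 z u - G0 z' u) (fun u => G1 z u - G1 z' u)
    (fun u => G2 z u - G2 z' u) (fun u => G3 z u - G3 z' u) 0 1
  G0m : ∀ z, Measurable (G0 z)
  b0 : ∀ z, ∀ u ∈ Icc (0:ℝ) 1, |G0 z u| ≤ 1
  b1 : ∀ z, ∀ u ∈ Icc (0:ℝ) 1, |G1 z u| ≤ 1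
  b2 : ∀ z, ∀ u ∈ Icc (0:ℝ) 1, |G2 z u| ≤ 1
  gm : ∀ j, Measurable (Function.uncurry (g j))
  gb : ∀ j ≤ L + 3, ∀ u y, ‖g j u y‖ ≤ Bd
  gd : ∀ j u y, HasDerivAt (g j u) (g (j+1) u y / w) y
  t0 : 0 < t
  t1 : t ≤ 1
  ξt : |ξ| * t = 1
  w0 : 0 < w
  ep0 : 0 < ep
  M4 : 4 ≤ M
  ML : 1 ≤ (M:ℝ)^L * t
  epw : 4 * (M:ℝ)^2 * t ≤ ep * w

structure IsTest (p α e : ℝ) (χ : ℝ → ℂ) (η : ℝ → ℝ) : Prop where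
  χm : Measurable χ
  ηm : Measurable η
  χb : ∀ u ∈ Icc p (p+α), ‖χ u‖ ≤ 1
  χl : ∀ u ∈ Icc p (p+α), ∀ v ∈ Icc p (p+α), ‖χ u - χ v‖ ≤ |u - v| / α
  ηb : ∀ u ∈ Icc p (p+α), |η u| ≤ e
  ηl : ∀ u ∈ Icc p (p+α), ∀ v ∈ Icc p (p+α), |η u - η v| ≤ e * |u - v| / α

/-- Restriction of a test to a smaller arc. -/
lemma IsTest.mono {p α e p' α' e' : ℝ} {χ : ℝ → ℂ} {η : ℝ → ℝ} (h : IsTest p α e χ η)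
    (hp : p ≤ p') (hq : p' + α' ≤ p + α) (h0 : 0 < α') (hα : α' ≤ α) (he0 : 0 ≤ e) (he : e ≤ e') :
    IsTest p' α' e' χ η := by
  have hs : ∀ u ∈ Icc p' (p'+α'), u ∈ Icc p (p+α) := fun u hu => ⟨hp.trans hu.1, hu.2.trans hq⟩
  refine ⟨h.χm, h.ηm, fun u hu => h.χb u (hs u hu), fun u hu v hv => ?_,
    fun u hu => (h.ηb u (hs u hu)).trans he, fun u hu v hv => ?_⟩
  · refine (h.χl u (hs u hu) v (hs v hv)).trans ?_
    gcongr
  · refine (h.ηl u (hs u hu) v (hs v hv)).trans ?_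
    have : 0 ≤ e' := he0.trans he
    gcongr

namespace PD
variable {ι : Type} (D : PD ι)

/-- arc length at level i -/
noncomputable def al (i : ℕ) : ℝ := ((D.M:ℝ)^i)⁻¹

noncomputable def eps (i : ℕ) : ℝ := i * D.ep

noncomputable def F (z : ι) (χ : ℝ → ℂ) (η : ℝ → ℝ) (j : ℕ) (u : ℝ) : ℂ :=
  χ u * Complex.exp (Complex.I * ((D.ξ * D.G0 z u : ℝ) : ℂ)) * D.g j u (D.G0 z u + D.w * η u)

noncomputable def T (i : ℕ) (p : ℝ) (z : ι) (χ : ℝ → ℂ) (η : ℝ → ℝ) (j : ℕ) : ℂ :=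
  ∫ u in p..(p + D.al i), D.F z χ η j u

def testVals (i : ℕ) (p : ℝ) (z : ι) : Set ℝ :=
  {x | ∃ χ η j, IsTest p (D.al i) (D.eps i) χ η ∧ j ≤ i ∧ x = (D.M:ℝ)^i * ‖D.T i p z χ η j‖}

noncomputable def N (i : ℕ) (p : ℝ) (z : ι) : ℝ := sSup (D.testVals i p z)

noncomputable def cell (i : ℕ) (p : ℝ) (z : ι) : ℤ × ℤ × ℤ :=
  (⌊D.G0 z p / D.t⌋, ⌊D.al i * D.G1 z p / D.t⌋, ⌊D.al i ^ 2 * D.G2 z p / D.t⌋)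

lemma M0 : (0:ℝ) < D.M := by have := D.M4; positivity
lemma M4' : (4:ℝ) ≤ D.M := by exact_mod_cast D.M4
lemma M1' : (1:ℝ) ≤ D.M := by have := D.M4'; linarith
lemma al_pos (i : ℕ) : 0 < D.al i := by have := D.M0; unfold al; positivity
lemma al_le_one (i : ℕ) : D.al i ≤ 1 := by
  unfold al; exact inv_le_one_of_one_le₀ (one_le_pow₀ D.M1')
lemma al_add (i k : ℕ) : D.al i = (D.M:ℝ)^k * D.al (i+k) := by
  have := D.M0; unfold al; rw [pow_add]; field_simp
lemma Mal (i : ℕ) : (D.M:ℝ)^i * D.al i = 1 := by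
  have := D.M0; unfold al; field_simp
lemma al_anti {i k : ℕ} (h : i ≤ k) : D.al k ≤ D.al i := by
  unfold al
  apply inv_anti₀ (pow_pos D.M0 _)
  exact pow_le_pow_right₀ D.M1' h
lemma eps_mono {i k : ℕ} (h : i ≤ k) : D.eps i ≤ D.eps k := by
  unfold eps
  have := D.ep0
  gcongr
lemma eps_nonneg (i : ℕ) : 0 ≤ D.eps i := by unfold eps; have := D.ep0; positivity
lemma Bd_nonneg : 0 ≤ D.Bd := (norm_nonneg _).trans (D.gb 0 (by omega) 0 0)

lemma norm_e (x : ℝ) : ‖Complex.exp (Complex.I * (x : ℂ))‖ = 1 := by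
  rw [mul_comm]; exact Complex.norm_exp_ofReal_mul_I _

lemma norm_e_sub (x y : ℝ) :
    ‖Complex.exp (Complex.I * (x : ℂ)) - Complex.exp (Complex.I * (y : ℂ))‖ ≤ |x - y| := by
  have h : Complex.exp (Complex.I * (x : ℂ)) - Complex.exp (Complex.I * (y : ℂ))
    = Complex.exp (Complex.I * (y : ℂ)) * (Complex.exp (Complex.I * ((x - y : ℝ) : ℂ)) - 1) := by
    rw [mul_sub, ← Complex.exp_add]; push_cast; ring_nf
  rw [h, norm_mul, norm_e, one_mul]
  exact Real.norm_exp_I_mul_ofReal_sub_one_le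

lemma F_meas (z : ι) {χ : ℝ → ℂ} {η : ℝ → ℝ} (hχ : Measurable χ) (hη : Measurable η) (j : ℕ) :
    Measurable (D.F z χ η j) := by
  unfold F
  have h0 := D.G0m z
  have h1 : Measurable (fun u => D.g j u (D.G0 z u + D.w * η u)) :=
    (D.gm j).comp (measurable_id.prodMk (h0.add (hη.const_mul _)))
  have h2 : Measurable (fun u => Complex.exp (Complex.I * ((D.ξ * D.G0 z u : ℝ) : ℂ))) := by
    fun_prop
  exact (hχ.mul h2).mul h1

lemma F_bound (z : ι) {χ : ℝ → ℂ} {η : ℝ → ℝ} {j : ℕ} (hj : j ≤ D.L + 3) {u c : ℝ}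
    (hc : 0 ≤ c) (h : ‖χ u‖ ≤ c) :
    ‖D.F z χ η j u‖ ≤ c * D.Bd := by
  unfold F
  rw [norm_mul, norm_mul, norm_e, mul_one]
  exact mul_le_mul h (D.gb j hj _ _) (norm_nonneg _) hc

lemma ii_of_bdd {f : ℝ → ℂ} {a b c : ℝ} (hf : Measurable f) (hab : a ≤ b)
    (h : ∀ u ∈ Icc a b, ‖f u‖ ≤ c) : IntervalIntegrable f volume a b := by
  rw [intervalIntegrable_iff, uIoc_of_le hab]
  refine Measure.integrableOn_of_bounded (M := c) (by simp) hf.aestronglyMeasurable ?_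
  rw [ae_restrict_iff' measurableSet_Ioc]
  exact Filter.Eventually.of_forall fun u hu => h u (Ioc_subset_Icc_self hu)

lemma F_ii (z : ι) {χ : ℝ → ℂ} {η : ℝ → ℝ} (hχ : Measurable χ) (hη : Measurable η) {j : ℕ}
    (hj : j ≤ D.L + 3) {a b c : ℝ} (hc : 0 ≤ c) (hab : a ≤ b) (h : ∀ u ∈ Icc a b, ‖χ u‖ ≤ c) :
    IntervalIntegrable (D.F z χ η j) volume a b :=
  ii_of_bdd (D.F_meas z hχ hη j) hab (c := c * D.Bd) fun u hu => D.F_bound z hj hc (h u hu)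

lemma testVals_le {i : ℕ} (hi : i ≤ D.L + 3) {p : ℝ} {z : ι} :
    ∀ x ∈ D.testVals i p z, x ≤ D.Bd := by
  rintro x ⟨χ, η, j, hT, hj, rfl⟩
  have h1 : ‖D.T i p z χ η j‖ ≤ (1 * D.Bd) * |p + D.al i - p| := by
    unfold T
    apply intervalIntegral.norm_integral_le_of_norm_le_const
    intro u hu
    rw [uIoc_of_le (by linarith [D.al_pos i])] at hu
    exact D.F_bound z (hj.trans hi) zero_le_one (hT.χb u (Ioc_subset_Icc_self hu))
  rw [add_sub_cancel_left, abs_of_pos (D.al_pos i)] at h1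
  calc (D.M:ℝ)^i * ‖D.T i p z χ η j‖ ≤ (D.M:ℝ)^i * (1 * D.Bd * D.al i) := by
        have := D.M0; gcongr
    _ = ((D.M:ℝ)^i * D.al i) * D.Bd := by ring
    _ = D.Bd := by rw [Mal, one_mul]

lemma zero_test (i : ℕ) (p : ℝ) : IsTest p (D.al i) (D.eps i) (fun _ => 1) (fun _ => 0) := by
  have := D.al_pos i
  have := D.eps_nonneg i
  refine ⟨measurable_const, measurable_const, by simp, fun u _ v _ => ?_, by simp [this],
    fun u _ v _ => ?_⟩
  · simp; positivity
  · simp; positivity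

lemma T_le_N {i : ℕ} (hi : i ≤ D.L + 3) {p : ℝ} {z : ι} {χ : ℝ → ℂ} {η : ℝ → ℝ} {j : ℕ}
    (hT : IsTest p (D.al i) (D.eps i) χ η) (hj : j ≤ i) :
    ‖D.T i p z χ η j‖ ≤ D.al i * D.N i p z := by
  have h : (D.M:ℝ)^i * ‖D.T i p z χ η j‖ ≤ D.N i p z :=
    le_csSup ⟨D.Bd, D.testVals_le hi⟩ ⟨χ, η, j, hT, hj, rfl⟩
  calc ‖D.T i p z χ η j‖ = ((D.M:ℝ)^i * D.al i) * ‖D.T i p z χ η j‖ := by rw [Mal, one_mul]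
    _ = D.al i * ((D.M:ℝ)^i * ‖D.T i p z χ η j‖) := by ring
    _ ≤ _ := mul_le_mul_of_nonneg_left h (D.al_pos i).le

lemma N_nonempty (i : ℕ) (p : ℝ) (z : ι) : (D.testVals i p z).Nonempty :=
  ⟨_, _, _, 0, D.zero_test i p, Nat.zero_le _, rfl⟩

lemma N_le {i : ℕ} {p : ℝ} {z : ι} {c : ℝ}
    (h : ∀ χ η j, IsTest p (D.al i) (D.eps i) χ η → j ≤ i → ‖D.T i p z χ η j‖ ≤ D.al i * c) :
    D.N i p z ≤ c := by
  apply csSup_le (D.N_nonempty i p z)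
  rintro x ⟨χ, η, j, hT, hj, rfl⟩
  have := h χ η j hT hj
  calc _ ≤ (D.M:ℝ)^i * (D.al i * c) := by have := D.M0; gcongr
    _ = c := by rw [← mul_assoc, Mal, one_mul]

lemma exists_of_lt_N {i : ℕ} {p : ℝ} {z : ι} {c : ℝ} (h : c < D.N i p z) :
    ∃ χ η j, IsTest p (D.al i) (D.eps i) χ η ∧ j ≤ i ∧ D.al i * c < ‖D.T i p z χ η j‖ := by
  by_contra! hcon
  exact absurd (D.N_le hcon) (not_le.2 h)

lemma N_nonneg {i : ℕ} {p : ℝ} {z : ι} : 0 ≤ D.N i p z := by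
  apply Real.sSup_nonneg
  rintro x ⟨χ, η, j, hT, hj, rfl⟩
  have := D.M0
  positivity

lemma N_le_Bd {i : ℕ} (hi : i ≤ D.L + 3) {p : ℝ} {z : ι} : D.N i p z ≤ D.Bd :=
  csSup_le (D.N_nonempty i p z) (D.testVals_le hi)

/-- splitting arcs -/
lemma T_split {i k : ℕ} {p : ℝ} {z : ι} {χ : ℝ → ℂ} {η : ℝ → ℝ} {j : ℕ} (hj : j ≤ D.L + 3)
    (hT : IsTest p (D.al i) (D.eps i) χ η) :
    D.T i p z χ η j = ∑ l ∈ Finset.range (D.M^k), D.T (i+k) (p + l * D.al (i+k)) z χ η j := by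
  have h := intervalIntegral.sum_integral_adjacent_intervals (f := D.F z χ η j) (μ := volume)
    (a := fun l : ℕ => p + l * D.al (i+k)) (n := D.M^k) (by
      intro l hl
      have hp := D.al_pos (i+k)
      apply D.F_ii z hT.χm hT.ηm hj zero_le_one
      · push_cast; nlinarith
      · intro u hu
        apply hT.χb
        refine ⟨?_, hu.2.trans ?_⟩
        · have : (0:ℝ) ≤ l * D.al (i+k) := by positivity
          linarith [hu.1]
        · have : ((l+1 : ℕ) : ℝ) ≤ (D.M:ℝ)^k := by exact_mod_cast hl
          rw [D.al_add i k]
          gcongr)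
  unfold T
  have e1 : p + D.al i = p + ((D.M^k : ℕ) : ℝ) * D.al (i+k) := by
    rw [D.al_add i k]; push_cast; rfl
  have e0 : p = p + ((0:ℕ):ℝ) * D.al (i+k) := by simp
  conv_lhs => rw [e1]
  conv_lhs => rw [e0]
  simp only [Nat.cast_zero, zero_mul, add_zero] at h ⊢
  rw [← h]
  apply Finset.sum_congr rfl
  intro l _
  congr 1
  push_cast; ring

lemma sub_arc {i k l : ℕ} {p : ℝ} (hl : l < D.M^k) :
    p ≤ p + l * D.al (i+k) ∧ p + l * D.al (i+k) + D.al (i+k) ≤ p + D.al i := by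
  have hp := D.al_pos (i+k)
  constructor
  · have : (0:ℝ) ≤ l * D.al (i+k) := by positivity
    linarith
  · have : ((l+1 : ℕ) : ℝ) ≤ (D.M:ℝ)^k := by exact_mod_cast hl
    rw [D.al_add i k]
    push_cast at this
    nlinarith

lemma IsTest_sub {i k l : ℕ} {p : ℝ} {χ : ℝ → ℂ} {η : ℝ → ℝ} (hl : l < D.M^k)
    (hT : IsTest p (D.al i) (D.eps i) χ η) :
    IsTest (p + l * D.al (i+k)) (D.al (i+k)) (D.eps (i+k)) χ η := by
  obtain ⟨h1, h2⟩ := D.sub_arc (p := p) (i := i) hl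
  exact hT.mono h1 h2 (D.al_pos _) (D.al_anti (by omega)) (D.eps_nonneg _) (D.eps_mono (by omega))

lemma N_mono {i : ℕ} (hi : i + 1 ≤ D.L + 3) {p : ℝ} {z : ι} :
    D.N i p z ≤ (∑ l ∈ Finset.range D.M, D.N (i+1) (p + l * D.al (i+1)) z) / D.M := by
  have hM := D.M0
  apply D.N_le
  intro χ η j hT hj
  rw [D.T_split (k := 1) (by omega) hT, pow_one]
  refine (norm_sum_le _ _).trans ?_
  calc _ ≤ ∑ l ∈ Finset.range D.M, D.al (i+1) * D.N (i+1) (p + l * D.al (i+1)) z := by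
        apply Finset.sum_le_sum
        intro l hl
        apply D.T_le_N hi _ (by omega)
        exact D.IsTest_sub (k := 1) (by simpa using hl) hT
    _ = _ := by
        rw [← Finset.mul_sum, D.al_add i 1]
        field_simp

end PD
end MW

namespace MW
open MeasureTheory Metric Set
namespace PD
variable {ι : Type} (D : PD ι)

lemma swap_ii {f : ℝ → ℝ → ℂ} {a b c : ℝ} (hf : Measurable (Function.uncurry f)) (hab : a ≤ b)
    (h : ∀ u ∈ Icc a b, ∀ s ∈ Icc (0:ℝ) 1, ‖f u s‖ ≤ c) :
    ∫ u in a..b, ∫ s in (0:ℝ)..1, f u s = ∫ s in (0:ℝ)..1, ∫ u in a..b, f u s := by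
  simp only [intervalIntegral.integral_of_le hab, intervalIntegral.integral_of_le zero_le_one]
  rw [integral_integral_swap]
  have : IsFiniteMeasure ((volume.restrict (Ioc a b)).prod (volume.restrict (Ioc (0:ℝ) 1))) := by
    infer_instance
  refine Integrable.of_bound (C := c) hf.aestronglyMeasurable ?_
  rw [Measure.prod_restrict, ae_restrict_iff' (measurableSet_Ioc.prod measurableSet_Ioc)]
  refine Filter.Eventually.of_forall fun x hx => ?_
  exact h _ (Ioc_subset_Icc_self hx.1) _ (Ioc_subset_Icc_self hx.2)

lemma err2 {k : ℕ} (hk : k ≤ D.L + 3) (hk0 : 0 < k) {c : ℝ} {z : ι} {η : ℝ → ℝ} {j : ℕ}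
    (hj : j + 1 ≤ k) (hT : IsTest c (D.al k) (D.eps k) (fun _ => 1) η) :
    ‖D.T k c z (fun _ => 1) η j - D.T k c z (fun _ => 1) (fun _ => 0) j‖
      ≤ D.eps k * (D.al k * D.N k c z) := by
  set e := D.eps k with he
  have he0 : 0 < e := by
    rw [he]; unfold eps; have := D.ep0; positivity
  have ha := D.al_pos k
  have hac : c ≤ c + D.al k := by linarith
  have hw := D.w0
  have hηm := hT.ηm
  -- tests
  have test : ∀ s ∈ Icc (0:ℝ) 1, IsTest c (D.al k) e (fun u => ((η u / e : ℝ) : ℂ)) (fun u => s * η u) := by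
    intro s hs
    refine ⟨by fun_prop, by fun_prop, fun u hu => ?_, fun u hu v hv => ?_, fun u hu => ?_,
      fun u hu v hv => ?_⟩
    · rw [Complex.norm_real, Real.norm_eq_abs, abs_div, abs_of_pos he0, div_le_one he0]
      exact hT.ηb u hu
    · rw [← Complex.ofReal_sub, Complex.norm_real, Real.norm_eq_abs, ← sub_div, abs_div, abs_of_pos he0,
        div_le_iff₀ he0]
      refine (hT.ηl u hu v hv).trans_eq (by ring)
    · rw [abs_mul, abs_of_nonneg hs.1]
      have := hT.ηb u hu
      have := abs_nonneg (η u)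
      nlinarith [hs.1, hs.2]
    · rw [← mul_sub, abs_mul, abs_of_nonneg hs.1]
      have := hT.ηl u hu v hv
      have := abs_nonneg (η u - η v)
      nlinarith [hs.1, hs.2]
  have key : ∀ u, D.F z (fun _ => 1) η j u - D.F z (fun _ => 1) (fun _ => 0) j u
      = (e : ℂ) * ∫ s in (0:ℝ)..1, D.F z (fun u => ((η u / e : ℝ) : ℂ)) (fun u => s * η u) (j+1) u := by
    intro u
    have hd : ∀ s ∈ uIcc (0:ℝ) 1, HasDerivAt (fun s : ℝ => D.g j u (D.G0 z u + D.w * (s * η u)))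
        ((η u : ℂ) * D.g (j+1) u (D.G0 z u + D.w * (s * η u))) s := by
      intro s _
      have h1 := D.gd j u (D.G0 z u + D.w * (s * η u))
      have h2 : HasDerivAt (fun s : ℝ => D.G0 z u + D.w * (s * η u)) (D.w * η u) s := by
        have := (((hasDerivAt_id s).mul_const (η u)).const_mul D.w).const_add (D.G0 z u)
        simpa using this
      have := HasDerivAt.scomp s h1 h2
      have hw' : (D.w : ℂ) ≠ 0 := by exact_mod_cast hw.ne'
      refine HasDerivAt.congr_deriv (f := fun s : ℝ => D.g j u (D.G0 z u + D.w * (s * η u))) this ?_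
      rw [Complex.real_smul]; push_cast; field_simp
    have hcont : Continuous (fun s : ℝ => (η u : ℂ) * D.g (j+1) u (D.G0 z u + D.w * (s * η u))) := by
      have : Continuous (D.g (j+1) u) :=
        continuous_iff_continuousAt.2 fun y => (D.gd (j+1) u y).continuousAt
      fun_prop
    have h_int := intervalIntegral.integral_eq_sub_of_hasDerivAt hd (hcont.intervalIntegrable _ _)
    simp only [F]
    simp only [one_mul, zero_mul, mul_zero, add_zero] at h_int ⊢
    rw [← mul_sub, ← h_int, ← intervalIntegral.integral_const_mul, ← intervalIntegral.integral_const_mul]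
    congr 1
    ext s
    have he' : (e : ℂ) ≠ 0 := by exact_mod_cast he0.ne'
    push_cast
    field_simp
  have hone : ∀ u ∈ Icc c (c + D.al k), ‖(1:ℂ)‖ ≤ 1 := by simp
  have i1 := D.F_ii z (χ := fun _ => (1:ℂ)) measurable_const hηm (j := j) (by omega) zero_le_one hac hone
  have i2 := D.F_ii z (χ := fun _ => (1:ℂ)) (η := fun _ => (0:ℝ)) measurable_const measurable_const
    (j := j) (by omega) zero_le_one hac hone
  have hmeas : Measurable (Function.uncurry fun u s =>
      D.F z (fun u => ((η u / e : ℝ) : ℂ)) (fun u => s * η u) (j+1) u) := by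
    unfold F
    have h0 := D.G0m z
    have h3 : Measurable (fun x : ℝ × ℝ => D.G0 z x.1 + D.w * (x.2 * η x.1)) := by fun_prop
    have h1 : Measurable (fun x : ℝ × ℝ => D.g (j+1) x.1 (D.G0 z x.1 + D.w * (x.2 * η x.1))) :=
      (D.gm (j+1)).comp (measurable_fst.prodMk h3)
    have h2 : Measurable (fun x : ℝ × ℝ => ((η x.1 / e : ℝ) : ℂ) *
        Complex.exp (Complex.I * ((D.ξ * D.G0 z x.1 : ℝ) : ℂ))) := by
      fun_prop
    exact h2.mul h1
  have hsw := swap_ii (c := 1 * D.Bd) hmeas hac (fun u hu s hs =>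
    D.F_bound z (by omega) zero_le_one ((test s hs).χb u hu))
  have : D.T k c z (fun _ => 1) η j - D.T k c z (fun _ => 1) (fun _ => 0) j
      = (e : ℂ) * ∫ s in (0:ℝ)..1, D.T k c z (fun u => ((η u / e : ℝ) : ℂ)) (fun u => s * η u) (j+1) := by
    unfold T
    rw [← intervalIntegral.integral_sub i1 i2, ← hsw, ← intervalIntegral.integral_const_mul]
    congr 1
    ext u
    exact key u
  rw [this, norm_mul, Complex.norm_real, Real.norm_eq_abs, abs_of_pos he0]
  refine mul_le_mul_of_nonneg_left ?_ he0.le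
  have := intervalIntegral.norm_integral_le_of_norm_le_const (a := (0:ℝ)) (b := 1)
    (C := D.al k * D.N k c z)
    (f := fun s => D.T k c z (fun u => ((η u / e : ℝ) : ℂ)) (fun u => s * η u) (j+1)) (by
      intro s hs
      rw [uIoc_of_le zero_le_one] at hs
      exact D.T_le_N hk (test s (Ioc_subset_Icc_self hs)) hj)
  simpa using this

/-- closeness of z and z0 on the arc τ of level i -/
def Close (i : ℕ) (p : ℝ) (z z0 : ι) : Prop :=
  ∀ u ∈ Icc p (p + D.al i), |D.G0 z u - D.G0 z0 u| ≤ 4 * (D.M:ℝ)^2 * D.t ∧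
    D.al i * |D.G1 z u - D.G1 z0 u| ≤ 3 * ((D.M:ℝ)^2 * D.t)

lemma theta_est {i l : ℕ} (hi : i + 3 ≤ D.L + 3) {p : ℝ} (hp : 0 ≤ p) (hp1 : p + D.al i ≤ 1)
    {z z0 : ι} (hc : D.Close i p z z0) {χ : ℝ → ℂ} {η : ℝ → ℝ} {j : ℕ}
    (hl : l < D.M^3) (hj : j ≤ i) (hT : IsTest p (D.al i) (D.eps i) χ η) {c : ℝ}
    (hcc : c = p + l * D.al (i+3)) :
    ‖D.T (i+3) c z χ η j - χ c * Complex.exp (Complex.I * ((D.ξ * (D.G0 z c - D.G0 z0 c) : ℝ) : ℂ)) *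
      D.T (i+3) c z0 (fun _ => 1) (fun _ => 0) j‖
      ≤ (4 / D.M + D.eps (i+3)) * (D.al (i+3) * D.N (i+3) c z0) := by
  have hM := D.M0
  have hM1 := D.M1'
  have hw := D.w0
  set α := D.al i with hα
  set β := D.al (i+3) with hβ
  have hα0 : 0 < α := D.al_pos _
  have hβ0 : 0 < β := D.al_pos _
  have hαβ : α = (D.M:ℝ)^3 * β := D.al_add i 3
  obtain ⟨hs1, hs2⟩ := D.sub_arc (p := p) (i := i) hl
  rw [← hcc] at hs1 hs2
  have hsub : ∀ u ∈ Icc c (c+β), u ∈ Icc p (p+α) := fun u hu => ⟨hs1.trans hu.1, hu.2.trans hs2⟩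
  have hsub01 : Icc p (p + α) ⊆ Icc 0 1 := Icc_subset_Icc hp hp1
  have hcm : c ∈ Icc c (c+β) := ⟨le_rfl, by linarith⟩
  -- phase function
  set δ : ℝ → ℝ := fun u => D.G0 z u - D.G0 z0 u with hδ
  have hδm : Measurable δ := (D.G0m z).sub (D.G0m z0)
  have hδl : ∀ u ∈ Icc p (p+α), ∀ v ∈ Icc p (p+α), |δ u - δ v| ≤ 3 * ((D.M:ℝ)^2 * D.t) / α * |u - v| := by
    intro u hu v hv
    refine mvt_abs (f' := fun u => D.G1 z u - D.G1 z0 u) (p := p) (q := p + α) ?_ ?_ hv hu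
    · exact fun x hx => (D.jet z z0).h0 x (hsub01 hx)
    · intro x hx
      rw [le_div_iff₀ hα0, mul_comm]
      exact (hc x hx).2
  have hξ : |D.ξ| = 1 / D.t := by have := D.t0; field_simp; exact D.ξt
  set E : ℝ → ℂ := fun u => Complex.exp (Complex.I * ((D.ξ * δ u : ℝ) : ℂ)) with hE
  have hEl : ∀ u ∈ Icc p (p+α), ∀ v ∈ Icc p (p+α), ‖E u - E v‖ ≤ 3 * (D.M:ℝ)^2 / α * |u - v| := by
    intro u hu v hv
    refine (norm_e_sub _ _).trans ?_
    rw [← mul_sub, abs_mul, hξ]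
    have := hδl u hu v hv
    have ht := D.t0
    calc 1 / D.t * |δ u - δ v| ≤ 1 / D.t * (3 * ((D.M:ℝ)^2 * D.t) / α * |u - v|) := by gcongr
      _ = _ := by field_simp
  have hEm : Measurable E := by rw [hE]; fun_prop
  have hEn : ∀ u, ‖E u‖ = 1 := fun u => norm_e _
  set H : ℝ → ℂ := fun u => χ u * E u with hH
  have hHm : Measurable H := hT.χm.mul hEm
  have hHl : ∀ u ∈ Icc p (p+α), ∀ v ∈ Icc p (p+α), ‖H u - H v‖ ≤ (4 * (D.M:ℝ)^2 / α) * |u - v| := by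
    intro u hu v hv
    have e : H u - H v = (χ u - χ v) * E u + χ v * (E u - E v) := by simp only [hH]; ring
    rw [e]
    calc _ ≤ ‖χ u - χ v‖ * ‖E u‖ + ‖χ v‖ * ‖E u - E v‖ := by
          refine (norm_add_le _ _).trans ?_; rw [norm_mul, norm_mul]
      _ ≤ |u - v| / α * 1 + 1 * (3 * (D.M:ℝ)^2 / α * |u - v|) := by
          rw [hEn]
          have h1 := hT.χl u hu v hv
          have h2 := hT.χb v hv
          have h3 := hEl u hu v hv
          gcongr
      _ = (1 + 3 * (D.M:ℝ)^2) / α * |u - v| := by ring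
      _ ≤ (4 * (D.M:ℝ)^2 / α) * |u - v| := by
          have : (1:ℝ) ≤ (D.M:ℝ)^2 := one_le_pow₀ hM1
          gcongr
          linarith
  -- the new tests
  set η' : ℝ → ℝ := fun u => η u + δ u / D.w with hη'
  have hep : D.eps i + D.ep ≤ D.eps (i+3) := by
    unfold eps; push_cast; have := D.ep0; linarith
  have hep0 := D.eps_nonneg i
  have hq : 4 * (D.M:ℝ)^2 * D.t / D.w ≤ D.ep := by rw [div_le_iff₀ hw]; exact D.epw
  have hη'm : Measurable η' := hT.ηm.add (hδm.div_const _)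
  have hη'b : ∀ u ∈ Icc p (p+α), |η' u| ≤ D.eps (i+3) := by
    intro u hu
    refine (abs_add_le _ _).trans ?_
    have h1 := hT.ηb u hu
    have h2 : |δ u / D.w| ≤ 4 * (D.M:ℝ)^2 * D.t / D.w := by
      rw [abs_div, abs_of_pos hw]; have := (hc u hu).1; gcongr
    linarith
  have hη'l : ∀ u ∈ Icc p (p+α), ∀ v ∈ Icc p (p+α), |η' u - η' v| ≤ D.eps (i+3) * |u - v| / α := by
    intro u hu v hv
    have e : η' u - η' v = (η u - η v) + (δ u - δ v) / D.w := by simp only [hη']; ring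
    rw [e]
    refine (abs_add_le _ _).trans ?_
    have h1 := hT.ηl u hu v hv
    have ht := D.t0
    have h2 : |(δ u - δ v) / D.w| ≤ D.ep * |u - v| / α := by
      rw [abs_div, abs_of_pos hw]
      calc _ ≤ (3 * ((D.M:ℝ)^2 * D.t) / α * |u - v|) / D.w := by have := hδl u hu v hv; gcongr
        _ ≤ (4 * ((D.M:ℝ)^2 * D.t) / α * |u - v|) / D.w := by gcongr; norm_num
        _ = (4 * (D.M:ℝ)^2 * D.t / D.w) * |u - v| / α := by ring
        _ ≤ _ := by gcongr
    calc _ ≤ D.eps i * |u - v| / α + D.ep * |u - v| / α := add_le_add h1 h2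
      _ = (D.eps i + D.ep) * |u - v| / α := by ring
      _ ≤ _ := by gcongr
  have hβα : β ≤ α := D.al_anti (by omega)
  have hη'l2 : ∀ u ∈ Icc c (c+β), ∀ v ∈ Icc c (c+β), |η' u - η' v| ≤ D.eps (i+3) * |u - v| / β := by
    intro u hu v hv
    refine (hη'l u (hsub u hu) v (hsub v hv)).trans ?_
    have := D.eps_nonneg (i+3)
    gcongr
  set χ' : ℝ → ℂ := fun u => ((D.M / 4 : ℝ) : ℂ) * (H u - H c) with hχ'
  have hl2 : ∀ u ∈ Icc c (c+β), ∀ v ∈ Icc c (c+β), ‖H u - H v‖ ≤ 4 / D.M * (|u - v| / β) := by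
    intro u hu v hv
    refine (hHl u (hsub u hu) v (hsub v hv)).trans_eq ?_
    rw [hαβ]; field_simp
  have n4 : ‖((D.M / 4 : ℝ) : ℂ)‖ = D.M / 4 := by
    rw [Complex.norm_real, Real.norm_eq_abs, abs_of_pos (by positivity)]
  have tst : IsTest c β (D.eps (i+3)) χ' η' := by
    refine ⟨measurable_const.mul (hHm.sub measurable_const), hη'm, fun u hu => ?_, fun u hu v hv => ?_,
      fun u hu => hη'b u (hsub u hu), hη'l2⟩
    · simp only [hχ']
      rw [norm_mul, n4]
      have h1 := hl2 u hu c hcm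
      have h2 : |u - c| / β ≤ 1 := by
        rw [div_le_one hβ0, abs_of_nonneg (by linarith [hu.1])]; linarith [hu.2]
      calc (D.M:ℝ) / 4 * ‖H u - H c‖ ≤ D.M / 4 * (4 / D.M * 1) := by
            gcongr; exact h1.trans (by gcongr)
        _ = 1 := by field_simp
    · have e : χ' u - χ' v = ((D.M / 4 : ℝ) : ℂ) * (H u - H v) := by simp only [hχ']; ring
      rw [e, norm_mul, n4]
      calc (D.M:ℝ) / 4 * ‖H u - H v‖ ≤ D.M / 4 * (4 / D.M * (|u - v| / β)) := by
            have := hl2 u hu v hv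
            gcongr
        _ = _ := by field_simp
  have tst1 : IsTest c β (D.eps (i+3)) (fun _ => 1) η' := by
    refine ⟨measurable_const, hη'm, by simp, fun u hu v hv => ?_,
      fun u hu => hη'b u (hsub u hu), hη'l2⟩
    simp; positivity
  -- decomposition
  have hdec : ∀ u, D.F z χ η j u = (4 / D.M : ℂ) * D.F z0 χ' η' j u + H c * D.F z0 (fun _ => 1) η' j u := by
    intro u
    have harg : D.G0 z u + D.w * η u = D.G0 z0 u + D.w * η' u := by
      simp only [hη', hδ]; field_simp; ring
    have hM' : (D.M : ℂ) ≠ 0 := by exact_mod_cast hM.ne'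
    have hexp : Complex.exp (Complex.I * ((D.ξ * D.G0 z u : ℝ) : ℂ))
        = E u * Complex.exp (Complex.I * ((D.ξ * D.G0 z0 u : ℝ) : ℂ)) := by
      simp only [hE, hδ]; rw [← Complex.exp_add]; congr 1; push_cast; ring
    simp only [F]
    rw [harg, hexp]
    simp only [hχ', hH]
    push_cast
    field_simp
    ring
  have hcle : c ≤ c + β := by linarith
  have i1 := D.F_ii z0 tst.χm tst.ηm (j := j) (by omega) zero_le_one hcle tst.χb
  have i2 := D.F_ii z0 tst1.χm tst1.ηm (j := j) (by omega) zero_le_one hcle tst1.χb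
  have hTd : D.T (i+3) c z χ η j = (4 / D.M : ℂ) * D.T (i+3) c z0 χ' η' j
      + H c * D.T (i+3) c z0 (fun _ => 1) η' j := by
    unfold T
    rw [← intervalIntegral.integral_const_mul, ← intervalIntegral.integral_const_mul,
      ← intervalIntegral.integral_add (i1.const_mul _) (i2.const_mul _)]
    congr 1
    ext u
    exact hdec u
  have hHc : ‖H c‖ ≤ 1 := by
    simp only [hH]; rw [norm_mul, hEn, mul_one]; exact hT.χb c (hsub c hcm)
  have hN0 : 0 ≤ D.al (i+3) * D.N (i+3) c z0 := mul_nonneg hβ0.le D.N_nonneg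
  have b1 := D.T_le_N (z := z0) hi tst (j := j) (by omega)
  have b2 := D.err2 (z := z0) hi (by omega) (j := j) (by omega) tst1
  have e : D.T (i+3) c z χ η j - χ c * Complex.exp (Complex.I * ((D.ξ * (D.G0 z c - D.G0 z0 c) : ℝ) : ℂ)) *
      D.T (i+3) c z0 (fun _ => 1) (fun _ => 0) j
      = (4 / D.M : ℂ) * D.T (i+3) c z0 χ' η' j + H c * (D.T (i+3) c z0 (fun _ => 1) η' j
        - D.T (i+3) c z0 (fun _ => 1) (fun _ => 0) j) := by
    rw [hTd]; simp only [hH, hE, hδ]; ring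
  rw [e]
  have n5 : ‖(4 / D.M : ℂ)‖ = 4 / D.M := by
    rw [norm_div, Complex.norm_natCast]; simp
  calc _ ≤ 4 / D.M * ‖D.T (i+3) c z0 χ' η' j‖ + ‖H c‖ * ‖D.T (i+3) c z0 (fun _ => 1) η' j
        - D.T (i+3) c z0 (fun _ => 1) (fun _ => 0) j‖ := by
        refine (norm_add_le _ _).trans ?_; rw [norm_mul, norm_mul, n5]
    _ ≤ 4 / D.M * (D.al (i+3) * D.N (i+3) c z0) + 1 * (D.eps (i+3) * (D.al (i+3) * D.N (i+3) c z0)) := by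
        gcongr
    _ = _ := by ring

end PD
end MW

namespace MW
open MeasureTheory Metric Set

lemma exists_unimod (x : ℂ) : ∃ ω : ℂ, ‖ω‖ = 1 ∧ ω * x = (‖x‖ : ℂ) := by
  by_cases hx : x = 0
  · exact ⟨1, by simp, by simp [hx]⟩
  · have h : (‖x‖ : ℂ) ≠ 0 := by simpa using hx
    refine ⟨(‖x‖ : ℂ) / x, ?_, by field_simp⟩
    rw [norm_div, Complex.norm_real, norm_norm, div_self (by simpa using hx)]

lemma tt_star {ι : Type} (V : Finset ι) (Λ : Finset ℕ) (e : ι → ℕ → ℂ) (b : ℕ → ℂ) {lam : ℝ}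
    (hlam : 0 ≤ lam)
    (hb : ∀ l ∈ Λ, ‖b l‖ ≤ 1) (h : ∀ z ∈ V, lam * Λ.card ≤ ‖∑ l ∈ Λ, e z l * b l‖) :
    (V.card : ℝ)^2 * lam^2 * Λ.card ≤
      ∑ z ∈ V, ∑ z' ∈ V, ‖∑ l ∈ Λ, e z l * (starRingEnd ℂ) (e z' l)‖ := by
  choose ω hω1 hω using fun z => exists_unimod (∑ l ∈ Λ, e z l * b l)
  set A : ℕ → ℂ := fun l => ∑ z ∈ V, ω z * e z l with hA
  have h1 : (V.card : ℝ) * lam * Λ.card ≤ ∑ l ∈ Λ, ‖A l‖ := by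
    have e1 : ((∑ z ∈ V, ‖∑ l ∈ Λ, e z l * b l‖ : ℝ) : ℂ) = ∑ l ∈ Λ, A l * b l := by
      push_cast
      simp only [hA, Finset.sum_mul]
      rw [Finset.sum_comm]
      apply Finset.sum_congr rfl
      intro z _
      rw [← hω z, Finset.mul_sum]
      exact Finset.sum_congr rfl fun l _ => by ring
    have e2 : (∑ z ∈ V, ‖∑ l ∈ Λ, e z l * b l‖ : ℝ) = ‖∑ l ∈ Λ, A l * b l‖ := by
      rw [← e1, Complex.norm_real, Real.norm_eq_abs, abs_of_nonneg]
      exact Finset.sum_nonneg fun _ _ => norm_nonneg _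
    calc (V.card : ℝ) * lam * Λ.card = ∑ z ∈ V, lam * Λ.card := by
          rw [Finset.sum_const, nsmul_eq_mul]; ring
      _ ≤ _ := Finset.sum_le_sum h
      _ = _ := e2
      _ ≤ ∑ l ∈ Λ, ‖A l * b l‖ := norm_sum_le _ _
      _ ≤ _ := by
        apply Finset.sum_le_sum
        intro l hl
        rw [norm_mul]
        exact mul_le_of_le_one_right (norm_nonneg _) (hb l hl)
  have h2 : (∑ l ∈ Λ, ‖A l‖)^2 ≤ Λ.card * ∑ l ∈ Λ, ‖A l‖^2 := sq_sum_le_card_mul_sum_sq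
  have h3 : (∑ l ∈ Λ, ‖A l‖^2) ≤ ∑ z ∈ V, ∑ z' ∈ V, ‖∑ l ∈ Λ, e z l * (starRingEnd ℂ) (e z' l)‖ := by
    have e1 : ((∑ l ∈ Λ, ‖A l‖^2 : ℝ) : ℂ) = ∑ z ∈ V, ∑ z' ∈ V,
        ω z * (starRingEnd ℂ) (ω z') * ∑ l ∈ Λ, e z l * (starRingEnd ℂ) (e z' l) := by
      push_cast
      have : ∀ l, ((‖A l‖ : ℂ)^2) = ∑ z ∈ V, ∑ z' ∈ V,
          ω z * (starRingEnd ℂ) (ω z') * (e z l * (starRingEnd ℂ) (e z' l)) := by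
        intro l
        rw [← Complex.mul_conj']
        simp only [hA, map_sum, map_mul]
        rw [Finset.sum_mul_sum]
        exact Finset.sum_congr rfl fun z _ => Finset.sum_congr rfl fun z' _ => by ring
      simp only [this]
      rw [Finset.sum_comm]
      refine Finset.sum_congr rfl fun z _ => ?_
      rw [Finset.sum_comm]
      refine Finset.sum_congr rfl fun z' _ => ?_
      rw [Finset.mul_sum]
    have e2 : (∑ l ∈ Λ, ‖A l‖^2 : ℝ) = ‖∑ z ∈ V, ∑ z' ∈ V,
        ω z * (starRingEnd ℂ) (ω z') * ∑ l ∈ Λ, e z l * (starRingEnd ℂ) (e z' l)‖ := by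
      rw [← e1, Complex.norm_real, Real.norm_eq_abs, abs_of_nonneg]
      exact Finset.sum_nonneg fun _ _ => by positivity
    rw [e2]
    refine (norm_sum_le _ _).trans (Finset.sum_le_sum fun z _ => (norm_sum_le _ _).trans
      (Finset.sum_le_sum fun z' _ => ?_))
    rw [norm_mul, norm_mul, hω1, RCLike.norm_conj, hω1, one_mul, one_mul]
  rcases Nat.eq_zero_or_pos Λ.card with h0 | h0
  · rw [h0]; simp only [Nat.cast_zero, mul_zero]
    exact Finset.sum_nonneg fun _ _ => Finset.sum_nonneg fun _ _ => norm_nonneg _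
  · have hc : (0:ℝ) < Λ.card := by exact_mod_cast h0
    refine le_trans ?_ h3
    have h4 : ((V.card : ℝ) * lam * Λ.card)^2 ≤ Λ.card * ∑ l ∈ Λ, ‖A l‖^2 :=
      (pow_le_pow_left₀ (by positivity) h1 2).trans h2
    have h5 : (Λ.card : ℝ) * ((V.card : ℝ)^2 * lam^2 * Λ.card) ≤ Λ.card * ∑ l ∈ Λ, ‖A l‖^2 := by
      calc _ = ((V.card : ℝ) * lam * Λ.card)^2 := by ring
        _ ≤ _ := h4
    exact le_of_mul_le_mul_left h5 hc

lemma tt_count {ι : Type} (V : Finset ι) (Λ : Finset ℕ) (e : ι → ℕ → ℂ) (b : ℕ → ℂ) {lam Kn : ℝ}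
    (hlam : 0 < lam) (hΛ : 0 < Λ.card) (hKn : 0 ≤ Kn)
    (hb : ∀ l ∈ Λ, ‖b l‖ ≤ 1) (h : ∀ z ∈ V, lam * Λ.card ≤ ‖∑ l ∈ Λ, e z l * b l‖)
    (he : ∀ z l, ‖e z l‖ ≤ 1)
    (near : ι → ι → Prop) (hfar : ∀ z ∈ V, ∀ z' ∈ V, ¬ near z z' →
      ‖∑ l ∈ Λ, e z l * (starRingEnd ℂ) (e z' l)‖ ≤ lam^2 / 2 * Λ.card)
    (hnear : ∀ z ∈ V, ∀ W ⊆ V, (∀ z' ∈ W, near z z') → (W.card : ℝ) ≤ Kn) :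
    (V.card : ℝ) ≤ 2 * Kn / lam^2 := by
  classical
  have h1 := tt_star V Λ e b hlam.le hb h
  have hc : (0:ℝ) < Λ.card := by exact_mod_cast hΛ
  have hall : ∀ z z', ‖∑ l ∈ Λ, e z l * (starRingEnd ℂ) (e z' l)‖ ≤ Λ.card := by
    intro z z'
    refine (norm_sum_le _ _).trans ?_
    calc _ ≤ ∑ l ∈ Λ, (1:ℝ) := by
          apply Finset.sum_le_sum
          intro l _
          rw [norm_mul, RCLike.norm_conj]
          exact mul_le_one₀ (he _ _) (norm_nonneg _) (he _ _)
      _ = _ := by simp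
  have h2 : ∀ z ∈ V, ∑ z' ∈ V, ‖∑ l ∈ Λ, e z l * (starRingEnd ℂ) (e z' l)‖
      ≤ Kn * Λ.card + V.card * (lam^2 / 2 * Λ.card) := by
    intro z hz
    rw [← Finset.sum_filter_add_sum_filter_not V (near z)]
    apply add_le_add
    · calc _ ≤ ∑ z' ∈ V.filter (near z), (Λ.card : ℝ) := Finset.sum_le_sum fun z' _ => hall z z'
        _ = (V.filter (near z)).card * (Λ.card : ℝ) := by rw [Finset.sum_const, nsmul_eq_mul]
        _ ≤ _ := by
          gcongr
          exact hnear z hz _ (Finset.filter_subset _ _) (fun z' hz' => (Finset.mem_filter.1 hz').2)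
    · calc _ ≤ ∑ z' ∈ V.filter (fun a => ¬ near z a), (lam^2 / 2 * Λ.card : ℝ) := by
            apply Finset.sum_le_sum
            intro z' hz'
            rw [Finset.mem_filter] at hz'
            exact hfar z hz z' hz'.1 hz'.2
        _ = (V.filter (fun a => ¬ near z a)).card * (lam^2 / 2 * Λ.card : ℝ) := by
            rw [Finset.sum_const, nsmul_eq_mul]
        _ ≤ _ := by
          gcongr
          exact Finset.filter_subset _ _
  have h3 := h1.trans (Finset.sum_le_sum h2)
  rw [Finset.sum_const, nsmul_eq_mul] at h3
  rcases Nat.eq_zero_or_pos V.card with h0 | h0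
  · rw [h0]; simp; positivity
  · have hv : (0:ℝ) < V.card := by exact_mod_cast h0
    rw [le_div_iff₀ (by positivity)]
    have h4 : (V.card * Λ.card : ℝ) * (V.card * lam^2) ≤ (V.card * Λ.card : ℝ) * (Kn + V.card * lam^2 / 2) := by
      nlinarith
    have h5 := le_of_mul_le_mul_left h4 (by positivity)
    linarith

namespace PD
variable {ι : Type} (D : PD ι)

lemma floor_close {x y R : ℝ} (h : |x - y| ≤ R) : |⌊x⌋ - ⌊y⌋| < R + 1 := by
  have h1 := Int.floor_le x
  have h2 := Int.lt_floor_add_one x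
  have h3 := Int.floor_le y
  have h4 := Int.lt_floor_add_one y
  rw [abs_le] at h
  push_cast
  rw [abs_lt]
  constructor <;> linarith [h.1, h.2]

lemma card_box {i : ℕ} {p : ℝ} (Y : Finset ι) (hY : InjOn (D.cell i p) Y) (z0 : ι) (R : ℕ)
    (h : ∀ z ∈ Y, |D.G0 z p - D.G0 z0 p| ≤ R * D.t ∧ D.al i * |D.G1 z p - D.G1 z0 p| ≤ R * D.t ∧
      D.al i ^ 2 * |D.G2 z p - D.G2 z0 p| ≤ R * D.t) :
    Y.card ≤ (2 * R + 1)^3 := by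
  have ht := D.t0
  have hal := D.al_pos i
  have fc : ∀ x y : ℝ, |x - y| ≤ R * D.t → |⌊x / D.t⌋ - ⌊y / D.t⌋| ≤ R := by
    intro x y hxy
    have h1 : |x / D.t - y / D.t| ≤ R := by
      rw [← sub_div, abs_div, abs_of_pos ht, div_le_iff₀ ht]; exact hxy
    have h2 := floor_close h1
    have : |⌊x / D.t⌋ - ⌊y / D.t⌋| < (R:ℤ) + 1 := by exact_mod_cast h2
    omega
  set c := D.cell i p z0 with hc
  set box : Finset (ℤ × ℤ × ℤ) := (Finset.Icc (c.1 - R) (c.1 + R)) ×ˢ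
    ((Finset.Icc (c.2.1 - R) (c.2.1 + R)) ×ˢ (Finset.Icc (c.2.2 - R) (c.2.2 + R))) with hbox
  have hcard : box.card = (2 * R + 1)^3 := by
    simp only [hbox, Finset.card_product, Int.card_Icc]
    have : ∀ a : ℤ, (a + R + 1 - (a - R)).toNat = 2 * R + 1 := by intro a; omega
    rw [this, this, this]; ring
  rw [← hcard]
  apply Finset.card_le_card_of_injOn (D.cell i p) _ hY
  intro z hz
  obtain ⟨h1, h2, h3⟩ := h z hz
  have k1 := fc _ _ h1
  have k2 := fc (D.al i * D.G1 z p) (D.al i * D.G1 z0 p) (by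
    rw [← mul_sub, abs_mul, abs_of_pos hal]; exact h2)
  have k3 := fc (D.al i ^ 2 * D.G2 z p) (D.al i ^ 2 * D.G2 z0 p) (by
    rw [← mul_sub, abs_mul, abs_of_pos (by positivity)]; exact h3)
  rw [abs_le] at k1 k2 k3
  simp only [hbox, hc, cell, Finset.coe_product, Finset.coe_Icc, Set.mem_prod, Set.mem_Icc]
  refine ⟨⟨?_, ?_⟩, ⟨?_, ?_⟩, ?_, ?_⟩ <;> linarith [k1.1, k1.2, k2.1, k2.2, k3.1, k3.2]

lemma cell_eq {i : ℕ} {p : ℝ} {z z0 : ι} (h : D.cell i p z = D.cell i p z0) :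
    |D.G0 z p - D.G0 z0 p| ≤ D.t ∧ D.al i * |D.G1 z p - D.G1 z0 p| ≤ D.t ∧
      D.al i ^ 2 * |D.G2 z p - D.G2 z0 p| ≤ D.t := by
  have ht := D.t0
  have hal := D.al_pos i
  have fc : ∀ x y : ℝ, ⌊x / D.t⌋ = ⌊y / D.t⌋ → |x - y| ≤ D.t := by
    intro x y hxy
    have := Int.abs_sub_lt_one_of_floor_eq_floor hxy
    rw [← sub_div, abs_div, abs_of_pos ht, div_lt_one ht] at this
    exact this.le
  simp only [cell, Prod.mk.injEq] at h
  refine ⟨fc _ _ h.1, ?_, ?_⟩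
  · have := fc _ _ h.2.1
    rwa [← mul_sub, abs_mul, abs_of_pos hal] at this
  · have := fc _ _ h.2.2
    rwa [← mul_sub, abs_mul, abs_of_pos (by positivity)] at this

/-- consequences of sharing a cell at level `i+k` on a subarc of the level `i` arc -/
lemma close_of_cell {i k l : ℕ} {p : ℝ} (hp : 0 ≤ p) (hp1 : p + D.al i ≤ 1)
    (hl : l < D.M^k) {z z0 : ι}
    (h : D.cell (i+k) (p + l * D.al (i+k)) z = D.cell (i+k) (p + l * D.al (i+k)) z0) :
    ∀ u ∈ Icc p (p + D.al i), |D.G0 z u - D.G0 z0 u| ≤ 4 * (((D.M:ℝ)^k)^2 * D.t) ∧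
      D.al i * |D.G1 z u - D.G1 z0 u| ≤ 3 * (((D.M:ℝ)^k)^2 * D.t) ∧
      D.al i ^ 2 * |D.G2 z u - D.G2 z0 u| ≤ 2 * (((D.M:ℝ)^k)^2 * D.t) := by
  obtain ⟨h0, h1, h2⟩ := D.cell_eq h
  have ht := D.t0
  have hM := D.M0
  have hMk : (1:ℝ) ≤ (D.M:ℝ)^k := one_le_pow₀ D.M1'
  obtain ⟨hs1, hs2⟩ := D.sub_arc (p := p) (i := i) hl
  set c := p + l * D.al (i+k) with hc
  have hβ := D.al_pos (i+k)
  have hα := D.al_add i k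
  have hα0 := D.al_pos i
  have J := (D.jet z z0).mono (p' := p) (q' := p + D.al i) (Icc_subset_Icc hp hp1)
  have hb := J.bounds (α := D.al i) (D := ((D.M:ℝ)^k)^2 * D.t) (c := c) (by ring) hα0
    (D.al_le_one i) ⟨hs1, by linarith⟩ (by
      calc D.al i * |D.G1 z c - D.G1 z0 c| = (D.M:ℝ)^k * (D.al (i+k) * |D.G1 z c - D.G1 z0 c|) := by
            rw [hα]; ring
        _ ≤ (D.M:ℝ)^k * D.t := by gcongr
        _ ≤ ((D.M:ℝ)^k)^2 * D.t := by gcongr; nlinarith) (by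
      calc D.al i ^ 2 * |D.G2 z c - D.G2 z0 c|
          = ((D.M:ℝ)^k)^2 * (D.al (i+k) ^ 2 * |D.G2 z c - D.G2 z0 c|) := by
            rw [hα]; ring
        _ ≤ ((D.M:ℝ)^k)^2 * D.t := by gcongr)
  intro u hu
  obtain ⟨k2, k1, k0, -⟩ := hb u hu
  refine ⟨?_, k1, k2⟩
  have h3 : |D.G0 z u - D.G0 z0 u| ≤ |D.G0 z c - D.G0 z0 c| +
      |(D.G0 z u - D.G0 z0 u) - (D.G0 z c - D.G0 z0 c)| := by
    have := abs_add_le (D.G0 z c - D.G0 z0 c) ((D.G0 z u - D.G0 z0 u) - (D.G0 z c - D.G0 z0 c))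
    simpa using this
  have h4 : D.t ≤ ((D.M:ℝ)^k)^2 * D.t := by
    have : 1 ≤ ((D.M:ℝ)^k)^2 := one_le_pow₀ hMk
    nlinarith
  linarith

end PD
end MW

namespace MW
open MeasureTheory Metric Set
namespace PD
variable {ι : Type} (D : PD ι)

lemma e_cont_ii {z z0 : ι} {a b : ℝ} (_ha : 0 ≤ a) (hab : a ≤ b) (_hb : b ≤ 1) :
    IntervalIntegrable (fun u => Complex.exp (Complex.I * ((D.ξ * (D.G0 z u - D.G0 z0 u) : ℝ) : ℂ)))
      volume a b := by
  have h1 := D.G0m z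
  have h2 := D.G0m z0
  apply ii_of_bdd (c := 1) (by fun_prop) hab
  intro u _
  exact (norm_e _).le

lemma block_far {i k m S : ℕ} {p : ℝ} (hp : 0 ≤ p) (hp1 : p + D.al i ≤ 1) {z z' : ι}
    (hc : D.Close i p z z') (hmS : D.M^3 = m^2 * S) (hk : k < m^2) {K : ℝ} (hK : 1 ≤ K)
    (hfar : K^3 * D.t ≤ max (D.al i * |D.G1 z p - D.G1 z' p|) (D.al i ^ 2 * |D.G2 z p - D.G2 z' p|)) :
    ‖∑ l ∈ Finset.Ico (k*S) (k*S+S), Complex.exp (Complex.I *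
      ((D.ξ * (D.G0 z (p + l * D.al (i+3)) - D.G0 z' (p + l * D.al (i+3))) : ℝ) : ℂ))‖
      ≤ S * (3 / D.M + 290 * m^2 / K) := by
  have hM := D.M0
  have ht := D.t0
  set α := D.al i with hα
  set β := D.al (i+3) with hβ
  have hα0 : 0 < α := D.al_pos _
  have hβ0 : 0 < β := D.al_pos _
  have hαβ : α = (D.M:ℝ)^3 * β := D.al_add i 3
  have hmS' : (D.M:ℝ)^3 = (m:ℝ)^2 * S := by exact_mod_cast hmS
  set e : ℝ → ℂ := fun u => Complex.exp (Complex.I * ((D.ξ * (D.G0 z u - D.G0 z' u) : ℝ) : ℂ)) with he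
  have hsub01 : Icc p (p + α) ⊆ Icc 0 1 := Icc_subset_Icc hp hp1
  have hξ : |D.ξ| = 1 / D.t := by field_simp; exact D.ξt
  have hel : ∀ u ∈ Icc p (p+α), ∀ v ∈ Icc p (p+α), ‖e u - e v‖ ≤ 3 * (D.M:ℝ)^2 / α * |u - v| := by
    intro u hu v hv
    refine (norm_e_sub _ _).trans ?_
    rw [← mul_sub, abs_mul, hξ]
    have : |(D.G0 z u - D.G0 z' u) - (D.G0 z v - D.G0 z' v)| ≤ 3 * ((D.M:ℝ)^2 * D.t) / α * |u - v| := by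
      refine mvt_abs (f := fun u => D.G0 z u - D.G0 z' u) (f' := fun u => D.G1 z u - D.G1 z' u)
        (p := p) (q := p + α) ?_ ?_ hv hu
      · exact fun x hx => (D.jet z z').h0 x (hsub01 hx)
      · intro x hx
        rw [le_div_iff₀ hα0, mul_comm]
        exact (hc x hx).2
    calc _ ≤ 1 / D.t * (3 * ((D.M:ℝ)^2 * D.t) / α * |u - v|) := by gcongr
      _ = _ := by field_simp
  set a : ℕ → ℝ := fun l => p + l * β with ha
  have ha1 : ∀ l, a (l+1) = a l + β := fun l => by simp only [ha]; push_cast; ring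
  have hain : ∀ l, l ≤ D.M^3 → a l ∈ Icc p (p+α) := by
    intro l hl
    have : (l:ℝ) ≤ (D.M:ℝ)^3 := by exact_mod_cast hl
    simp only [ha]
    refine ⟨by have : (0:ℝ) ≤ l * β := by positivity
               linarith, ?_⟩
    rw [hαβ]; gcongr
  have hkS : k*S+S ≤ D.M^3 := by
    rw [hmS]; calc k*S+S = (k+1)*S := by ring
      _ ≤ _ := Nat.mul_le_mul_right _ hk
  have h_int := intervalIntegral.sum_integral_adjacent_intervals_Ico (f := e) (μ := volume)
    (a := a) (m := k*S) (n := k*S+S) (by omega) (by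
      intro l hl
      have hl2 : l + 1 ≤ D.M^3 := by have := hl.2; omega
      apply D.e_cont_ii (hsub01 (hain l (by omega))).1 (by rw [ha1]; linarith)
        (hsub01 (hain (l+1) hl2)).2)
  have hdiff : ∀ l ∈ Finset.Ico (k*S) (k*S+S), ‖(β:ℂ) * e (a l) - ∫ u in a l..a (l+1), e u‖ ≤ 3 / D.M * β := by
    intro l hl
    rw [Finset.mem_Ico] at hl
    have hl2 : l + 1 ≤ D.M^3 := by omega
    have hle : a l ≤ a (l+1) := by rw [ha1]; linarith
    have h1 : (β:ℂ) * e (a l) = ∫ u in a l..a (l+1), e (a l) := by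
      rw [intervalIntegral.integral_const, ha1, add_sub_cancel_left, Complex.real_smul]
    rw [h1, ← intervalIntegral.integral_sub (by simp)
      (D.e_cont_ii (hsub01 (hain l (by omega))).1 hle (hsub01 (hain (l+1) hl2)).2)]
    have := intervalIntegral.norm_integral_le_of_norm_le_const (a := a l) (b := a (l+1)) (C := 3 / D.M)
      (f := fun u => e (a l) - e u) (by
        intro u hu
        rw [uIoc_of_le hle] at hu
        have hu2 : u ∈ Icc p (p+α) := ⟨(hain l (by omega)).1.trans hu.1.le, hu.2.trans (hain (l+1) hl2).2⟩
        refine (hel _ (hain l (by omega)) _ hu2).trans ?_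
        have h5 : |a l - u| ≤ β := by
          rw [abs_sub_comm, abs_of_nonneg (by linarith [hu.1])]; rw [ha1] at hu; linarith [hu.2]
        calc _ ≤ 3 * (D.M:ℝ)^2 / α * β := by gcongr
          _ = _ := by rw [hαβ]; field_simp)
    refine this.trans_eq ?_
    rw [ha1, add_sub_cancel_left, abs_of_pos hβ0]
  have J := (D.jet z z').mono (p' := p) (q' := p + α) hsub01
  have hv := J.vdc (α := α) (t := D.t) (ξ := D.ξ) (K := K) (a := a (k*S)) (b := a (k*S+S)) (by ring) hα0
    (D.al_le_one i) rfl ht D.ξt hK hfar (hain _ (by omega)).1 (by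
      simp only [ha]; push_cast; nlinarith [show (0:ℝ) ≤ S * β by positivity]) (hain _ hkS).2
  rw [← h_int] at hv
  have h6 : ‖∑ l ∈ Finset.Ico (k*S) (k*S+S), (β:ℂ) * e (a l)‖ ≤ S * (3 / D.M * β) + 290 * α / K := by
    have : ∑ l ∈ Finset.Ico (k*S) (k*S+S), (β:ℂ) * e (a l)
      = ∑ l ∈ Finset.Ico (k*S) (k*S+S), ((β:ℂ) * e (a l) - ∫ u in a l..a (l+1), e u)
        + ∑ l ∈ Finset.Ico (k*S) (k*S+S), ∫ u in a l..a (l+1), e u := by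
      rw [← Finset.sum_add_distrib]; simp
    rw [this]
    refine (norm_add_le _ _).trans (add_le_add ?_ hv)
    refine (norm_sum_le _ _).trans ((Finset.sum_le_sum hdiff).trans_eq ?_)
    rw [Finset.sum_const, nsmul_eq_mul, Nat.card_Ico, Nat.add_sub_cancel_left]
  rw [← Finset.mul_sum, norm_mul, Complex.norm_real, Real.norm_eq_abs, abs_of_pos hβ0] at h6
  have h7 : β * ‖∑ l ∈ Finset.Ico (k*S) (k*S+S), e (a l)‖ ≤ β * (S * (3 / D.M + 290 * m^2 / K)) := by
    refine h6.trans_eq ?_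
    rw [hαβ, hmS']; ring
  exact le_of_mul_le_mul_left h7 hβ0

/-- near count -/
lemma near_count {i l0 : ℕ} {p : ℝ} (hp : 0 ≤ p) (hp1 : p + D.al i ≤ 1) (hl0 : l0 < D.M)
    {K : ℕ} (hK : 1 ≤ K) {z : ι} (W : Finset ι) (hW : InjOn (D.cell i p) W)
    (hcell : ∀ z' ∈ W, D.cell (i+1) (p + l0 * D.al (i+1)) z' = D.cell (i+1) (p + l0 * D.al (i+1)) z)
    (hnear : ∀ z' ∈ W, max (D.al i * |D.G1 z p - D.G1 z' p|) (D.al i ^ 2 * |D.G2 z p - D.G2 z' p|)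
      < (K:ℝ)^3 * D.t) : W.card ≤ (9 * K^3)^3 := by
  have ht := D.t0
  have hK3 : 1 ≤ K^3 := Nat.one_le_pow _ _ hK
  have hK3' : (1:ℝ) ≤ (K:ℝ)^3 := by exact_mod_cast hK3
  refine (D.card_box W hW z (4 * K^3) ?_).trans (Nat.pow_le_pow_left (by omega) 3)
  intro z' hz'
  have hn := hnear z' hz'
  rw [max_lt_iff] at hn
  have n1 := hn.1.le
  have n2 := hn.2.le
  rw [abs_sub_comm] at n1 n2
  push_cast
  have hKt : 0 < (K:ℝ)^3 * D.t := by positivity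
  have J := (D.jet z' z).mono (p' := p) (q' := p + D.al i) (Icc_subset_Icc hp hp1)
  have hα0 := D.al_pos i
  have hb := J.bounds (α := D.al i) (D := (K:ℝ)^3 * D.t) (c := p) (by ring) hα0
    (D.al_le_one i) ⟨le_rfl, by linarith⟩ n1 n2
  obtain ⟨hs1, hs2⟩ := D.sub_arc (p := p) (i := i) (k := 1) (l := l0) (by simpa using hl0)
  have hβ0 := D.al_pos (i+1)
  obtain ⟨-, -, h0, -⟩ := hb (p + l0 * D.al (i+1)) ⟨hs1, by linarith⟩
  obtain ⟨k0, -, -⟩ := D.cell_eq (hcell z' hz')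
  refine ⟨?_, by linarith, by linarith⟩
  rw [abs_le] at h0 k0 ⊢
  constructor <;> nlinarith [h0.1, h0.2, k0.1, k0.2]

/-- the count of large points -/
lemma big_count {i l0 m S : ℕ} (hi : i + 3 ≤ D.L + 3) {p : ℝ} (hp : 0 ≤ p) (hp1 : p + D.al i ≤ 1)
    (hl0 : l0 < D.M) (hm : 2 ≤ m) (hmS : D.M^3 = m^2 * S) (hmM : 48 * m^2 ≤ D.M)
    (heps : 4 / D.M + D.eps (i+3) ≤ 1 / (2 * m)) {z0 : ι} {mU : ℝ} (hmU : 0 < mU)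
    (hN : ∀ l < D.M^3, D.N (i+3) (p + l * D.al (i+3)) z0 ≤ mU)
    (Y : Finset ι) (hY : InjOn (D.cell i p) Y)
    (hcell : ∀ z ∈ Y, D.cell (i+1) (p + l0 * D.al (i+1)) z = D.cell (i+1) (p + l0 * D.al (i+1)) z0)
    (hbig : ∀ z ∈ Y, 2 * mU / m < D.N i p z) :
    (Y.card : ℝ) ≤ (i+1) * m^2 * (8 * m^2 * (9 * (4640 * m^4 : ℕ)^3)^3) := by
  classical
  have hM := D.M0
  have ht := D.t0
  set α := D.al i with hα
  set β := D.al (i+3) with hβ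
  have hα0 : 0 < α := D.al_pos _
  have hβ0 : 0 < β := D.al_pos _
  have hαβ : α = (D.M:ℝ)^3 * β := D.al_add i 3
  have hmS' : (D.M:ℝ)^3 = (m:ℝ)^2 * S := by exact_mod_cast hmS
  have hm0 : (0:ℝ) < m := by positivity
  have hm2 : (2:ℝ) ≤ m := by exact_mod_cast hm
  have hS : 0 < S := by
    rcases Nat.eq_zero_or_pos S with h | h
    · rw [h, mul_zero] at hmS
      have := D.M4
      have h2 : 0 < D.M^3 := by positivity
      omega
    · exact h
  have hS0 : (0:ℝ) < S := by exact_mod_cast hS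
  set c : ℕ → ℝ := fun l => p + l * β with hcdef
  have hclose : ∀ z z', D.cell (i+1) (p + l0 * D.al (i+1)) z = D.cell (i+1) (p + l0 * D.al (i+1)) z' →
      D.Close i p z z' := by
    intro z z' h u hu
    obtain ⟨h1, h2, -⟩ := D.close_of_cell (k := 1) (l := l0) hp hp1 (by simpa using hl0) h u hu
    rw [pow_one] at h1 h2
    exact ⟨by linarith, h2⟩
  set E : ι → ℕ → ℂ := fun z l => Complex.exp (Complex.I * ((D.ξ * (D.G0 z (c l) - D.G0 z0 (c l)) : ℝ) : ℂ)) with hE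
  set b : ℕ → ℕ → ℂ := fun j l => D.T (i+3) (c l) z0 (fun _ => 1) (fun _ => 0) j / ((β * mU : ℝ) : ℂ) with hb
  have hbm : (((β * mU : ℝ)) : ℂ) ≠ 0 := by exact_mod_cast (mul_pos hβ0 hmU).ne'
  have hbb : ∀ j ≤ i, ∀ l < D.M^3, ‖b j l‖ ≤ 1 := by
    intro j hj l hl
    simp only [hb]
    rw [norm_div, Complex.norm_real, Real.norm_eq_abs, abs_of_pos (mul_pos hβ0 hmU),
      div_le_one (mul_pos hβ0 hmU)]
    refine (D.T_le_N hi (D.zero_test _ _) (by omega)).trans ?_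
    exact mul_le_mul_of_nonneg_left (hN l hl) hβ0.le
  set V : ℕ × ℕ → Finset ι := fun jk => Y.filter fun z =>
    1 / (2 * (m:ℝ)) * S ≤ ‖∑ l ∈ Finset.Ico (jk.2 * S) (jk.2 * S + S), E z l * b jk.1 l‖ with hV
  have hblk : ∀ k < m^2, k*S+S ≤ D.M^3 := by
    intro k hk
    rw [hmS]; calc k*S+S = (k+1)*S := by ring
      _ ≤ _ := Nat.mul_le_mul_right _ hk
  -- every point lies in some V
  have hcover : Y ⊆ ((Finset.range (i+1)) ×ˢ (Finset.range (m^2))).biUnion V := by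
    intro z hz
    have hcl := hclose z z0 (hcell z hz)
    obtain ⟨χ, η, j, hT, hj, hlt⟩ := D.exists_of_lt_N (hbig z hz)
    rw [Finset.mem_biUnion]
    by_contra! hcon
    have hsmall : ∀ k < m^2, ‖∑ l ∈ Finset.Ico (k * S) (k * S + S), E z l * b j l‖ < 1 / (2 * (m:ℝ)) * S := by
      intro k hk
      have := hcon (j, k) (by simp; omega)
      simp only [hV, Finset.mem_filter, not_and, not_le] at this
      exact this hz
    have hsplit := D.T_split (z := z) (k := 3) (j := j) (by omega) hT
    have hcin : ∀ l < D.M^3, c l ∈ Icc p (p+α) := by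
      intro l hl
      obtain ⟨h1, h2⟩ := D.sub_arc (p := p) (i := i) hl
      exact ⟨h1, by linarith⟩
    have hb1 : ‖D.T i p z χ η j - ∑ l ∈ Finset.range (D.M^3), χ (c l) * E z l *
        D.T (i+3) (c l) z0 (fun _ => 1) (fun _ => 0) j‖ ≤ (1 / (2 * m)) * (α * mU) := by
      rw [hsplit, ← Finset.sum_sub_distrib]
      refine (norm_sum_le _ _).trans ?_
      calc _ ≤ ∑ l ∈ Finset.range (D.M^3), (1 / (2 * m)) * (β * mU) := by
            apply Finset.sum_le_sum
            intro l hl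
            rw [Finset.mem_range] at hl
            refine (D.theta_est hi hp hp1 hcl hl hj hT rfl).trans ?_
            have h0 : 0 ≤ D.N (i+3) (c l) z0 := D.N_nonneg
            have h1 : 0 ≤ 4 / D.M + D.eps (i+3) := by have := D.eps_nonneg (i+3); positivity
            have := hN l hl
            gcongr
        _ = _ := by
            rw [Finset.sum_const, nsmul_eq_mul, Finset.card_range, hαβ]; push_cast; ring
    have hb2 : ∑ l ∈ Finset.range (D.M^3), χ (c l) * E z l *
        D.T (i+3) (c l) z0 (fun _ => 1) (fun _ => 0) j
        = ((β * mU : ℝ) : ℂ) * ∑ l ∈ Finset.range (D.M^3), χ (c l) * E z l * b j l := by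
      rw [Finset.mul_sum]
      apply Finset.sum_congr rfl
      intro l _
      simp only [hb]; field_simp
    have hb3 : ∑ l ∈ Finset.range (D.M^3), χ (c l) * E z l * b j l
        = ∑ k ∈ Finset.range (m^2), ∑ l ∈ Finset.Ico (k*S) (k*S+S), χ (c l) * E z l * b j l := by
      rw [hmS]
      have : ∀ N : ℕ, ∑ l ∈ Finset.range (N * S), χ (c l) * E z l * b j l
        = ∑ k ∈ Finset.range N, ∑ l ∈ Finset.Ico (k*S) (k*S+S), χ (c l) * E z l * b j l := by
        intro N
        induction N with
        | zero => simp
        | succ N ih =>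
          rw [Finset.sum_range_succ, ← ih, Nat.succ_mul]
          rw [Finset.range_eq_Ico, Finset.range_eq_Ico, Finset.sum_Ico_consecutive _ (by omega) (by omega)]
      exact this _
    have hb4 : ∀ k ∈ Finset.range (m^2), ‖∑ l ∈ Finset.Ico (k*S) (k*S+S), χ (c l) * E z l * b j l‖
        ≤ S * (1 / m^2 + 1 / (2 * m)) := by
      intro k hk
      rw [Finset.mem_range] at hk
      have hkS := hblk k hk
      have hkS' : k * S < D.M^3 := by omega
      have e1 : ∑ l ∈ Finset.Ico (k*S) (k*S+S), χ (c l) * E z l * b j l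
        = ∑ l ∈ Finset.Ico (k*S) (k*S+S), (χ (c l) - χ (c (k*S))) * (E z l * b j l)
          + χ (c (k*S)) * ∑ l ∈ Finset.Ico (k*S) (k*S+S), E z l * b j l := by
        rw [Finset.mul_sum, ← Finset.sum_add_distrib]
        exact Finset.sum_congr rfl fun l _ => by ring
      rw [e1, mul_add]
      refine (norm_add_le _ _).trans (add_le_add ?_ ?_)
      · refine (norm_sum_le _ _).trans ?_
        calc _ ≤ ∑ l ∈ Finset.Ico (k*S) (k*S+S), (1 / (m:ℝ)^2) := by
              apply Finset.sum_le_sum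
              intro l hl
              rw [Finset.mem_Ico] at hl
              have hl3 : l < D.M^3 := by omega
              rw [norm_mul, norm_mul, norm_e, one_mul]
              have h1 := hT.χl _ (hcin l hl3) _ (hcin _ hkS')
              have h2 : |c l - c (k*S)| / α ≤ 1 / (m:ℝ)^2 := by
                rw [div_le_div_iff₀ hα0 (by positivity), one_mul]
                have e2 : c l - c (k*S) = ((l:ℝ) - (k*S : ℕ)) * β := by simp only [hcdef]; ring
                have h3 : ((k*S : ℕ) : ℝ) ≤ l := by exact_mod_cast hl.1
                have h4 : (l:ℝ) ≤ (k*S : ℕ) + S := by exact_mod_cast hl.2.le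
                rw [e2, abs_of_nonneg (mul_nonneg (by linarith) hβ0.le), hαβ, hmS']
                nlinarith [mul_pos hβ0 (pow_pos hm0 2)]
              calc _ ≤ (1 / (m:ℝ)^2) * 1 := by
                    apply mul_le_mul (h1.trans h2) (hbb j hj l hl3) (norm_nonneg _) (by positivity)
                _ = _ := mul_one _
          _ = _ := by rw [Finset.sum_const, nsmul_eq_mul, Nat.card_Ico, Nat.add_sub_cancel_left]
      · rw [norm_mul]
        calc _ ≤ 1 * (1 / (2 * (m:ℝ)) * S) := by
              apply mul_le_mul (hT.χb _ (hcin _ hkS')) (hsmall k hk).le (norm_nonneg _) zero_le_one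
          _ = _ := by ring
    have hb5 : ‖∑ l ∈ Finset.range (D.M^3), χ (c l) * E z l * b j l‖ ≤ (D.M:ℝ)^3 * (1 / m) := by
      rw [hb3]
      refine (norm_sum_le _ _).trans ((Finset.sum_le_sum hb4).trans ?_)
      rw [Finset.sum_const, nsmul_eq_mul, Finset.card_range, hmS']
      push_cast
      rw [← mul_assoc]
      gcongr
      rw [div_add_div _ _ (by positivity) (by positivity), div_le_div_iff₀ (by positivity) (by positivity)]
      nlinarith [mul_pos hm0 hm0]
    have hb6 : ‖D.T i p z χ η j‖ ≤ (1 / (2 * m)) * (α * mU) + (β * mU) * ((D.M:ℝ)^3 * (1 / m)) := by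
      have e1 : D.T i p z χ η j = (D.T i p z χ η j - ∑ l ∈ Finset.range (D.M^3), χ (c l) * E z l *
        D.T (i+3) (c l) z0 (fun _ => 1) (fun _ => 0) j) + ((β * mU : ℝ) : ℂ) *
          ∑ l ∈ Finset.range (D.M^3), χ (c l) * E z l * b j l := by rw [← hb2]; ring
      rw [e1]
      refine (norm_add_le _ _).trans (add_le_add hb1 ?_)
      rw [norm_mul, Complex.norm_real, Real.norm_eq_abs, abs_of_pos (mul_pos hβ0 hmU)]
      exact mul_le_mul_of_nonneg_left hb5 (mul_pos hβ0 hmU).le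
    have e9 : (1 / (2 * m)) * (α * mU) + (β * mU) * ((D.M:ℝ)^3 * (1 / m)) = (3/2) * (α * (mU / m)) := by
      rw [hαβ]; field_simp; ring
    rw [e9] at hb6
    have e10 : D.al i * (2 * mU / m) = 2 * (α * (mU / m)) := by rw [hα]; ring
    rw [e10] at hlt
    have : 0 < α * (mU / m) := by positivity
    linarith
  -- bound each V
  have hVb : ∀ jk ∈ (Finset.range (i+1)) ×ˢ (Finset.range (m^2)),
      (V jk).card ≤ 8 * m^2 * (9 * (4640 * m^4)^3)^3 := by
    rintro ⟨j, k⟩ hjk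
    simp only [Finset.mem_product, Finset.mem_range] at hjk
    obtain ⟨hj, hk⟩ := hjk
    have hkS := hblk k hk
    have hVY : V (j,k) ⊆ Y := Finset.filter_subset _ _
    have hcard : (Finset.Ico (k*S) (k*S+S)).card = S := by
      rw [Nat.card_Ico, Nat.add_sub_cancel_left]
    have hK1 : 1 ≤ 4640 * m^4 := Nat.mul_pos (by norm_num) (by positivity)
    have := tt_count (V (j,k)) (Finset.Ico (k*S) (k*S+S)) E (b j) (lam := 1 / (2 * m))
      (Kn := (((9 * (4640 * m^4)^3)^3 : ℕ) : ℝ)) (by positivity) (by rw [hcard]; exact hS) (by positivity)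
      (fun l hl => hbb j (by omega) l (by rw [Finset.mem_Ico] at hl; omega))
      (fun z hz => by
        rw [hcard]
        simp only [hV, Finset.mem_filter] at hz
        exact hz.2)
      (fun z l => (norm_e _).le)
      (fun z z' => max (D.al i * |D.G1 z p - D.G1 z' p|) (D.al i ^ 2 * |D.G2 z p - D.G2 z' p|)
        < ((4640 * m^4 : ℕ):ℝ)^3 * D.t)
      (by
        intro z hz z' hz' hn
        rw [not_lt] at hn
        have h1 := D.block_far (k := k) (m := m) (S := S) hp hp1 (hclose z z' ((hcell z (hVY hz)).trans
          (hcell z' (hVY hz')).symm)) hmS hk (K := ((4640 * m^4 : ℕ):ℝ)) (by exact_mod_cast hK1) hn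
        have e1 : ∀ l, E z l * (starRingEnd ℂ) (E z' l) = Complex.exp (Complex.I *
            ((D.ξ * (D.G0 z (p + l * D.al (i+3)) - D.G0 z' (p + l * D.al (i+3))) : ℝ) : ℂ)) := by
          intro l
          simp only [hE, hcdef]
          rw [← Complex.exp_conj, ← Complex.exp_add]
          congr 1
          rw [map_mul, Complex.conj_I, Complex.conj_ofReal]
          push_cast; ring
        simp only [e1]
        refine h1.trans ?_
        rw [hcard, mul_comm]
        gcongr
        have hM48 : 48 * (m:ℝ)^2 ≤ D.M := by exact_mod_cast hmM
        have h2 : 3 / (D.M:ℝ) ≤ 1 / (16 * m^2) := by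
          rw [div_le_div_iff₀ hM (by positivity)]; linarith
        have h3 : 290 * (m:ℝ)^2 / ((4640 * m^4 : ℕ):ℝ) = 1 / (16 * m^2) := by
          push_cast; field_simp; norm_num
        rw [h3]
        have h4 : (1 / (2 * (m:ℝ)))^2 / 2 = 1 / (16 * m^2) + 1 / (16 * m^2) := by
          field_simp; norm_num
        rw [h4]; linarith)
      (by
        intro z hz W hW hn
        exact_mod_cast D.near_count hp hp1 hl0 hK1 (z := z) W (hY.mono (by
          intro x hx; exact hVY (hW hx))) (fun z' hz' => (hcell z' (hVY (hW hz'))).trans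
            (hcell z (hVY hz)).symm) hn)
    have h2 : 2 * (((9 * (4640 * m^4)^3)^3 : ℕ) : ℝ) / (1 / (2 * (m:ℝ)))^2
        = ((8 * m^2 * (9 * (4640 * m^4)^3)^3 : ℕ) : ℝ) := by
      push_cast; field_simp; norm_num
    rw [h2] at this
    exact_mod_cast this
  have hfin := (Finset.card_le_card hcover).trans (Finset.card_biUnion_le_card_mul _ _ _ hVb)
  rw [Finset.card_product, Finset.card_range, Finset.card_range] at hfin
  exact_mod_cast hfin

end PD
end MW

namespace MW
open MeasureTheory Metric Set

lemma reps {ι κ : Type} [DecidableEq κ] (c : ι → κ) (Y : Finset ι) (f : ι → ℝ) :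
    ∃ R ⊆ Y, InjOn c R ∧ (∀ F : ι → ℝ, ∑ z ∈ Y, F z = ∑ y ∈ R, ∑ z ∈ Y.filter (fun z => c z = c y), F z) ∧
      ∀ y ∈ R, ∀ z ∈ Y, c z = c y → f z ≤ f y := by
  classical
  have h : ∀ v ∈ Y.image c, ∃ y ∈ Y, c y = v ∧ ∀ z ∈ Y, c z = v → f z ≤ f y := by
    intro v hv
    have hne : (Y.filter (fun z => c z = v)).Nonempty := by
      obtain ⟨z, hz, hzv⟩ := Finset.mem_image.1 hv
      exact ⟨z, Finset.mem_filter.2 ⟨hz, hzv⟩⟩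
    obtain ⟨y, hy, hmax⟩ := Finset.exists_max_image _ f hne
    rw [Finset.mem_filter] at hy
    exact ⟨y, hy.1, hy.2, fun z hz hzv => hmax z (Finset.mem_filter.2 ⟨hz, hzv⟩)⟩
  rcases Y.eq_empty_or_nonempty with h0 | ⟨y0, h0⟩
  · subst h0
    exact ⟨∅, by simp, by simp, by simp, by simp⟩
  haveI : Nonempty ι := ⟨y0⟩
  choose! r hr1 hr2 hr3 using h
  have hinj : ∀ v ∈ Y.image c, ∀ w ∈ Y.image c, r v = r w → v = w := by
    intro v hv w hw hvw
    rw [← hr2 v hv, hvw, hr2 w hw]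
  refine ⟨(Y.image c).image r, ?_, ?_, ?_, ?_⟩
  · intro y hy
    obtain ⟨v, hv, rfl⟩ := Finset.mem_image.1 hy
    exact hr1 v hv
  · intro y hy y' hy' hyy
    obtain ⟨v, hv, rfl⟩ := Finset.mem_image.1 (Finset.mem_coe.1 hy)
    obtain ⟨w, hw, rfl⟩ := Finset.mem_image.1 (Finset.mem_coe.1 hy')
    rw [hr2 v hv, hr2 w hw] at hyy
    rw [hyy]
  · intro F
    rw [Finset.sum_image hinj]
    rw [← Finset.sum_fiberwise_of_maps_to (s := Y) (t := Y.image c) (g := c)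
      (fun z hz => Finset.mem_image_of_mem _ hz)]
    apply Finset.sum_congr rfl
    intro v hv
    rw [hr2 v hv]
  · intro y hy z hz hzy
    obtain ⟨v, hv, rfl⟩ := Finset.mem_image.1 hy
    rw [hr2 v hv] at hzy
    exact hr3 v hv z hz hzy

lemma sum_le_fiber {ι κ : Type} [DecidableEq κ] (c : ι → κ) (Y : Finset ι) (f : ι → ℝ)
    {K X : ℝ} (hK0 : 0 ≤ K) (hf : ∀ z, 0 ≤ f z)
    (hK : ∀ y ∈ Y, ∀ W ⊆ Y, (∀ z ∈ W, c z = c y) → (W.card : ℝ) ≤ K)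
    (hX : ∀ Y' ⊆ Y, InjOn c Y' → ∑ z ∈ Y', f z ≤ X) : ∑ z ∈ Y, f z ≤ K * X := by
  obtain ⟨R, hR, hinj, hsum, hmax⟩ := reps c Y f
  rw [hsum f]
  calc _ ≤ ∑ y ∈ R, K * f y := by
        apply Finset.sum_le_sum
        intro y hy
        calc _ ≤ ∑ z ∈ Y.filter (fun z => c z = c y), f y := by
              apply Finset.sum_le_sum
              intro z hz
              rw [Finset.mem_filter] at hz
              exact hmax y hy z hz.1 hz.2
          _ = (Y.filter (fun z => c z = c y)).card * f y := by rw [Finset.sum_const, nsmul_eq_mul]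
          _ ≤ _ := by
            apply mul_le_mul_of_nonneg_right _ (hf y)
            exact hK y (hR hy) _ (Finset.filter_subset _ _) fun z hz => (Finset.mem_filter.1 hz).2
    _ = K * ∑ y ∈ R, f y := by rw [Finset.mul_sum]
    _ ≤ _ := mul_le_mul_of_nonneg_left (hX R hR hinj) hK0

lemma young_Q {x m Q : ℝ} (hx : 0 ≤ x) (hm : 0 ≤ m) (hQ : 0 < Q) (pw q : ℕ) :
    x^q * m^pw ≤ Q^pw * x^(pw+q) + m^(pw+q) / Q^q := by
  rcases le_total m (Q * x) with h | h
  · calc x^q * m^pw ≤ x^q * (Q*x)^pw := by gcongr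
      _ = Q^pw * x^(pw+q) := by rw [mul_pow, pow_add]; ring
      _ ≤ _ := le_add_of_nonneg_right (by positivity)
  · have h2 : x ≤ m / Q := by rw [le_div_iff₀ hQ]; linarith
    calc x^q * m^pw ≤ (m/Q)^q * m^pw := by gcongr
      _ = m^(pw+q) / Q^q := by rw [div_pow, pow_add]; ring
      _ ≤ _ := le_add_of_nonneg_left (by positivity)

namespace PD
variable {ι : Type} (D : PD ι)

lemma N_le_two {i l0 : ℕ} (hi : i + 3 ≤ D.L + 3) {p : ℝ} (hp : 0 ≤ p) (hp1 : p + D.al i ≤ 1)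
    (hl0 : l0 < D.M) (heps : 4 / D.M + D.eps (i+3) ≤ 1) {z z0 : ι} {mU : ℝ}
    (hN : ∀ l < D.M^3, D.N (i+3) (p + l * D.al (i+3)) z0 ≤ mU)
    (hcell : D.cell (i+1) (p + l0 * D.al (i+1)) z = D.cell (i+1) (p + l0 * D.al (i+1)) z0) :
    D.N i p z ≤ 2 * mU := by
  have hM := D.M0
  have hcl : D.Close i p z z0 := by
    intro u hu
    obtain ⟨h1, h2, -⟩ := D.close_of_cell (k := 1) (l := l0) hp hp1 (by simpa using hl0) hcell u hu
    rw [pow_one] at h1 h2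
    exact ⟨by linarith, h2⟩
  have hβ0 := D.al_pos (i+3)
  apply D.N_le
  intro χ η j hT hj
  rw [D.T_split (k := 3) (by omega) hT]
  refine (norm_sum_le _ _).trans ?_
  calc _ ≤ ∑ l ∈ Finset.range (D.M^3), 2 * (D.al (i+3) * mU) := by
        apply Finset.sum_le_sum
        intro l hl
        rw [Finset.mem_range] at hl
        have h1 := D.theta_est hi hp hp1 hcl hl hj hT rfl
        have h2 := D.T_le_N (z := z0) hi (D.zero_test (i+3) (p + l * D.al (i+3))) (j := j) (by omega)
        have h3 : D.al (i+3) * D.N (i+3) (p + l * D.al (i+3)) z0 ≤ D.al (i+3) * mU :=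
          mul_le_mul_of_nonneg_left (hN l hl) hβ0.le
        have h0 : 0 ≤ D.al (i+3) * D.N (i+3) (p + l * D.al (i+3)) z0 := mul_nonneg hβ0.le D.N_nonneg
        obtain ⟨s1, s2⟩ := D.sub_arc (p := p) (i := i) hl
        have h4 := hT.χb (p + l * D.al (i+3)) ⟨s1, by linarith⟩
        set c := p + l * D.al (i+3)
        set X := D.T (i+3) c z0 (fun _ => 1) (fun _ => 0) j
        set w := χ c * Complex.exp (Complex.I * ((D.ξ * (D.G0 z c - D.G0 z0 c) : ℝ) : ℂ)) with hw
        have hwn : ‖w‖ ≤ 1 := by rw [hw, norm_mul, norm_e, mul_one]; exact h4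
        have h5 : ‖D.T (i+3) c z χ η j‖ ≤ ‖D.T (i+3) c z χ η j - w * X‖ + ‖w * X‖ := by
          have := norm_add_le (D.T (i+3) c z χ η j - w * X) (w * X); simpa using this
        have h6 : ‖w * X‖ ≤ ‖X‖ := by
          rw [norm_mul]; exact mul_le_of_le_one_left (norm_nonneg _) hwn
        have h7 : (4 / D.M + D.eps (i+3)) * (D.al (i+3) * D.N (i+3) c z0) ≤
          1 * (D.al (i+3) * D.N (i+3) c z0) := mul_le_mul_of_nonneg_right heps h0
        linarith
    _ = _ := by
        rw [Finset.sum_const, nsmul_eq_mul, Finset.card_range, D.al_add i 3]; push_cast; ring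

lemma local_sum {i l0 m S pw : ℕ} (hi : i + 3 ≤ D.L + 3) {p : ℝ} (hp : 0 ≤ p) (hp1 : p + D.al i ≤ 1)
    (hl0 : l0 < D.M) (hm : 2 ≤ m) (hmS : D.M^3 = m^2 * S) (hmM : 48 * m^2 ≤ D.M)
    (hpw : 1 ≤ pw) (hMm : D.M^6 ≤ m^pw)
    (heps : 4 / D.M + D.eps (i+3) ≤ 1 / (2 * m)) {z0 : ι} {mU : ℝ} (hmU : 0 ≤ mU)
    (hN : ∀ l < D.M^3, D.N (i+3) (p + l * D.al (i+3)) z0 ≤ mU)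
    (Y : Finset ι) (hY : InjOn (D.cell i p) Y)
    (hcell : ∀ z ∈ Y, D.cell (i+1) (p + l0 * D.al (i+1)) z = D.cell (i+1) (p + l0 * D.al (i+1)) z0) :
    ∑ z ∈ Y, D.N i p z ^ pw ≤ (2^pw * (D.L + 2) * (8 * 9^3 * 4640^9) * m^40) * mU^pw := by
  classical
  have hM := D.M0
  have hm0 : (0:ℝ) < m := by positivity
  have hm2 : (2:ℝ) ≤ m := by exact_mod_cast hm
  have heps1 : 4 / D.M + D.eps (i+3) ≤ 1 := heps.trans (by
    rw [div_le_one (by positivity)]; linarith)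
  have h2 : ∀ z ∈ Y, D.N i p z ≤ 2 * mU := fun z hz =>
    D.N_le_two hi hp hp1 hl0 heps1 hN (hcell z hz)
  rcases hmU.eq_or_lt with h0 | hpos
  · rw [← h0]
    have : ∀ z ∈ Y, D.N i p z ^ pw = 0 := by
      intro z hz
      have h3 := h2 z hz
      rw [← h0, mul_zero] at h3
      rw [le_antisymm h3 D.N_nonneg, zero_pow (by omega)]
    rw [Finset.sum_eq_zero this, zero_pow (by omega), mul_zero]
  have hsplit := Finset.sum_filter_add_sum_filter_not Y (fun z => 2 * mU / m < D.N i p z)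
    (fun z => D.N i p z ^ pw)
  rw [← hsplit]
  set Yb := Y.filter (fun z => 2 * mU / m < D.N i p z) with hYb
  have hbig := D.big_count hi hp hp1 hl0 hm hmS hmM heps hpos hN Yb
    (hY.mono (Finset.coe_subset.2 (Finset.filter_subset _ _)))
    (fun z hz => hcell z (Finset.filter_subset _ _ hz)) (fun z hz => (Finset.mem_filter.1 hz).2)
  have hcardY : Y.card ≤ 729 * D.M^6 := by
    have hM1 : 1 ≤ D.M^2 := Nat.one_le_pow _ _ (by have := D.M4; omega)
    refine (D.card_box Y hY z0 (4 * D.M^2) ?_).trans ?_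
    · intro z hz
      have hal := D.al_pos i
      obtain ⟨h1, h2, h3⟩ := D.close_of_cell (k := 1) (l := l0) hp hp1 (by simpa using hl0)
        (hcell z hz) p ⟨le_rfl, by linarith⟩
      have : 0 < (D.M:ℝ)^2 * D.t := by have := D.t0; positivity
      rw [pow_one] at h1 h2 h3
      push_cast
      refine ⟨by linarith, by linarith, by linarith⟩
    · calc (2 * (4 * D.M^2) + 1)^3 ≤ (9 * D.M^2)^3 := Nat.pow_le_pow_left (by omega) 3
        _ = _ := by ring
  have hbig2 : (Yb.card : ℝ) ≤ (D.L + 1) * (8 * 9^3 * 4640^9) * m^40 := by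
    refine hbig.trans ?_
    have hiL : (i:ℝ) ≤ D.L := by exact_mod_cast (by omega : i ≤ D.L)
    push_cast
    calc ((i:ℝ)+1) * m^2 * (8 * m^2 * (9 * (4640 * m^4)^3)^3) = (i+1) * (8 * 9^3 * 4640^9) * m^40 := by ring
      _ ≤ _ := by gcongr
  have s1 : ∑ z ∈ Yb, D.N i p z ^ pw ≤ ((D.L + 1) * (8 * 9^3 * 4640^9) * m^40) * (2^pw * mU^pw) := by
    calc _ ≤ ∑ z ∈ Yb, (2 * mU)^pw := by
          apply Finset.sum_le_sum
          intro z hz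
          exact pow_le_pow_left₀ D.N_nonneg (h2 z (Finset.filter_subset _ _ hz)) _
      _ = Yb.card * (2^pw * mU^pw) := by rw [Finset.sum_const, nsmul_eq_mul, mul_pow]
      _ ≤ _ := by gcongr
  have s2 : ∑ z ∈ Y.filter (fun z => ¬ 2 * mU / m < D.N i p z), D.N i p z ^ pw ≤ 729 * (2^pw * mU^pw) := by
    calc _ ≤ ∑ z ∈ Y.filter (fun z => ¬ 2 * mU / m < D.N i p z), (2 * mU / m)^pw := by
          apply Finset.sum_le_sum
          intro z hz
          exact pow_le_pow_left₀ D.N_nonneg (not_lt.1 (Finset.mem_filter.1 hz).2) _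
      _ = (Y.filter (fun z => ¬ 2 * mU / m < D.N i p z)).card * (2 * mU / m)^pw := by
          rw [Finset.sum_const, nsmul_eq_mul]
      _ ≤ (729 * (m:ℝ)^pw) * (2 * mU / m)^pw := by
          gcongr
          have h1 := (Finset.card_le_card (Finset.filter_subset (fun z => ¬ 2 * mU / m < D.N i p z) Y)).trans
            (hcardY.trans (Nat.mul_le_mul_left _ hMm))
          exact_mod_cast h1
      _ = _ := by rw [div_pow, mul_pow]; field_simp
  refine (add_le_add s1 s2).trans ?_
  have hm40 : (1:ℝ) ≤ (m:ℝ)^40 := one_le_pow₀ (by linarith)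
  have hc : (729:ℝ) ≤ (8 * 9^3 * 4640^9) * (m:ℝ)^40 := by
    calc (729:ℝ) ≤ (8 * 9^3 * 4640^9) * 1 := by norm_num
      _ ≤ _ := by gcongr
  have hq : 0 ≤ (2:ℝ)^pw * mU^pw := by positivity
  calc _ ≤ ((D.L + 1) * (8 * 9^3 * 4640^9) * m^40) * (2^pw * mU^pw)
        + ((8 * 9^3 * 4640^9) * (m:ℝ)^40) * (2^pw * mU^pw) := by gcongr
    _ = _ := by ring

def Bound (P i : ℕ) (X : ℝ) : Prop :=
  ∀ p, 0 ≤ p → p + D.al i ≤ 1 → ∀ Y : Finset ι, InjOn (D.cell i p) Y → ∑ z ∈ Y, D.N i p z ^ P ≤ X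

lemma step {i m S pw q : ℕ} (hi : i + 3 ≤ D.L + 3) (hm : 2 ≤ m) (hmS : D.M^3 = m^2 * S)
    (hmM : 48 * m^2 ≤ D.M) (hpw : 1 ≤ pw) (hMm : D.M^6 ≤ m^pw)
    (heps : 4 / D.M + D.eps (i+3) ≤ 1 / (2 * m)) {Q X : ℝ} (hQ : 0 < Q)
    (hQq : 729 * (D.M:ℝ)^21 ≤ Q^q)
    (h1 : D.Bound (pw+q) (i+1) X) (h3 : D.Bound (pw+q) (i+3) X) :
    D.Bound (pw+q) i ((2^pw * (D.L + 2) * (8 * 9^3 * 4640^9) * m^40) * (Q^pw + 1) * X) := by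
  classical
  intro p hp hp1 Y hY
  have hM := D.M0
  have hX0 : 0 ≤ X := by
    have := h1 0 le_rfl (by rw [zero_add]; exact D.al_le_one _) ∅ (by simp)
    simpa using this
  set C1 : ℝ := 2^pw * (D.L + 2) * (8 * 9^3 * 4640^9) * m^40 with hC1
  have hC10 : 0 ≤ C1 := by positivity
  -- Jensen
  have hJ : ∀ z, D.N i p z ^ (pw+q) ≤
      (∑ l ∈ Finset.range D.M, D.N i p z ^ pw * D.N (i+1) (p + l * D.al (i+1)) z ^ q) / D.M := by
    intro z
    rw [pow_add, ← Finset.mul_sum, mul_div_assoc]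
    refine mul_le_mul_of_nonneg_left ?_ (pow_nonneg D.N_nonneg _)
    refine (pow_le_pow_left₀ D.N_nonneg (D.N_mono (i := i) (by omega) (p := p) (z := z)) q).trans ?_
    rcases Nat.eq_zero_or_pos q with h0 | h0
    · subst h0; simp; rw [div_self hM.ne']
    · obtain ⟨q', rfl⟩ : ∃ q', q = q' + 1 := ⟨q - 1, by omega⟩
      have hp := pow_sum_div_card_le_sum_pow (s := Finset.range D.M)
        (f := fun l : ℕ => D.N (i+1) (p + l * D.al (i+1)) z) (fun _ _ => D.N_nonneg) q'
      rw [Finset.card_range] at hp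
      rw [div_pow, pow_succ (D.M:ℝ), ← div_div]
      gcongr
  have hA : ∀ l ∈ Finset.range D.M, ∑ z ∈ Y, D.N i p z ^ pw * D.N (i+1) (p + l * D.al (i+1)) z ^ q
      ≤ C1 * (Q^pw + 1) * X := by
    intro l hl
    rw [Finset.mem_range] at hl
    set ps := p + l * D.al (i+1) with hps
    obtain ⟨hs1, hs2⟩ := D.sub_arc (p := p) (i := i) (k := 1) (l := l) (by simpa using hl)
    rw [← hps] at hs1 hs2
    have hal1 := D.al_pos (i+1)
    obtain ⟨R, hR, hRinj, hsum, hmax⟩ := reps (D.cell (i+1) ps) Y (fun z => D.N (i+1) ps z)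
    rw [hsum]
    have hne : (Finset.range (D.M^3)).Nonempty := by
      rw [Finset.nonempty_range_iff]; have := D.M4; positivity
    have hex : ∀ y, ∃ l' ∈ Finset.range (D.M^3), ∀ l'' ∈ Finset.range (D.M^3),
        D.N (i+3) (p + l'' * D.al (i+3)) y ≤ D.N (i+3) (p + l' * D.al (i+3)) y := fun y =>
      Finset.exists_max_image _ (fun l'' : ℕ => D.N (i+3) (p + l'' * D.al (i+3)) y) hne
    choose lm hlm hlmax using hex
    set mU : ι → ℝ := fun y => D.N (i+3) (p + lm y * D.al (i+3)) y with hmU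
    have hmU0 : ∀ y, 0 ≤ mU y := fun y => D.N_nonneg
    have hin : ∀ y ∈ R, ∑ z ∈ Y.filter (fun z => D.cell (i+1) ps z = D.cell (i+1) ps y),
        D.N i p z ^ pw * D.N (i+1) ps z ^ q ≤
        C1 * (Q^pw * D.N (i+1) ps y ^ (pw+q) + mU y ^ (pw+q) / Q^q) := by
      intro y hy
      have hloc := D.local_sum hi hp hp1 hl hm hmS hmM hpw hMm heps (z0 := y) (hmU0 y)
        (fun l hl => hlmax y l (Finset.mem_range.2 hl))
        (Y.filter (fun z => D.cell (i+1) ps z = D.cell (i+1) ps y))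
        (hY.mono (Finset.coe_subset.2 (Finset.filter_subset _ _)))
        (fun z hz => (Finset.mem_filter.1 hz).2)
      calc _ ≤ ∑ z ∈ Y.filter (fun z => D.cell (i+1) ps z = D.cell (i+1) ps y),
              D.N i p z ^ pw * D.N (i+1) ps y ^ q := by
            apply Finset.sum_le_sum
            intro z hz
            rw [Finset.mem_filter] at hz
            have := hmax y hy z hz.1 hz.2
            exact mul_le_mul_of_nonneg_left (pow_le_pow_left₀ D.N_nonneg this _)
              (pow_nonneg D.N_nonneg _)
        _ = D.N (i+1) ps y ^ q * ∑ z ∈ Y.filter (fun z => D.cell (i+1) ps z = D.cell (i+1) ps y),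
              D.N i p z ^ pw := by rw [← Finset.sum_mul, mul_comm]
        _ ≤ D.N (i+1) ps y ^ q * (C1 * mU y ^ pw) :=
            mul_le_mul_of_nonneg_left hloc (pow_nonneg D.N_nonneg _)
        _ = C1 * (D.N (i+1) ps y ^ q * mU y ^ pw) := by ring
        _ ≤ _ := mul_le_mul_of_nonneg_left (young_Q D.N_nonneg (hmU0 y) hQ pw q) hC10
    have t1 : ∑ y ∈ R, D.N (i+1) ps y ^ (pw+q) ≤ X :=
      h1 ps (by linarith) (by linarith) R hRinj
    have t2 : ∑ y ∈ R, mU y ^ (pw+q) ≤ (D.M:ℝ)^3 * ((729 * (D.M:ℝ)^18) * X) := by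
      calc _ ≤ ∑ y ∈ R, ∑ l' ∈ Finset.range (D.M^3), D.N (i+3) (p + l' * D.al (i+3)) y ^ (pw+q) := by
            apply Finset.sum_le_sum
            intro y hy
            exact Finset.single_le_sum (f := fun l' : ℕ => D.N (i+3) (p + l' * D.al (i+3)) y ^ (pw+q))
              (fun _ _ => pow_nonneg D.N_nonneg _) (hlm y)
        _ = ∑ l' ∈ Finset.range (D.M^3), ∑ y ∈ R, D.N (i+3) (p + l' * D.al (i+3)) y ^ (pw+q) :=
            Finset.sum_comm
        _ ≤ ∑ l' ∈ Finset.range (D.M^3), (729 * (D.M:ℝ)^18) * X := by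
            apply Finset.sum_le_sum
            intro l' hl'
            rw [Finset.mem_range] at hl'
            obtain ⟨ht1, ht2⟩ := D.sub_arc (p := p) (i := i) (k := 3) (l := l') hl'
            have hal3 := D.al_pos (i+3)
            apply sum_le_fiber (D.cell (i+3) (p + l' * D.al (i+3))) R _ (by positivity)
              (fun _ => pow_nonneg D.N_nonneg _)
            · intro y hy W hW hWc
              have hM1 : 1 ≤ D.M^6 := Nat.one_le_pow _ _ (by have := D.M4; omega)
              have hb := D.card_box (i := i+1) (p := ps) W (hRinj.mono (Finset.coe_subset.2 hW)) y
                (4 * D.M^6) (by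
                  intro z hz
                  obtain ⟨k0, k1, k2⟩ := D.close_of_cell (k := 3) (l := l') hp hp1 hl' (hWc z hz) ps
                    ⟨hs1, by linarith⟩
                  have hal := D.al_anti (Nat.le_succ i)
                  have e6 : ((D.M:ℝ)^3)^2 = (D.M:ℝ)^6 := by ring
                  rw [e6] at k0 k1 k2
                  have hpos : 0 < (D.M:ℝ)^6 * D.t := by have := D.t0; positivity
                  push_cast
                  have j1 : D.al (i+1) * |D.G1 z ps - D.G1 y ps| ≤ D.al i * |D.G1 z ps - D.G1 y ps| := by
                    gcongr
                  have j2 : D.al (i+1)^2 * |D.G2 z ps - D.G2 y ps| ≤ D.al i ^ 2 * |D.G2 z ps - D.G2 y ps| := by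
                    gcongr
                  refine ⟨by linarith, by linarith, by linarith⟩)
              have hb2 : W.card ≤ 729 * D.M^18 := hb.trans (by
                calc (2 * (4 * D.M^6) + 1)^3 ≤ (9 * D.M^6)^3 := Nat.pow_le_pow_left (by omega) 3
                  _ = _ := by ring)
              exact_mod_cast hb2
            · intro Y' _ hY'
              exact h3 _ (by linarith) (by linarith) Y' hY'
        _ = _ := by rw [Finset.sum_const, nsmul_eq_mul, Finset.card_range]; push_cast; ring
    calc _ ≤ ∑ y ∈ R, C1 * (Q^pw * D.N (i+1) ps y ^ (pw+q) + mU y ^ (pw+q) / Q^q) :=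
          Finset.sum_le_sum hin
      _ = C1 * (Q^pw * ∑ y ∈ R, D.N (i+1) ps y ^ (pw+q) + (∑ y ∈ R, mU y ^ (pw+q)) / Q^q) := by
          rw [← Finset.mul_sum, Finset.sum_add_distrib, Finset.mul_sum, Finset.sum_div]
      _ ≤ C1 * (Q^pw * X + X) := by
          gcongr
          rw [div_le_iff₀ (by positivity)]
          refine t2.trans ?_
          calc (D.M:ℝ)^3 * ((729 * (D.M:ℝ)^18) * X) = (729 * (D.M:ℝ)^21) * X := by ring
            _ ≤ Q^q * X := by gcongr
            _ = X * Q^q := mul_comm _ _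
      _ = _ := by ring
  calc ∑ z ∈ Y, D.N i p z ^ (pw+q) ≤ ∑ z ∈ Y,
        (∑ l ∈ Finset.range D.M, D.N i p z ^ pw * D.N (i+1) (p + l * D.al (i+1)) z ^ q) / D.M :=
        Finset.sum_le_sum fun z _ => hJ z
    _ = (∑ l ∈ Finset.range D.M, ∑ z ∈ Y, D.N i p z ^ pw * D.N (i+1) (p + l * D.al (i+1)) z ^ q) / D.M := by
        rw [← Finset.sum_div, Finset.sum_comm]
    _ ≤ (∑ l ∈ Finset.range D.M, C1 * (Q^pw + 1) * X) / D.M := by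
        gcongr with l hl
        exact hA l hl
    _ = _ := by
        rw [Finset.sum_const, nsmul_eq_mul, Finset.card_range]; field_simp

lemma terminal {P i : ℕ} (hi : i ≤ D.L + 3) (hL : D.L ≤ i) : D.Bound P i (45 * D.Bd^P / D.t) := by
  intro p hp hp1 Y hY
  have ht := D.t0
  have hal := D.al_pos i
  have hpm : p ∈ Icc (0:ℝ) 1 := ⟨hp, by linarith⟩
  have halt : D.al i ≤ D.t := by
    refine (D.al_anti hL).trans ?_
    have h1 := D.ML
    have h2 := D.Mal D.L
    have h3 : (0:ℝ) < (D.M:ℝ)^D.L := pow_pos D.M0 _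
    have : (D.M:ℝ)^D.L * D.al D.L ≤ (D.M:ℝ)^D.L * D.t := by linarith
    exact le_of_mul_le_mul_left this h3
  set R : ℕ := ⌈1 / D.t⌉₊ with hR
  have hRl : 1 / D.t ≤ R := Nat.le_ceil _
  have hRu : (R:ℝ) < 1 / D.t + 1 := Nat.ceil_lt_add_one (by positivity)
  set box : Finset (ℤ × ℤ × ℤ) := (Finset.Icc (-(R:ℤ)) R) ×ˢ
    ((Finset.Icc (-1) 1) ×ˢ (Finset.Icc (-1) 1)) with hbox
  have hcard : box.card = (2 * R + 1) * 9 := by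
    simp only [hbox, Finset.card_product, Int.card_Icc]
    have : ((R:ℤ) + 1 - -R).toNat = 2 * R + 1 := by omega
    rw [this]; norm_num; rfl
  have fl : ∀ (x : ℝ) (K : ℕ), |x| ≤ K → -(K:ℤ) ≤ ⌊x⌋ ∧ ⌊x⌋ ≤ K := by
    intro x K hx
    rw [abs_le] at hx
    constructor
    · rw [Int.le_floor]; push_cast; exact hx.1
    · have := Int.floor_le x
      have h2 : (⌊x⌋ : ℝ) ≤ K := this.trans hx.2
      exact_mod_cast h2
  have hc : Y.card ≤ (2 * R + 1) * 9 := by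
    rw [← hcard]
    apply Finset.card_le_card_of_injOn (D.cell i p) _ hY
    intro z _
    have a1 : |D.G0 z p / D.t| ≤ R := by
      rw [abs_div, abs_of_pos ht]
      refine le_trans ?_ hRl
      have := D.b0 z p hpm
      gcongr
    have a2 : |D.al i * D.G1 z p / D.t| ≤ (1:ℕ) := by
      rw [abs_div, abs_of_pos ht, abs_mul, abs_of_pos hal, Nat.cast_one, div_le_one ht]
      have h := D.b1 z p hpm
      calc D.al i * |D.G1 z p| ≤ D.al i * 1 := by gcongr
        _ ≤ _ := by linarith
    have a3 : |D.al i ^ 2 * D.G2 z p / D.t| ≤ (1:ℕ) := by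
      rw [abs_div, abs_of_pos ht, abs_mul, abs_of_pos (by positivity), Nat.cast_one, div_le_one ht]
      have h := D.b2 z p hpm
      have h2 := D.al_le_one i
      calc D.al i ^ 2 * |D.G2 z p| ≤ D.al i ^ 2 * 1 := by gcongr
        _ ≤ D.al i := by nlinarith
        _ ≤ _ := halt
    have f1 := fl _ _ a1
    have f2 := fl _ _ a2
    have f3 := fl _ _ a3
    simp only [hbox, cell, Finset.coe_product, Finset.coe_Icc, Set.mem_prod, Set.mem_Icc]
    exact ⟨f1, f2, f3⟩
  have hB := D.Bd_nonneg
  calc ∑ z ∈ Y, D.N i p z ^ P ≤ ∑ z ∈ Y, D.Bd ^ P :=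
        Finset.sum_le_sum fun z _ => pow_le_pow_left₀ D.N_nonneg (D.N_le_Bd hi) _
    _ = Y.card * D.Bd^P := by rw [Finset.sum_const, nsmul_eq_mul]
    _ ≤ ((2 * R + 1) * 9 : ℝ) * D.Bd^P := by
        gcongr
        exact_mod_cast hc
    _ ≤ (45 / D.t) * D.Bd^P := by
        gcongr
        have : 1 ≤ 1 / D.t := by rw [le_div_iff₀ ht]; linarith [D.t1]
        have e : 45 / D.t = 45 * (1 / D.t) := by ring
        rw [e]
        linarith
    _ = _ := by ring

/-- The planar estimate. -/
theorem planar {m S pw q : ℕ} (hm : 2 ≤ m) (hmS : D.M^3 = m^2 * S)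
    (hmM : 48 * m^2 ≤ D.M) (hpw : 1 ≤ pw) (hMm : D.M^6 ≤ m^pw)
    (heps : 4 / D.M + D.eps (D.L+3) ≤ 1 / (2 * m)) {Q : ℝ} (hQ : 0 < Q)
    (hQq : 729 * (D.M:ℝ)^21 ≤ Q^q) (Z : Finset ι) (hZ : InjOn (D.cell 0 0) Z) :
    ∑ z ∈ Z, ‖∫ u in (0:ℝ)..1, Complex.exp (Complex.I * ((D.ξ * D.G0 z u : ℝ) : ℂ)) *
      D.g 0 u (D.G0 z u)‖ ^ (pw+q) ≤
    ((2^pw * (D.L + 2) * (8 * 9^3 * 4640^9) * m^40) * (Q^pw + 1))^D.L * (45 * D.Bd^(pw+q) / D.t) := by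
  set C2 : ℝ := (2^pw * (D.L + 2) * (8 * 9^3 * 4640^9) * m^40) * (Q^pw + 1) with hC2
  have hm1 : (1:ℝ) ≤ m := by exact_mod_cast (by omega : 1 ≤ m)
  have hC2' : 1 ≤ C2 := by
    have a1 : (1:ℝ) ≤ 2^pw := one_le_pow₀ (by norm_num)
    have a2 : (1:ℝ) ≤ (D.L:ℝ) + 2 := by have : (0:ℝ) ≤ D.L := Nat.cast_nonneg _
                                        linarith
    have a3 : (1:ℝ) ≤ (m:ℝ)^40 := one_le_pow₀ hm1
    have a4 : (1:ℝ) ≤ Q^pw + 1 := by have : 0 < Q^pw := by positivity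
                                     linarith
    have a5 : (1:ℝ) ≤ 8 * 9^3 * 4640^9 := by norm_num
    rw [hC2]
    exact one_le_mul_of_one_le_of_one_le (one_le_mul_of_one_le_of_one_le
      (one_le_mul_of_one_le_of_one_le (one_le_mul_of_one_le_of_one_le a1 a2) a5) a3) a4
  set X0 : ℝ := 45 * D.Bd^(pw+q) / D.t with hX0
  have hX00 : 0 ≤ X0 := by have := D.Bd_nonneg; have := D.t0; positivity
  have key : ∀ d i : ℕ, i ≤ D.L + 2 → D.L ≤ i + d → D.Bound (pw+q) i (C2^d * X0) := by
    intro d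
    induction d with
    | zero =>
      intro i hi hL
      rw [pow_zero, one_mul]
      exact D.terminal (by omega) (by omega)
    | succ d ih =>
      intro i hi hL
      rcases le_or_gt D.L i with h | h
      · intro p hp hp1 Y hY
        refine (D.terminal (P := pw+q) (by omega) h p hp hp1 Y hY).trans ?_
        exact le_mul_of_one_le_left hX00 (one_le_pow₀ hC2')
      · have := D.step (i := i) (by omega) hm hmS hmM hpw hMm
          (le_trans (by gcongr; exact D.eps_mono (by omega)) heps) hQ hQq
          (ih (i+1) (by omega) (by omega)) (ih (i+3) (by omega) (by omega))
        rw [pow_succ', mul_assoc]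
        exact this
  have hfin := key D.L 0 (by omega) (by omega) 0 le_rfl (by simp [al]) Z hZ
  refine le_trans (Finset.sum_le_sum fun z _ => ?_) hfin
  apply pow_le_pow_left₀ (norm_nonneg _)
  have := D.T_le_N (z := z) (i := 0) (by omega) (D.zero_test 0 0) (j := 0) le_rfl
  simpa [T, F, al] using this

end PD
end MW

namespace MW
open MeasureTheory Metric Set

noncomputable def cG (a q u : ℝ) : ℝ := √(q - (u - a)^2)
noncomputable def c1 (a q u : ℝ) : ℝ := -(u - a) / cG a q u
noncomputable def c2 (a q u : ℝ) : ℝ := -(1 + (c1 a q u)^2) / cG a q u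
noncomputable def c3 (a q u : ℝ) : ℝ := 3 * c1 a q u * (c2 a q u)^2 / (1 + (c1 a q u)^2)

structure Good (R a q : ℝ) : Prop where
  R1 : 100 ≤ R
  a0 : 0 ≤ a
  a1 : a ≤ 1
  q0 : (R/2)^2 + 1 ≤ q
  q1 : q ≤ (2*R)^2

lemma cG_meas (a q : ℝ) : Measurable (cG a q) := by
  unfold cG; fun_prop

section
variable {R a q u : ℝ} 

lemma Good.sq_le (h : Good R a q) (hu : u ∈ Icc (0:ℝ) 1) : (u - a)^2 ≤ 1 := by
  have := h.a0; have := h.a1; have := hu.1; have := hu.2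
  nlinarith

lemma Good.cG_lower (h : Good R a q) (hu : u ∈ Icc (0:ℝ) 1) : R / 2 ≤ cG a q u := by
  have := h.sq_le hu
  have := h.q0
  have := h.R1
  unfold cG
  apply Real.le_sqrt_of_sq_le
  linarith

lemma Good.cG_upper (h : Good R a q) : cG a q u ≤ 2 * R := by
  have := h.q1
  have := h.R1
  unfold cG
  rw [Real.sqrt_le_left (by linarith)]
  nlinarith [sq_nonneg (u-a)]

lemma Good.cG_sq (h : Good R a q) (hu : u ∈ Icc (0:ℝ) 1) : cG a q u ^ 2 = q - (u-a)^2 := by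
  have := h.sq_le hu
  have := h.q0
  unfold cG
  rw [Real.sq_sqrt]
  nlinarith [sq_nonneg (R/2)]

lemma Good.c1_abs (h : Good R a q) (hu : u ∈ Icc (0:ℝ) 1) : |c1 a q u| ≤ 2 / R := by
  have h1 := h.cG_lower hu
  have h2 := h.R1
  have h3 := abs_le_one_iff_mul_self_le_one.2 (by have := h.sq_le hu; nlinarith : (u-a) * (u-a) ≤ 1)
  unfold c1
  rw [abs_div, abs_neg, abs_of_pos (by linarith : 0 < cG a q u), div_le_div_iff₀ (by linarith) (by linarith)]
  nlinarith

lemma Good.two_div (h : Good R a q) : 2 / R ≤ 1/50 := by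
  have h2 := h.R1
  rw [div_le_div_iff₀ (by linarith) (by norm_num)]; linarith

lemma Good.c1_sq (h : Good R a q) (hu : u ∈ Icc (0:ℝ) 1) : (c1 a q u)^2 ≤ 1/2500 := by
  have h1 := (h.c1_abs hu).trans h.two_div
  rw [← sq_abs]
  calc |c1 a q u|^2 ≤ (1/50)^2 := by gcongr
    _ = _ := by norm_num

lemma Good.c2_abs (h : Good R a q) (hu : u ∈ Icc (0:ℝ) 1) : |c2 a q u| ≤ 1/25 := by
  have h1 := h.cG_lower hu
  have h2 := h.R1
  have h3 := h.c1_sq hu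
  unfold c2
  rw [abs_div, abs_neg, abs_of_pos (by linarith : 0 < cG a q u), div_le_iff₀ (by linarith), abs_of_pos (by positivity)]
  nlinarith

lemma Good.c2_lower (h : Good R a q) (hu : u ∈ Icc (0:ℝ) 1) : 1 / (2 * R) ≤ |c2 a q u| := by
  have h1 := h.cG_lower hu
  have h1' := h.cG_upper (u := u)
  have h2 := h.R1
  have h3 := sq_nonneg (c1 a q u)
  unfold c2
  rw [abs_div, abs_neg, abs_of_pos (by linarith : 0 < cG a q u), abs_of_pos (by positivity),
    div_le_div_iff₀ (by linarith) (by linarith)]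
  nlinarith

lemma Good.hd0 (h : Good R a q) (hu : u ∈ Icc (0:ℝ) 1) : HasDerivAt (cG a q) (c1 a q u) u := by
  have h1 := h.cG_lower hu
  have h2 := h.R1
  have hne : q - (u-a)^2 ≠ 0 := by
    rw [← h.cG_sq hu]; have : 0 < cG a q u := by linarith
    positivity
  have e : HasDerivAt (fun u => q - (u-a)^2) (-(2 * (u - a))) u := by
    have := (((hasDerivAt_id u).sub_const a).pow 2).const_sub q
    simpa using this
  have := e.sqrt hne
  unfold cG
  convert this using 1
  unfold c1 cG
  rw [neg_div, neg_div, mul_div_mul_left _ _ two_ne_zero]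

lemma Good.hd1 (h : Good R a q) (hu : u ∈ Icc (0:ℝ) 1) : HasDerivAt (c1 a q) (c2 a q u) u := by
  have h1 := h.cG_lower hu
  have h2 := h.R1
  have hp : 0 < cG a q u := by linarith
  have e : HasDerivAt (fun u => -(u - a)) (-1) u := ((hasDerivAt_id u).sub_const a).neg
  have := e.div (h.hd0 hu) hp.ne'
  refine this.congr_deriv ?_
  unfold c2
  have : c1 a q u * cG a q u = -(u-a) := by unfold c1; field_simp
  rw [← this]
  field_simp
  ring

lemma Good.hd2 (h : Good R a q) (hu : u ∈ Icc (0:ℝ) 1) : HasDerivAt (c2 a q) (c3 a q u) u := by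
  have h1 := h.cG_lower hu
  have h2 := h.R1
  have hp : 0 < cG a q u := by linarith
  have e : HasDerivAt (fun u => -(1 + (c1 a q u)^2)) (-(2 * c1 a q u * c2 a q u)) u := by
    have := (((h.hd1 hu).fun_pow 2).const_add 1).fun_neg
    refine this.congr_deriv ?_
    simp
  have := e.div (h.hd0 hu) hp.ne'
  refine this.congr_deriv ?_
  have hs : (1 + (c1 a q u)^2) ≠ 0 := by positivity
  have e2 : c2 a q u = -(1 + (c1 a q u)^2) / cG a q u := rfl
  unfold c3
  rw [e2]
  field_simp
  ring

lemma lip3 {p q p' q' : ℝ} (hp : |p| ≤ 1/50) (hq : |q| ≤ 1/25) (hp' : |p'| ≤ 1/50) (hq' : |q'| ≤ 1/25) :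
    |3 * p * q^2 / (1 + p^2) - 3 * p' * q'^2 / (1 + p'^2)| ≤ (1/100) * (|p - p'| + |q - q'|) := by
  have e : 3 * p * q^2 / (1 + p^2) - 3 * p' * q'^2 / (1 + p'^2) =
     3 * q^2 * ((1 - p * p') / ((1+p^2) * (1+p'^2))) * (p - p') +
      3 * (p' / (1+p'^2)) * (q + q') * (q - q') := by
    field_simp
    ring
  have b1 : |(1 - p * p') / ((1+p^2) * (1+p'^2))| ≤ 2 := by
    rw [abs_div, abs_of_pos (by positivity : 0 < (1+p^2) * (1+p'^2)), div_le_iff₀ (by positivity)]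
    have : |1 - p * p'| ≤ 2 := by
      have : |p * p'| ≤ 1 := by rw [abs_mul]; nlinarith [abs_nonneg p, abs_nonneg p']
      rw [abs_le] at this ⊢; constructor <;> linarith
    nlinarith [sq_nonneg p, sq_nonneg p', mul_nonneg (sq_nonneg p) (sq_nonneg p')]
  have b2 : |p' / (1+p'^2)| ≤ 1/50 := by
    rw [abs_div, abs_of_pos (by positivity : 0 < (1+p'^2)), div_le_iff₀ (by positivity)]
    nlinarith [sq_nonneg p']
  have b3 : |q + q'| ≤ 2/25 := (abs_add_le _ _).trans (by linarith)
  have b4 : q^2 ≤ 1/625 := by rw [← sq_abs]; nlinarith [abs_nonneg q]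
  rw [e]
  refine (abs_add_le _ _).trans ?_
  rw [abs_mul, abs_mul, abs_mul, abs_mul, abs_mul, abs_mul, abs_of_pos (by norm_num : (0:ℝ) < 3),
    abs_of_nonneg (sq_nonneg q)]
  have i1 : 3 * q^2 * |(1 - p * p') / ((1+p^2) * (1+p'^2))| ≤ 3 * (1/625) * 2 := by gcongr
  have i2 : 3 * |p' / (1+p'^2)| * |q+q'| ≤ 3 * (1/50) * (2/25) := by gcongr
  nlinarith [abs_nonneg (p-p'), abs_nonneg (q-q')]

lemma Good.jet {a' q' b b' : ℝ} (h : Good R a q) (h' : Good R a' q') :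
    Jet (fun u => (b + cG a q u) - (b' + cG a' q' u)) (fun u => c1 a q u - c1 a' q' u)
     (fun u => c2 a q u - c2 a' q' u) (fun u => c3 a q u - c3 a' q' u) 0 1 where
  h0 u hu := ((h.hd0 hu).const_add b).sub ((h'.hd0 hu).const_add b')
  h1 u hu := (h.hd1 hu).sub (h'.hd1 hu)
  h2 u hu := (h.hd2 hu).sub (h'.hd2 hu)
  h3 u hu := by
    exact lip3 ((h.c1_abs hu).trans h.two_div) (h.c2_abs hu) ((h'.c1_abs hu).trans h'.two_div) (h'.c2_abs hu)

/-- Inverse jet map is Lipschitz. -/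
lemma Good.inv {a' q' b b' τ : ℝ} (h : Good R a q) (h' : Good R a' q')
    (k0 : |(b + cG a q 0) - (b' + cG a' q' 0)| ≤ τ) (k1 : |c1 a q 0 - c1 a' q' 0| ≤ τ)
    (k2 : |c2 a q 0 - c2 a' q' 0| ≤ τ) :
    |a - a'| ≤ 100 * R^3 * τ ∧ |b - b'| ≤ 100 * R^3 * τ ∧ |q - q'| ≤ 100 * R^3 * τ := by
  have hu : (0:ℝ) ∈ Icc (0:ℝ) 1 := by simp
  have hR := h.R1
  have hτ : 0 ≤ τ := (abs_nonneg _).trans k0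
  have hG := h.cG_lower hu
  have hG' := h'.cG_lower hu
  have gG := h.cG_upper (u := 0)
  have gG' := h'.cG_upper (u := 0)
  have s1 := h.cG_sq hu
  have s1' := h'.cG_sq hu
  have ea : c1 a q 0 * cG a q 0 = a := by unfold c1; field_simp [(by linarith : cG a q 0 ≠ 0)]; ring
  have ea' : c1 a' q' 0 * cG a' q' 0 = a' := by unfold c1; field_simp [(by linarith : cG a' q' 0 ≠ 0)]; ring
  have ec : c2 a q 0 * cG a q 0 = -(1 + c1 a q 0 ^2) := by unfold c2; field_simp [(by linarith : cG a q 0 ≠ 0)]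
  have ec' : c2 a' q' 0 * cG a' q' 0 = -(1 + c1 a' q' 0 ^2) := by unfold c2; field_simp [(by linarith : cG a' q' 0 ≠ 0)]
  have p1 := (h.c1_abs hu).trans h.two_div
  have p1' := (h'.c1_abs hu).trans h'.two_div
  have l2 := h.c2_lower hu
  generalize cG a q 0 = G at *
  generalize cG a' q' 0 = G' at *
  generalize c1 a q 0 = p at *
  generalize c1 a' q' 0 = p' at *
  generalize c2 a q 0 = c at *
  generalize c2 a' q' 0 = c' at *
  have y1 : 100 * τ ≤ R * τ := by gcongr
  have y2 : 100 * (R * τ) ≤ R^2 * τ := by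
    have := mul_le_mul_of_nonneg_left y1 (by linarith : 0 ≤ R)
    linarith
  have y3 : 100 * (R^2 * τ) ≤ R^3 * τ := by
    have := mul_le_mul_of_nonneg_left y2 (by linarith : 0 ≤ R)
    linarith
  have e1 : c * (G - G') = -(p + p') * (p - p') - G' * (c - c') := by nlinarith
  have n1 : |c| * |G - G'| ≤ τ + 2 * R * τ := by
    rw [← abs_mul, e1]
    refine (abs_sub _ _).trans ?_
    rw [abs_mul, abs_mul, abs_neg, abs_of_pos (by linarith : 0 < G')]
    have : |p + p'| ≤ 1 := (abs_add_le _ _).trans (by linarith)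
    have i1 : |p + p'| * |p - p'| ≤ 1 * τ := by gcongr
    have i2 : G' * |c - c'| ≤ (2 * R) * τ := by gcongr
    linarith
  have n2 : |G - G'| ≤ 5 * R^2 * τ := by
    have : 1 / (2*R) * |G - G'| ≤ τ + 2 * R * τ := le_trans (by gcongr) n1
    rw [div_mul_eq_mul_div, one_mul, div_le_iff₀ (by linarith)] at this
    linarith
  have n3 : |a - a'| ≤ 7 * R^2 * τ := by
    have : a - a' = p * (G - G') + G' * (p - p') := by rw [← ea, ← ea']; ring
    rw [this]
    refine (abs_add_le _ _).trans ?_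
    rw [abs_mul, abs_mul, abs_of_pos (by linarith : 0 < G')]
    have i1 : |p| * |G - G'| ≤ 1 * (5 * R^2 * τ) := by gcongr; linarith
    have i2 : G' * |p - p'| ≤ (2 * R) * τ := by gcongr
    linarith
  refine ⟨by linarith, ?_, ?_⟩
  · have : b - b' = ((b + G) - (b' + G')) - (G - G') := by ring
    rw [this]
    refine (abs_sub _ _).trans ?_
    linarith
  · have : q - q' = (G + G') * (G - G') + (a + a') * (a - a') := by nlinarith
    rw [this]
    refine (abs_add_le _ _).trans ?_
    rw [abs_mul, abs_mul, abs_of_pos (by linarith : 0 < G + G')]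
    have ha : |a + a'| ≤ 2 := by
      rw [abs_of_nonneg (by linarith [h.a0, h'.a0])]; linarith [h.a1, h'.a1]
    have i1 : (G + G') * |G - G'| ≤ (4 * R) * (5 * R^2 * τ) := by gcongr; linarith
    have i2 : |a + a'| * |a - a'| ≤ 2 * (7 * R^2 * τ) := by gcongr
    linarith

end
end MW

namespace MW
open MeasureTheory Metric Set

noncomputable def hpol : ℕ → Polynomial ℝ
  | 0 => 1
  | j+1 => Polynomial.derivative (hpol j) - Polynomial.X * hpol j

noncomputable def hk (j : ℕ) (q : ℝ) : ℝ := (hpol j).eval q * Real.exp (-q^2/2)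

lemma hk_zero (q : ℝ) : hk 0 q = Real.exp (-q^2/2) := by simp [hk, hpol]

lemma hk_deriv (j : ℕ) (q : ℝ) : HasDerivAt (hk j) (hk (j+1) q) q := by
  have h1 : HasDerivAt (fun q : ℝ => Real.exp (-q^2/2)) (Real.exp (-q^2/2) * (-q)) q := by
    have : HasDerivAt (fun q : ℝ => -q^2/2) (-q) q := by
      have := (((hasDerivAt_id q).fun_pow 2).fun_neg).div_const 2
      refine this.congr_deriv ?_
      simp; ring
    exact this.exp
  have := ((hpol j).hasDerivAt q).fun_mul h1
  refine this.congr_deriv ?_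
  simp [hk, hpol]; ring

lemma hk_cont (j : ℕ) : Continuous (hk j) :=
  continuous_iff_continuousAt.2 fun q => (hk_deriv j q).continuousAt

lemma poly_bd (p : Polynomial ℝ) : ∃ C : ℝ, 0 ≤ C ∧ ∀ q : ℝ, |p.eval q| ≤ C * Real.exp (q^2/4) := by
  induction p using Polynomial.induction_on' with
  | add p q hp hq =>
    obtain ⟨C, h0, hC⟩ := hp
    obtain ⟨C', h0', hC'⟩ := hq
    refine ⟨C + C', by positivity, fun x => ?_⟩
    rw [Polynomial.eval_add, add_mul]
    exact (abs_add_le _ _).trans (add_le_add (hC x) (hC' x))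
  | monomial j a =>
    refine ⟨|a| * (j.factorial * Real.exp 1), by positivity, fun x => ?_⟩
    rw [Polynomial.eval_monomial, abs_mul, abs_pow, mul_assoc]
    gcongr
    have h := Real.pow_div_factorial_le_exp |x| (abs_nonneg x) j
    rw [div_le_iff₀ (by positivity)] at h
    have h2 : Real.exp |x| ≤ Real.exp 1 * Real.exp (x^2/4) := by
      rw [← Real.exp_add]
      apply Real.exp_le_exp.2
      rw [← sq_abs x]
      nlinarith [sq_nonneg (|x| - 2)]
    calc |x|^j ≤ Real.exp |x| * j.factorial := h
      _ ≤ (Real.exp 1 * Real.exp (x^2/4)) * j.factorial := by gcongr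
      _ = _ := by ring

lemma hk_bd_ex (j : ℕ) : ∃ C : ℝ, 0 ≤ C ∧ ∀ q : ℝ, |hk j q| ≤ C * Real.exp (-(1/4) * q^2) := by
  obtain ⟨C, h0, hC⟩ := poly_bd (hpol j)
  refine ⟨C, h0, fun q => ?_⟩
  unfold hk
  rw [abs_mul, abs_of_pos (Real.exp_pos _)]
  calc _ ≤ C * Real.exp (q^2/4) * Real.exp (-q^2/2) := by gcongr; exact hC q
    _ = _ := by rw [mul_assoc, ← Real.exp_add]; ring_nf

noncomputable def hC (j : ℕ) : ℝ := (hk_bd_ex j).choose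
lemma hC_nonneg (j : ℕ) : 0 ≤ hC j := (hk_bd_ex j).choose_spec.1
lemma hk_bd (j : ℕ) (q : ℝ) : |hk j q| ≤ hC j * Real.exp (-(1/4) * q^2) := (hk_bd_ex j).choose_spec.2 q
lemma hk_le (j : ℕ) (q : ℝ) : |hk j q| ≤ hC j := by
  refine (hk_bd j q).trans (mul_le_of_le_one_right (hC_nonneg j) ?_)
  apply Real.exp_le_one_iff.2
  nlinarith [sq_nonneg q]

/-- The kernel. -/
noncomputable def kg (f : ℝ → ℝ → ℝ) (ξ w : ℝ) (j : ℕ) (u y : ℝ) : ℂ :=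
  ∫ s in (0:ℝ)..1, ((f u s : ℝ) : ℂ) * Complex.exp (-(Complex.I * ((ξ * s : ℝ) : ℂ))) * ((hk j ((y - s)/w) / w : ℝ) : ℂ)

lemma norm_exp_neg_I (x : ℝ) : ‖Complex.exp (-(Complex.I * (x : ℂ)))‖ = 1 := by
  have : -(Complex.I * (x : ℂ)) = ((-x : ℝ) : ℂ) * Complex.I := by push_cast; ring
  rw [this, Complex.norm_exp_ofReal_mul_I]

section
variable {f : ℝ → ℝ → ℝ} {ξ w : ℝ}

lemma kg_meas (hf : Measurable (Function.uncurry f)) (j : ℕ) : Measurable (Function.uncurry (kg f ξ w j)) := by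
  have hm : Measurable (fun p : (ℝ × ℝ) × ℝ => ((f p.1.1 p.2 : ℝ) : ℂ) *
     Complex.exp (-(Complex.I * ((ξ * p.2 : ℝ) : ℂ))) * ((hk j ((p.1.2 - p.2)/w) / w : ℝ) : ℂ)) := by
    have h1 : Measurable (fun p : (ℝ × ℝ) × ℝ => f p.1.1 p.2) :=
      hf.comp (by fun_prop : Measurable fun p : (ℝ × ℝ) × ℝ => (p.1.1, p.2))
    have h2 : Measurable (fun p : (ℝ × ℝ) × ℝ => hk j ((p.1.2 - p.2)/w)) :=
      (hk_cont j).measurable.comp (by fun_prop)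
    fun_prop
  have := (hm.stronglyMeasurable.integral_prod_right' (ν := volume.restrict (Ioc (0:ℝ) 1))).measurable
  convert this using 1
  ext ⟨u, y⟩
  simp only [Function.uncurry, kg]
  rw [intervalIntegral.integral_of_le zero_le_one]

lemma kg_bd (hf : ∀ u s, |f u s| ≤ 1) (hw : 0 < w) (j : ℕ) (u y : ℝ) : ‖kg f ξ w j u y‖ ≤ 4 * hC j := by
  unfold kg
  rw [intervalIntegral.integral_of_le zero_le_one]
  have hi : Integrable (fun s : ℝ => hC j / w * Real.exp (-(1/4/w^2) * (s - y)^2)) :=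
    ((integrable_exp_neg_mul_sq (by positivity : 0 < 1/4/w^2)).comp_sub_right y).const_mul _
  refine (norm_integral_le_of_norm_le (hi.restrict (s := Ioc 0 1)) (ae_of_all _ fun s => ?_)).trans ?_
  · rw [norm_mul, norm_mul, norm_exp_neg_I, mul_one, Complex.norm_real, Complex.norm_real,
      Real.norm_eq_abs, Real.norm_eq_abs, abs_div, abs_of_pos hw]
    calc _ ≤ 1 * ((hC j * Real.exp (-(1/4) * ((y-s)/w)^2))/w) := by
            gcongr
            · exact hf _ _
            · exact hk_bd _ _
      _ = _ := by
        have : -(1/4) * ((y-s)/w)^2 = -(1/4/w^2) * (s-y)^2 := by field_simp; ring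
        rw [this]; ring
  · refine (setIntegral_le_integral hi (ae_of_all _ fun s => ?_)).trans ?_
    · have := hC_nonneg j
      positivity
    rw [integral_const_mul, integral_sub_right_eq_self (fun s => Real.exp (-(1/4/w^2) * s^2)) y, integral_gaussian]
    have e : Real.pi / (1/4/w^2) = (2*w)^2 * Real.pi := by field_simp; ring
    rw [e, Real.sqrt_mul (by positivity), Real.sqrt_sq (by positivity)]
    have : √Real.pi ≤ 2 := by
      rw [Real.sqrt_le_left (by norm_num)]; linarith [Real.pi_le_four]
    have h0 := hC_nonneg j
    calc hC j / w * (2 * w * √Real.pi) = 2 * hC j * √Real.pi := by field_simp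
      _ ≤ 2 * hC j * 2 := by gcongr
      _ = _ := by ring

lemma kg_deriv (hfm : Measurable (Function.uncurry f)) (hf : ∀ u s, |f u s| ≤ 1) (hw : 0 < w) (j : ℕ) (u y : ℝ) :
    HasDerivAt (kg f ξ w j u) (kg f ξ w (j+1) u y / w) y := by
  have hm : ∀ (j : ℕ) (y : ℝ), Measurable (fun s : ℝ => ((f u s : ℝ) : ℂ) *
     Complex.exp (-(Complex.I * ((ξ * s : ℝ) : ℂ))) * ((hk j ((y - s)/w) / w : ℝ) : ℂ)) := by
    intro j y
    have h1 : Measurable (fun s : ℝ => f u s) :=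
      hfm.comp (by fun_prop : Measurable fun s : ℝ => (u, s))
    have h2 : Measurable (fun s : ℝ => hk j ((y - s)/w)) :=
      (hk_cont j).measurable.comp (by fun_prop)
    fun_prop
  have hb : ∀ (j : ℕ) (y s : ℝ), ‖((f u s : ℝ) : ℂ) *
     Complex.exp (-(Complex.I * ((ξ * s : ℝ) : ℂ))) * ((hk j ((y - s)/w) / w : ℝ) : ℂ)‖ ≤ hC j / w := by
    intro j y s
    rw [norm_mul, norm_mul, norm_exp_neg_I, mul_one, Complex.norm_real, Complex.norm_real,
      Real.norm_eq_abs, Real.norm_eq_abs, abs_div, abs_of_pos hw]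
    calc _ ≤ 1 * (hC j / w) := by
            gcongr
            · exact hf _ _
            · exact hk_le _ _
      _ = _ := one_mul _
  have key := hasDerivAt_integral_of_dominated_loc_of_deriv_le (μ := volume.restrict (Ioc (0:ℝ) 1))
    (F := fun y s => ((f u s : ℝ) : ℂ) *
     Complex.exp (-(Complex.I * ((ξ * s : ℝ) : ℂ))) * ((hk j ((y - s)/w) / w : ℝ) : ℂ))
    (F' := fun y s => (((f u s : ℝ) : ℂ) *
     Complex.exp (-(Complex.I * ((ξ * s : ℝ) : ℂ))) * ((hk (j+1) ((y - s)/w) / w : ℝ) : ℂ)) / w)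
    (x₀ := y) (s := univ) (bound := fun _ => hC (j+1) / w / w) Filter.univ_mem
    (Filter.Eventually.of_forall fun y => (hm j y).aestronglyMeasurable)
    (Integrable.of_bound (hm j y).aestronglyMeasurable (hC j / w) (ae_of_all _ fun s => hb j y s))
    ((hm (j+1) y).div_const _).aestronglyMeasurable
    (ae_of_all _ fun s y _ => by
      rw [norm_div, Complex.norm_real, Real.norm_eq_abs, abs_of_pos hw]
      gcongr
      exact hb _ _ _)
    (integrable_const _)
    (ae_of_all _ fun s y _ => by
      have h1 : HasDerivAt (fun y => (y - s)/w) (1/w) y := ((hasDerivAt_id y).sub_const s).div_const w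
      have h2 : HasDerivAt (fun y => hk j ((y-s)/w) / w) (hk (j+1) ((y-s)/w) * (1/w) / w) y :=
        (HasDerivAt.comp y (h₂ := hk j) (h := fun y => (y - s)/w) (hk_deriv j ((y-s)/w)) h1).div_const w
      refine (h2.ofReal_comp.const_mul _).congr_deriv ?_
      push_cast; ring)
  have h2 := key.2
  rw [integral_div] at h2
  unfold kg
  simp only [intervalIntegral.integral_of_le (zero_le_one (α := ℝ))]
  exact h2

end
end MW

namespace MW
open MeasureTheory Metric Set

noncomputable def U01 : Measure ℝ := volume.restrict (Ioc (0:ℝ) 1)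

instance : IsProbabilityMeasure U01 := ⟨by simp [U01]⟩

noncomputable def Pc (d : ℕ) : Measure (Fin d → ℝ) := Measure.pi (fun _ => U01)

instance (d : ℕ) : IsProbabilityMeasure (Pc d) := by unfold Pc; infer_instance

variable {d : ℕ}

lemma upd_meas (o : Fin d) : Measurable (fun p : (Fin d → ℝ) × ℝ => Function.update p.1 o p.2) := by
  rw [measurable_pi_iff]
  intro a
  rcases eq_or_ne a o with rfl | h
  · simp only [Function.update_self]; fun_prop
  · simp only [Function.update_of_ne h]; fun_prop

lemma upd_mp (o : Fin d) : MeasurePreserving (fun p : (Fin d → ℝ) × ℝ => Function.update p.1 o p.2)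
    ((Pc d).prod U01) (Pc d) := by
  refine ⟨upd_meas o, ?_⟩
  symm
  unfold Pc
  apply Measure.pi_eq
  intro s hs
  rw [Measure.map_apply (upd_meas o) (MeasurableSet.univ_pi hs)]
  have : (fun p : (Fin d → ℝ) × ℝ => Function.update p.1 o p.2) ⁻¹' (univ.pi s) =
      (univ.pi (Function.update s o univ)) ×ˢ (s o) := by
    ext ⟨v, t⟩
    simp only [mem_preimage, mem_univ_pi, mem_prod]
    constructor
    · intro h
      refine ⟨fun a => ?_, by simpa using h o⟩
      rcases eq_or_ne a o with rfl | ha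
      · simp
      · have := h a
        rw [Function.update_of_ne ha] at this
        rw [Function.update_of_ne ha]; exact this
    · rintro ⟨h, h'⟩ a
      rcases eq_or_ne a o with rfl | ha
      · simpa using h'
      · have := h a
        rw [Function.update_of_ne ha] at this
        rw [Function.update_of_ne ha]; exact this
  rw [this, Measure.prod_prod, Measure.pi_pi]
  rw [← Finset.mul_prod_erase Finset.univ _ (Finset.mem_univ o),
    ← Finset.mul_prod_erase Finset.univ _ (Finset.mem_univ o)]
  rw [Function.update_self, measure_univ, one_mul, mul_comm]
  congr 1
  apply Finset.prod_congr rfl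
  intro a ha
  rw [Function.update_of_ne (Finset.ne_of_mem_erase ha)]

/-- Slicing in one coordinate. -/
lemma slice1 (o : Fin d) {E : Type*} [NormedAddCommGroup E] [NormedSpace ℝ E] {Φ : (Fin d → ℝ) → E}
    (hΦ : Integrable Φ (Pc d)) :
    Integrable (fun v => ∫ s in (0:ℝ)..1, Φ (Function.update v o s)) (Pc d) ∧
    ∫ v, Φ v ∂(Pc d) = ∫ v, (∫ s in (0:ℝ)..1, Φ (Function.update v o s)) ∂(Pc d) := by
  have h1 : Integrable (fun p : (Fin d → ℝ) × ℝ => Φ (Function.update p.1 o p.2)) ((Pc d).prod U01) :=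
    (upd_mp o).integrable_comp_of_integrable hΦ
  have h2 : ∫ v, Φ v ∂(Pc d) = ∫ p, Φ (Function.update p.1 o p.2) ∂((Pc d).prod U01) := by
    have := (upd_mp o).map_eq
    conv_lhs => rw [← this]
    rw [integral_map (upd_meas o).aemeasurable]
    rw [this]; exact hΦ.aestronglyMeasurable
  simp only [intervalIntegral.integral_of_le (zero_le_one (α := ℝ))]
  refine ⟨h1.integral_prod_left, ?_⟩
  rw [h2, integral_prod _ h1]
  rfl

/-- Slicing in two coordinates. -/
lemma slice2 (o i : Fin d) {E : Type*} [NormedAddCommGroup E] [NormedSpace ℝ E] {Φ : (Fin d → ℝ) → E}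
    (hΦ : Integrable Φ (Pc d)) :
    Integrable (fun v => ∫ u in (0:ℝ)..1, ∫ s in (0:ℝ)..1, Φ (Function.update (Function.update v i u) o s)) (Pc d) ∧
    ∫ v, Φ v ∂(Pc d) = ∫ v, (∫ u in (0:ℝ)..1, ∫ s in (0:ℝ)..1,
      Φ (Function.update (Function.update v i u) o s)) ∂(Pc d) := by
  have h1 := slice1 o hΦ
  have h2 := slice1 i h1.1
  exact ⟨h2.1, h1.2.trans h2.2⟩

lemma Pc_le (d : ℕ) : Pc d ≤ (volume : Measure (Fin d → ℝ)) := by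
  have : Pc d = volume.restrict (univ.pi fun _ => Ioc (0:ℝ) 1) := by
    unfold Pc U01
    rw [volume_pi, Measure.restrict_pi_pi]
  rw [this]; exact Measure.restrict_le_self

lemma Pc_ae (d : ℕ) : ∀ᵐ v ∂(Pc d), ∀ a, v a ∈ Icc (0:ℝ) 1 := by
  have : Pc d = volume.restrict (univ.pi fun _ => Ioc (0:ℝ) 1) := by
    unfold Pc U01
    rw [volume_pi, Measure.restrict_pi_pi]
  rw [this]
  filter_upwards [ae_restrict_mem (MeasurableSet.univ_pi fun _ => measurableSet_Ioc)] with v hv a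
  exact Ioc_subset_Icc_self (hv a (mem_univ a))

/-- Probability that an affine function is small. -/
lemma prob_affine (a : Fin d) {A : (Fin d → ℝ) → ℝ} (hA : Measurable A) {β c : ℝ} (hβ : β ≠ 0) (hc : 0 ≤ c)
    (h : ∀ v s, A (Function.update v a s) = A (Function.update v a 0) + β * s) :
    (Pc d).real {v | |A v| ≤ c} ≤ 2 * c / |β| := by
  have hms : MeasurableSet {v | |A v| ≤ c} := measurableSet_le (by fun_prop) measurable_const
  have hi : Integrable (indicator {v | |A v| ≤ c} (fun _ => (1:ℝ))) (Pc d) := (integrable_const 1).indicator hms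
  have h1 := slice1 a hi
  rw [integral_indicator_const _ hms, smul_eq_mul, mul_one] at h1
  rw [h1.2]
  have hb : 0 < |β| := abs_pos.2 hβ
  calc _ ≤ ∫ v, 2 * c / |β| ∂(Pc d) := by
        apply integral_mono h1.1 (integrable_const _)
        intro v
        simp only [intervalIntegral.integral_of_le (zero_le_one (α := ℝ))]
        have e : (fun s => indicator {v | |A v| ≤ c} (fun _ => (1:ℝ)) (Function.update v a s)) =
           indicator (Icc (-A (Function.update v a 0)/β - c/|β|) (-A (Function.update v a 0)/β + c/|β|)) (fun _ => (1:ℝ)) := by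
          ext s
          simp only [indicator]
          congr 1
          simp only [mem_ofPred_eq, mem_Icc, h v s, eq_iff_iff]
          have : |A (Function.update v a 0) + β * s| = |β| * |s - (-A (Function.update v a 0)/β)| := by
            rw [← abs_mul]; congr 1; field_simp; ring
          rw [this, ← le_div_iff₀' hb, abs_le]
          constructor <;> rintro ⟨h1, h2⟩ <;> constructor <;> linarith
        rw [e, integral_indicator_const _ measurableSet_Icc, smul_eq_mul, mul_one]
        calc _ ≤ volume.real (Icc (-A (Function.update v a 0)/β - c/|β|) (-A (Function.update v a 0)/β + c/|β|)) :=
              ENNReal.toReal_mono (by simp) (Measure.restrict_le_self _)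
          _ = 2 * c / |β| := by
              rw [Real.volume_real_Icc_of_le]
              · ring
              · have : 0 ≤ c / |β| := by positivity
                linarith
    _ = _ := by simp

end MW

namespace MW
open MeasureTheory Metric Set

/-- Weighted sum bounded via an unweighted high-power estimate on separated sets. -/
lemma weight_split {ι κ : Type} [DecidableEq κ] (cl : ι → κ) (X : Finset ι) (w N W : ι → ℝ)
    (hw : ∀ x, 0 ≤ w x) (hN : ∀ x, 0 ≤ N x) {Bd Y lam PE : ℝ} {P : ℕ} (hBd : ∀ x, N x ≤ Bd)
    (hY : 0 < Y) (hlam : 0 < lam)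
    (hW : ∀ x ∈ X, ∑ y ∈ X.filter (fun y => cl y = cl x), w y ≤ W x)
    (hPE : ∀ Z ⊆ X, InjOn cl Z → ∑ z ∈ Z, N z ^ (P+1) ≤ PE) :
    ∑ x ∈ X, w x * N x ≤ Bd / Y * ∑ x ∈ X, w x * W x + lam * ∑ x ∈ X, w x + Y * PE / lam^P := by
  classical
  have hPE0 : 0 ≤ PE := by simpa using hPE ∅ (by simp) (by simp)
  have hW0 : ∀ x ∈ X, 0 ≤ W x := fun x hx => le_trans (Finset.sum_nonneg fun y _ => hw y) (hW x hx)
  obtain ⟨Z, hZ, hinj, hsum, hmax⟩ := reps cl (X.filter (fun x => W x ≤ Y)) N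
  have hZX : Z ⊆ X := hZ.trans (Finset.filter_subset _ _)
  have hsm : ∑ x ∈ X.filter (fun x => W x ≤ Y), w x * N x ^ (P+1) ≤ Y * PE := by
    rw [hsum]
    calc _ ≤ ∑ z ∈ Z, Y * N z ^ (P+1) := by
          apply Finset.sum_le_sum
          intro z hz
          have hz' := Finset.mem_filter.1 (hZ hz)
          calc _ ≤ ∑ y ∈ (X.filter (fun x => W x ≤ Y)).filter (fun y => cl y = cl z), w y * N z ^ (P+1) := by
                apply Finset.sum_le_sum
                intro y hy
                rw [Finset.mem_filter] at hy
                have := hmax z hz y hy.1 hy.2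
                have := hN y
                have := hw y
                gcongr
            _ = (∑ y ∈ (X.filter (fun x => W x ≤ Y)).filter (fun y => cl y = cl z), w y) * N z ^ (P+1) := by
                rw [Finset.sum_mul]
            _ ≤ Y * N z ^ (P+1) := by
                have := hN z
                gcongr
                refine le_trans ?_ ((hW z hz'.1).trans hz'.2)
                apply Finset.sum_le_sum_of_subset_of_nonneg
                · intro y hy
                  simp only [Finset.mem_filter] at hy ⊢
                  exact ⟨hy.1.1, hy.2⟩
                · intro y _ _; exact hw y
      _ = Y * ∑ z ∈ Z, N z ^ (P+1) := by rw [Finset.mul_sum]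
      _ ≤ Y * PE := by
          gcongr
          exact hPE Z hZX hinj
  have pt : ∀ x ∈ X, w x * N x ≤ Bd / Y * (w x * W x) + lam * w x +
      (if W x ≤ Y then w x * N x ^ (P+1) else 0) / lam^P := by
    intro x hx
    have h1 := hN x; have h2 := hw x; have h3 := hBd x; have h4 := hW0 x hx
    have h5 : 0 ≤ Bd := h1.trans h3
    split_ifs with h
    · have : N x ≤ lam + N x ^ (P+1) / lam^P := by
        rcases le_or_gt (N x) lam with h6 | h6
        · have : 0 ≤ N x ^ (P+1) / lam^P := by positivity
          linarith
        · have : N x ≤ N x ^ (P+1) / lam^P := by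
            rw [le_div_iff₀ (by positivity), pow_succ']
            gcongr
          linarith
      have h7 := mul_le_mul_of_nonneg_left this h2
      have h8 : 0 ≤ Bd / Y * (w x * W x) := by positivity
      calc _ ≤ _ := h7
        _ = lam * w x + w x * N x ^ (P+1) / lam^P := by ring
        _ ≤ _ := by linarith
    · push Not at h
      have : w x * N x ≤ Bd / Y * (w x * W x) := by
        calc w x * N x ≤ w x * Bd * 1 := by rw [mul_one]; gcongr
          _ ≤ w x * Bd * (W x / Y) := by
              gcongr
              rw [le_div_iff₀ hY]; linarith
          _ = _ := by ring
      have : 0 ≤ lam * w x := by positivity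
      simp only [zero_div]
      linarith
  calc _ ≤ ∑ x ∈ X, (Bd / Y * (w x * W x) + lam * w x +
      (if W x ≤ Y then w x * N x ^ (P+1) else 0) / lam^P) := Finset.sum_le_sum pt
    _ = Bd / Y * ∑ x ∈ X, w x * W x + lam * ∑ x ∈ X, w x + (∑ x ∈ X.filter (fun x => W x ≤ Y), w x * N x ^ (P+1)) / lam^P := by
        rw [Finset.sum_add_distrib, Finset.sum_add_distrib, Finset.mul_sum, Finset.mul_sum, ← Finset.sum_div, Finset.sum_filter]
    _ ≤ _ := by gcongr

variable {d : ℕ}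

noncomputable def Rd (d : ℕ) : ℝ := 100 * (d + 1)

lemma Rd_ge (d : ℕ) : 100 ≤ Rd d := by
  unfold Rd
  have : (0:ℝ) ≤ d := Nat.cast_nonneg _
  linarith

lemma Rd_ge' (d : ℕ) : 100 * (d:ℝ) ≤ Rd d := by
  unfold Rd
  linarith

structure IsCfg (o : Fin d) (c : (Fin d → ℝ) × ℝ) : Prop where
  h1 : ∀ a, a ≠ o → |c.1 a - 1/2| ≤ 1/16
  h2 : |c.1 o + Rd d - 1/2| ≤ 1/16
  h3 : |c.2 - Rd d| ≤ 1/16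

def Cfg (o : Fin d) : Type := {c : (Fin d → ℝ) × ℝ // IsCfg o c}

noncomputable def Gam (o : Fin d) (c : (Fin d → ℝ) × ℝ) (v : Fin d → ℝ) : ℝ :=
  c.1 o + √(c.2^2 - ∑ a ∈ Finset.univ.erase o, (c.1 a - v a)^2)

noncomputable def qq (o i : Fin d) (c : (Fin d → ℝ) × ℝ) (v : Fin d → ℝ) : ℝ :=
  c.2^2 - ∑ a ∈ (Finset.univ.erase o).erase i, (c.1 a - v a)^2

lemma Gam_meas (o : Fin d) (c : (Fin d → ℝ) × ℝ) : Continuous (Gam o c) := by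
  unfold Gam; fun_prop

lemma qq_meas (o i : Fin d) (c : (Fin d → ℝ) × ℝ) : Continuous (qq o i c) := by
  unfold qq; fun_prop

lemma Gam_upd_o (o : Fin d) (c : (Fin d → ℝ) × ℝ) (v : Fin d → ℝ) (s : ℝ) :
    Gam o c (Function.update v o s) = Gam o c v := by
  unfold Gam
  congr 3
  apply Finset.sum_congr rfl
  intro a ha
  rw [Function.update_of_ne (Finset.ne_of_mem_erase ha)]

lemma Gam_upd_i {o i : Fin d} (hi : i ≠ o) (c : (Fin d → ℝ) × ℝ) (v : Fin d → ℝ) (u : ℝ) :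
    Gam o c (Function.update v i u) = c.1 o + cG (c.1 i) (qq o i c v) u := by
  unfold Gam cG qq
  congr 2
  rw [← Finset.add_sum_erase (Finset.univ.erase o) _ (Finset.mem_erase.2 ⟨hi, Finset.mem_univ i⟩)]
  rw [Function.update_self]
  have : ∑ a ∈ (Finset.univ.erase o).erase i, (c.1 a - Function.update v i u a)^2 =
      ∑ a ∈ (Finset.univ.erase o).erase i, (c.1 a - v a)^2 := by
    apply Finset.sum_congr rfl
    intro a ha
    rw [Function.update_of_ne (Finset.ne_of_mem_erase ha)]
  rw [this]; ring

lemma IsCfg.sum_le {o : Fin d} {c} (h : IsCfg o c) {v : Fin d → ℝ} (hv : ∀ a, v a ∈ Icc (0:ℝ) 1)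
    (s : Finset (Fin d)) (hs : s ⊆ Finset.univ.erase o) : ∑ a ∈ s, (c.1 a - v a)^2 ≤ d := by
  calc _ ≤ ∑ a ∈ s, (1:ℝ) := by
        apply Finset.sum_le_sum
        intro a ha
        have h1 := abs_le.1 (h.h1 a (Finset.ne_of_mem_erase (hs ha)))
        have h2 := (hv a).1; have h3 := (hv a).2
        nlinarith
    _ = (s.card : ℝ) := by simp
    _ ≤ d := by
        have := Finset.card_le_univ s
        rw [Fintype.card_fin] at this
        exact_mod_cast this

lemma IsCfg.good {o i : Fin d} (hi : i ≠ o) {c} (h : IsCfg o c) {v : Fin d → ℝ} (hv : ∀ a, v a ∈ Icc (0:ℝ) 1) :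
    Good (Rd d) (c.1 i) (qq o i c v) := by
  have h1 := abs_le.1 (h.h1 i hi)
  have h3 := abs_le.1 h.h3
  have h4 := h.sum_le hv ((Finset.univ.erase o).erase i) (Finset.erase_subset _ _)
  have h4' : 0 ≤ ∑ a ∈ (Finset.univ.erase o).erase i, (c.1 a - v a)^2 := Finset.sum_nonneg fun _ _ => sq_nonneg _
  have h5 := Rd_ge d
  have h6 := Rd_ge' d
  refine ⟨h5, by linarith, by linarith, ?_, ?_⟩
  · unfold qq
    nlinarith
  · unfold qq
    nlinarith

lemma IsCfg.Gam_mem {o : Fin d} {c} (h : IsCfg o c) {v : Fin d → ℝ} (hv : ∀ a, v a ∈ Icc (0:ℝ) 1) :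
    Gam o c v ∈ Icc (1/4:ℝ) (3/4) := by
  have h1 := abs_le.1 h.h2
  have h3 := abs_le.1 h.h3
  have h4 := h.sum_le hv (Finset.univ.erase o) le_rfl
  have h4' : 0 ≤ ∑ a ∈ (Finset.univ.erase o), (c.1 a - v a)^2 := Finset.sum_nonneg fun _ _ => sq_nonneg _
  have h5 := Rd_ge d
  have h6 := Rd_ge' d
  unfold Gam
  have g1 : √(c.2^2 - ∑ a ∈ Finset.univ.erase o, (c.1 a - v a)^2) ≤ c.2 := by
    rw [Real.sqrt_le_left (by linarith)]; linarith
  have g2 : c.2 - 1/16 ≤ √(c.2^2 - ∑ a ∈ Finset.univ.erase o, (c.1 a - v a)^2) := by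
    apply Real.le_sqrt_of_sq_le
    nlinarith
  constructor <;> linarith

/-- Everything needed for the planar estimates. -/
noncomputable def mkPD (o i : Fin d) (hi : i ≠ o) (f : (Fin d → ℝ) → ℝ) (hfm : Measurable f) (hf : ∀ v, |f v| ≤ 1)
    (v : Fin d → ℝ) (hv : ∀ a, v a ∈ Icc (0:ℝ) 1)
    (t w ξ ep : ℝ) (M L : ℕ) (t0 : 0 < t) (t1 : t ≤ 1) (ξt : |ξ| * t = 1) (w0 : 0 < w) (ep0 : 0 < ep) (M4 : 4 ≤ M)
    (ML : 1 ≤ (M:ℝ)^L * t) (epw : 4 * (M:ℝ)^2 * t ≤ ep * w) : PD (Cfg o) where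
  G0 c u := c.1.1 o + cG (c.1.1 i) (qq o i c.1 v) u
  G1 c u := c1 (c.1.1 i) (qq o i c.1 v) u
  G2 c u := c2 (c.1.1 i) (qq o i c.1 v) u
  G3 c u := c3 (c.1.1 i) (qq o i c.1 v) u
  g := kg (fun u s => f (Function.update (Function.update v i u) o s)) ξ w
  t := t
  w := w
  ξ := ξ
  ep := ep
  Bd := 4 * ∑ j ∈ Finset.range (L+4), hC j
  M := M
  L := L
  jet z z' := (z.2.good hi hv).jet (z'.2.good hi hv)
  G0m z := (cG_meas _ _).const_add _
  b0 z u hu := by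
    have := z.2.Gam_mem (v := Function.update v i u) (fun a => by
      rcases eq_or_ne a i with rfl | ha
      · rw [Function.update_self]; exact hu
      · rw [Function.update_of_ne ha]; exact hv a)
    rw [Gam_upd_i hi] at this
    rw [abs_le]; constructor <;> linarith [this.1, this.2]
  b1 z u hu := ((z.2.good hi hv).c1_abs hu).trans ((z.2.good hi hv).two_div.trans (by norm_num))
  b2 z u hu := ((z.2.good hi hv).c2_abs hu).trans (by norm_num)
  gm j := kg_meas (by
    have h1 : Measurable (fun p : ℝ × ℝ => Function.update (Function.update v i p.1) o p.2) :=
      (upd_meas o).comp (((upd_meas i).comp (measurable_const.prodMk measurable_fst)).prodMk measurable_snd)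
    exact hfm.comp h1) j
  gb j hj u y := (kg_bd (fun _ _ => hf _) w0 j u y).trans (by
    gcongr
    exact Finset.single_le_sum (f := hC) (fun _ _ => hC_nonneg _) (Finset.mem_range.2 (by omega)))
  gd j u y := kg_deriv (by
    have h1 : Measurable (fun p : ℝ × ℝ => Function.update (Function.update v i p.1) o p.2) :=
      (upd_meas o).comp (((upd_meas i).comp (measurable_const.prodMk measurable_fst)).prodMk measurable_snd)
    exact hfm.comp h1) (fun _ _ => hf _) w0 j u y
  t0 := t0
  t1 := t1
  ξt := ξt
  w0 := w0
  ep0 := ep0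
  M4 := M4
  ML := ML
  epw := epw

noncomputable def BdL (L : ℕ) : ℝ := 4 * ∑ j ∈ Finset.range (L+4), hC j

noncomputable def Fx (o : Fin d) (f : (Fin d → ℝ) → ℝ) (w ξ : ℝ) (c : (Fin d → ℝ) × ℝ) : ℂ :=
  ∫ v, ((f v : ℝ) : ℂ) * Complex.exp (Complex.I * ((ξ * (Gam o c v - v o) : ℝ) : ℂ)) *
    ((hk 0 ((Gam o c v - v o)/w) / w : ℝ) : ℂ) ∂(Pc d)

noncomputable def Fv (o i : Fin d) (f : (Fin d → ℝ) → ℝ) (w ξ : ℝ) (c : (Fin d → ℝ) × ℝ) (v : Fin d → ℝ) : ℂ :=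
  ∫ u in (0:ℝ)..1, Complex.exp (Complex.I * ((ξ * (c.1 o + cG (c.1 i) (qq o i c v) u) : ℝ) : ℂ)) *
    kg (fun u s => f (Function.update (Function.update v i u) o s)) ξ w 0 u (c.1 o + cG (c.1 i) (qq o i c v) u)

lemma norm_exp_I (x : ℝ) : ‖Complex.exp (Complex.I * (x : ℂ))‖ = 1 := by
  rw [mul_comm, Complex.norm_exp_ofReal_mul_I]

section
variable {o i : Fin d} {f : (Fin d → ℝ) → ℝ} {w ξ : ℝ}

lemma Fx_integrable (hfm : Measurable f) (hf : ∀ v, |f v| ≤ 1) (hw : 0 < w) (c : (Fin d → ℝ) × ℝ) :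
    Integrable (fun v => ((f v : ℝ) : ℂ) * Complex.exp (Complex.I * ((ξ * (Gam o c v - v o) : ℝ) : ℂ)) *
    ((hk 0 ((Gam o c v - v o)/w) / w : ℝ) : ℂ)) (Pc d) := by
  have hG := (Gam_meas o c).measurable
  have hh := (hk_cont 0).measurable
  apply Integrable.of_bound (C := hC 0 / w)
  · have : Measurable (fun v : Fin d → ℝ => hk 0 ((Gam o c v - v o)/w)) := hh.comp (by fun_prop)
    apply Measurable.aestronglyMeasurable
    fun_prop
  · refine ae_of_all _ fun v => ?_
    rw [norm_mul, norm_mul, norm_exp_I, mul_one, Complex.norm_real, Complex.norm_real,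
      Real.norm_eq_abs, Real.norm_eq_abs, abs_div, abs_of_pos hw]
    calc _ ≤ 1 * (hC 0 / w) := by
            gcongr
            · exact hf _
            · exact hk_le _ _
      _ = _ := one_mul _

lemma Fx_slice (hi : i ≠ o) (hfm : Measurable f) (hf : ∀ v, |f v| ≤ 1) (hw : 0 < w) (c : (Fin d → ℝ) × ℝ) :
    Integrable (Fv o i f w ξ c) (Pc d) ∧ Fx o f w ξ c = ∫ v, Fv o i f w ξ c v ∂(Pc d) := by
  have h := slice2 o i (Fx_integrable (o := o) (ξ := ξ) hfm hf hw c)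
  have e : (fun v : Fin d → ℝ => ∫ u in (0:ℝ)..1, ∫ s in (0:ℝ)..1, 
     ((f (Function.update (Function.update v i u) o s) : ℝ) : ℂ) * Complex.exp (Complex.I * ((ξ *
     (Gam o c (Function.update (Function.update v i u) o s) - (Function.update (Function.update v i u) o s) o) : ℝ) : ℂ)) *
    ((hk 0 ((Gam o c (Function.update (Function.update v i u) o s) - (Function.update (Function.update v i u) o s) o)/w) / w : ℝ) : ℂ)) = Fv o i f w ξ c := by
    ext v
    unfold Fv kg
    congr 1
    ext u
    rw [← intervalIntegral.integral_const_mul]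
    congr 1
    ext s
    rw [Gam_upd_o, Gam_upd_i hi, Function.update_self]
    have : Complex.exp (Complex.I * ((ξ * (c.1 o + cG (c.1 i) (qq o i c v) u - s) : ℝ) : ℂ)) =
       Complex.exp (Complex.I * ((ξ * (c.1 o + cG (c.1 i) (qq o i c v) u) : ℝ) : ℂ)) * 
         Complex.exp (-(Complex.I * ((ξ * s : ℝ) : ℂ))) := by
      rw [← Complex.exp_add]; congr 1; push_cast; ring
    rw [this]; ring
  rw [e] at h
  exact h

lemma Fv_bd (hf : ∀ v, |f v| ≤ 1) (hw : 0 < w) (c : (Fin d → ℝ) × ℝ) (v : Fin d → ℝ) : ‖Fv o i f w ξ c v‖ ≤ 4 * hC 0 := by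
  unfold Fv
  have := intervalIntegral.norm_integral_le_of_norm_le_const (a := (0:ℝ)) (b := 1) (C := 4 * hC 0)
    (f := fun u => Complex.exp (Complex.I * ((ξ * (c.1 o + cG (c.1 i) (qq o i c v) u) : ℝ) : ℂ)) *
    kg (fun u s => f (Function.update (Function.update v i u) o s)) ξ w 0 u (c.1 o + cG (c.1 i) (qq o i c v) u))
    (fun u _ => by
      rw [norm_mul, norm_exp_I, one_mul]
      exact kg_bd (fun _ _ => hf _) hw _ _ _)
  simpa using this

lemma Fx_bd (hi : i ≠ o) (hfm : Measurable f) (hf : ∀ v, |f v| ≤ 1) (hw : 0 < w) (c : (Fin d → ℝ) × ℝ) :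
    ‖Fx o f w ξ c‖ ≤ 4 * hC 0 := by
  rw [(Fx_slice hi hfm hf hw c).2]
  refine (norm_integral_le_of_norm_le_const (ae_of_all _ fun v => Fv_bd hf hw c v)).trans ?_
  simp

end
end MW

namespace MW
open MeasureTheory Metric Set
variable {d : ℕ} {o i : Fin d} {f : (Fin d → ℝ) → ℝ} {w ξ : ℝ}

def nearC (o i : Fin d) (τ : ℝ) (c c' : (Fin d → ℝ) × ℝ) : Prop := |c.1 i - c'.1 i| ≤ τ ∧ |c.1 o - c'.1 o| ≤ τ

lemma floor_close {x y t : ℝ} (ht : 0 < t) (h : ⌊x / t⌋ = ⌊y / t⌋) : |x - y| ≤ t := by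
  have := Int.abs_sub_lt_one_of_floor_eq_floor h
  rw [← sub_div, abs_div, abs_of_pos ht, div_lt_one ht] at this
  exact this.le

open Classical in
lemma mid_est (hi : i ≠ o) (hfm : Measurable f) (hf : ∀ v, |f v| ≤ 1)
    {t ep : ℝ} {M L : ℕ} (t0 : 0 < t) (t1 : t ≤ 1) (ξt : |ξ| * t = 1) (w0 : 0 < w) (ep0 : 0 < ep) (M4 : 4 ≤ M)
    (ML : 1 ≤ (M:ℝ)^L * t) (epw : 4 * (M:ℝ)^2 * t ≤ ep * w)
    {m S pw q P : ℕ} (hm : 2 ≤ m) (hmS : M^3 = m^2 * S)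
    (hmM : 48 * m^2 ≤ M) (hpw : 1 ≤ pw) (hMm : M^6 ≤ m^pw)
    (heps : 4 / M + (L+3:ℕ) * ep ≤ 1 / (2 * m)) {Q : ℝ} (hQ : 0 < Q)
    (hQq : 729 * (M:ℝ)^21 ≤ Q^q) (hP : P + 1 = pw + q)
    (X : Finset (Cfg o)) (wt : Cfg o → ℝ) (hwt : ∀ c, 0 ≤ wt c) {Y lam EW τ : ℝ} (hY : 0 < Y) (hlam : 0 < lam)
    (hτ : 100 * Rd d ^ 3 * t ≤ τ)
    (hEW : ∀ c ∈ X, ∑ c' ∈ X.filter (fun c' => nearC o i τ c.1 c'.1), wt c' *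
       (Pc d).real {v | |qq o i c.1 v - qq o i c'.1 v| ≤ τ} ≤ EW) :
    ∑ c ∈ X, wt c * ‖Fx o f w ξ c.1‖ ≤ BdL L / Y * EW * ∑ c ∈ X, wt c + lam * ∑ c ∈ X, wt c +
      Y * (((2^pw * (L + 2) * (8 * 9^3 * 4640^9) * m^40) * (Q^pw + 1))^L * (45 * (BdL L)^(pw+q) / t)) / lam^P := by
  set PE := ((2^pw * (L + 2) * (8 * 9^3 * 4640^9) * m^40) * (Q^pw + 1))^L * (45 * (BdL L)^(pw+q) / t) with hPE
  set W : Cfg o → (Fin d → ℝ) → ℝ := fun c v => ∑ c' ∈ X.filter (fun c' => nearC o i τ c.1 c'.1), wt c' *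
     indicator {v | |qq o i c.1 v - qq o i c'.1 v| ≤ τ} (fun _ => (1:ℝ)) v with hW
  have hB0 : 4 * hC 0 ≤ BdL L := by
    unfold BdL
    gcongr
    exact Finset.single_le_sum (f := hC) (fun _ _ => hC_nonneg _) (Finset.mem_range.2 (by omega))
  have hms : ∀ c c' : Cfg o, MeasurableSet {v | |qq o i c.1 v - qq o i c'.1 v| ≤ τ} := by
    intro c c'
    have h1 := (qq_meas o i c.1).measurable
    have h2 := (qq_meas o i c'.1).measurable
    exact measurableSet_le (by fun_prop) measurable_const
  have hWi1 : ∀ c c' : Cfg o, Integrable (fun v => wt c' *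
     indicator {v | |qq o i c.1 v - qq o i c'.1 v| ≤ τ} (fun _ => (1:ℝ)) v) (Pc d) :=
    fun c c' => ((integrable_const (1:ℝ)).indicator (hms c c')).const_mul _
  have hWi : ∀ c : Cfg o, Integrable (W c) (Pc d) := by
    intro c
    exact integrable_finsetSum _ fun c' _ => hWi1 c c'
  have hWE : ∀ c ∈ X, ∫ v, W c v ∂(Pc d) ≤ EW := by
    intro c hc
    refine le_trans (le_of_eq ?_) (hEW c hc)
    rw [hW]
    simp only
    rw [integral_finsetSum _ fun c' _ => hWi1 c c']
    apply Finset.sum_congr rfl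
    intro c' _
    rw [integral_const_mul, integral_indicator_const _ (hms c c'), smul_eq_mul, mul_one]
  have hFi : ∀ c : Cfg o, Integrable (fun v => ‖Fv o i f w ξ c.1 v‖) (Pc d) := fun c =>
    (Fx_slice hi hfm hf w0 c.1).1.norm
  have hpt : ∀ v : Fin d → ℝ, (∀ a, v a ∈ Icc (0:ℝ) 1) → ∑ c ∈ X, wt c * ‖Fv o i f w ξ c.1 v‖ ≤
      BdL L / Y * ∑ c ∈ X, wt c * W c v + lam * ∑ c ∈ X, wt c + Y * PE / lam^P := by
    intro v hv
    set D := mkPD o i hi f hfm hf v hv t w ξ ep M L t0 t1 ξt w0 ep0 M4 ML epw with hD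
    apply weight_split (D.cell 0 0) X wt (fun c => ‖Fv o i f w ξ c.1 v‖) (fun c => W c v) hwt
      (fun _ => norm_nonneg _) (fun c => (Fv_bd hf w0 c.1 v).trans hB0) hY hlam
    · intro c hc
      rw [hW]
      simp only
      calc _ = ∑ c' ∈ X.filter (fun c' => D.cell 0 0 c' = D.cell 0 0 c), wt c' *
             indicator {v | |qq o i c.1 v - qq o i c'.1 v| ≤ τ} (fun _ => (1:ℝ)) v := by
            apply Finset.sum_congr rfl
            intro c' hc'
            rw [Finset.mem_filter] at hc'
            have he := hc'.2
            simp only [PD.cell, Prod.mk.injEq] at he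
            have hal : D.al 0 = 1 := by simp [PD.al]
            rw [hal, one_mul, one_mul, one_pow, one_mul, one_mul] at he
            have k := Good.inv (c.2.good hi hv) (c'.2.good hi hv) (floor_close t0 he.1.symm) (floor_close t0 he.2.1.symm)
              (floor_close t0 he.2.2.symm)
            rw [indicator_of_mem, mul_one]
            exact k.2.2.trans hτ
        _ ≤ _ := by
            apply Finset.sum_le_sum_of_subset_of_nonneg
            · intro c' hc'
              rw [Finset.mem_filter] at hc' ⊢
              refine ⟨hc'.1, ?_⟩
              have he := hc'.2
              simp only [PD.cell, Prod.mk.injEq] at he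
              have hal : D.al 0 = 1 := by simp [PD.al]
              rw [hal, one_mul, one_mul, one_pow, one_mul, one_mul] at he
              have k := Good.inv (c.2.good hi hv) (c'.2.good hi hv) (floor_close t0 he.1.symm) (floor_close t0 he.2.1.symm)
                (floor_close t0 he.2.2.symm)
              exact ⟨k.1.trans hτ, k.2.1.trans hτ⟩
            · intro c' _ _
              exact mul_nonneg (hwt c') (indicator_nonneg (fun _ _ => zero_le_one) _)
    · intro Z _ hZ
      rw [hP]
      have := D.planar (m := m) (S := S) (pw := pw) (q := q) hm hmS hmM hpw hMm heps hQ hQq Z hZ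
      exact this
  calc _ ≤ ∑ c ∈ X, wt c * ∫ v, ‖Fv o i f w ξ c.1 v‖ ∂(Pc d) := by
        apply Finset.sum_le_sum
        intro c _
        apply mul_le_mul_of_nonneg_left _ (hwt c)
        rw [(Fx_slice hi hfm hf w0 c.1).2]
        exact norm_integral_le_integral_norm _
    _ = ∫ v, ∑ c ∈ X, wt c * ‖Fv o i f w ξ c.1 v‖ ∂(Pc d) := by
        rw [integral_finsetSum _ fun c _ => (hFi c).const_mul _]
        simp_rw [integral_const_mul]
    _ ≤ ∫ v, (BdL L / Y * ∑ c ∈ X, wt c * W c v + lam * ∑ c ∈ X, wt c + Y * PE / lam^P) ∂(Pc d) := by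
        apply integral_mono_ae
        · exact integrable_finsetSum _ fun c _ => (hFi c).const_mul _
        · refine (((integrable_finsetSum _ fun c _ => (hWi c).const_mul _).const_mul _).add (integrable_const _)).add (integrable_const _)
        · filter_upwards [Pc_ae d] with v hv using hpt v hv
    _ = BdL L / Y * ∑ c ∈ X, wt c * (∫ v, W c v ∂(Pc d)) + lam * ∑ c ∈ X, wt c + Y * PE / lam^P := by
        have hI : Integrable (fun v => BdL L / Y * ∑ c ∈ X, wt c * W c v) (Pc d) :=
          (integrable_finsetSum _ fun c _ => (hWi c).const_mul _).const_mul _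
        have hI2 : Integrable (fun v => BdL L / Y * ∑ c ∈ X, wt c * W c v + lam * ∑ c ∈ X, wt c) (Pc d) :=
          hI.add (integrable_const _)
        rw [integral_add hI2 (integrable_const _), integral_add hI (integrable_const _)]
        rw [integral_const_mul, integral_finsetSum _ fun c _ => (hWi c).const_mul _]
        simp_rw [integral_const_mul]
        simp
    _ ≤ BdL L / Y * ∑ c ∈ X, wt c * EW + lam * ∑ c ∈ X, wt c + Y * PE / lam^P := by
        have : 0 ≤ BdL L := le_trans (by have := hC_nonneg 0; positivity) hB0
        gcongr with c hc
        · exact hwt c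
        · exact hWE c hc
    _ = _ := by rw [← Finset.sum_mul]; ring

end MW

namespace MW
open MeasureTheory Metric Set
variable {d : ℕ} {o i : Fin d} {f : (Fin d → ℝ) → ℝ} {w : ℝ}

noncomputable def Kt (t s : ℝ) : ℝ := Real.exp (-s^2/(2*t^2)) / t

noncomputable def It (o : Fin d) (f : (Fin d → ℝ) → ℝ) (t : ℝ) (c : (Fin d → ℝ) × ℝ) : ℝ :=
  ∫ v, f v * Kt t (Gam o c v - v o) ∂(Pc d)

noncomputable def rho (w t : ℝ) : ℝ := 1 / √(1 - (t/w)^2)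

noncomputable def Psi (w t ξ : ℝ) : ℝ := rho w t * Real.exp (-((t * rho w t)^2/2) * ξ^2)

lemma rho_pos {t : ℝ} (hw : 0 < w) (ht : 0 < t) (htw : 2 * t ≤ w) : 1 ≤ rho w t ∧ rho w t ≤ 1 + (t/w)^2 ∧
    rho w t ≤ 2 ∧ 1 / (rho w t)^2 = 1 - (t/w)^2 := by
  have hk : t / w ≤ 1/2 := by rw [div_le_iff₀ hw]; linarith
  have hk0 : 0 < t / w := by positivity
  unfold rho
  set k := t / w
  have h1 : 0 < 1 - k^2 := by nlinarith
  have h2 : 0 < √(1 - k^2) := Real.sqrt_pos.2 h1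
  have h3 : √(1 - k^2) ≤ 1 := by rw [Real.sqrt_le_left (by norm_num)]; nlinarith
  have h4 : 1 / √(1-k^2) ≤ 1 + k^2 := by
    rw [div_le_iff₀ h2]
    have : 1 / (1 + k^2) ≤ √(1-k^2) := by
      apply Real.le_sqrt_of_sq_le
      rw [div_pow, div_le_iff₀ (by positivity)]
      have h5 : k^2 ≤ 1/4 := by nlinarith
      have h6 := sq_nonneg k
      generalize k^2 = x at *
      nlinarith [mul_nonneg h6 h6, mul_nonneg h6 (sub_nonneg.2 h5), mul_nonneg (mul_nonneg h6 h6) (sub_nonneg.2 h5)]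
    rw [div_le_iff₀ (by positivity)] at this
    linarith
  refine ⟨?_, h4, h4.trans (by nlinarith), ?_⟩
  · rw [le_div_iff₀ h2]; linarith
  · rw [div_pow, Real.sq_sqrt h1.le]; simp

lemma Psi_nonneg {t ξ : ℝ} : 0 ≤ Psi w t ξ := by unfold Psi rho; positivity

lemma Psi_int {t : ℝ} (hw : 0 < w) (ht : 0 < t) (htw : 2 * t ≤ w) : Integrable (Psi w t) ∧
    ∫ ξ, Psi w t ξ = √(2 * Real.pi) / t := by
  obtain ⟨h1, -, -, -⟩ := rho_pos hw ht htw
  have hp : 0 < (t * rho w t)^2/2 := by have : 0 < rho w t := by linarith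
                                        positivity
  have hr : 0 < rho w t := by linarith
  refine ⟨(integrable_exp_neg_mul_sq hp).const_mul _, ?_⟩
  unfold Psi
  rw [integral_const_mul, integral_gaussian]
  have : Real.pi / ((t * rho w t)^2/2) = (2 * Real.pi) / (t * rho w t)^2 := by field_simp
  rw [this, Real.sqrt_div (by positivity), Real.sqrt_sq (by positivity)]
  field_simp

lemma K_repr {t : ℝ} (hw : 0 < w) (ht : 0 < t) (htw : 2 * t ≤ w) (s : ℝ) :
    ∫ ξ : ℝ, (Psi w t ξ : ℂ) * Complex.exp (Complex.I * ((ξ * s : ℝ) : ℂ)) * ((hk 0 (s / w) : ℝ) : ℂ)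
      = ((√(2 * Real.pi) * Kt t s : ℝ) : ℂ) := by
  obtain ⟨h1, -, -, h4⟩ := rho_pos hw ht htw
  have hr : 0 < rho w t := by linarith
  have hp : 0 < (t * rho w t)^2/2 := by positivity
  have hg := fourierIntegral_gaussian (b := (((t * rho w t)^2/2 : ℝ) : ℂ)) (by rw [Complex.ofReal_re]; exact hp) (s : ℂ)
  have e : ∀ ξ : ℝ, (Psi w t ξ : ℂ) * Complex.exp (Complex.I * ((ξ * s : ℝ) : ℂ)) * ((hk 0 (s / w) : ℝ) : ℂ) =
    (((rho w t : ℝ) : ℂ) * ((hk 0 (s / w) : ℝ) : ℂ)) * (Complex.exp (Complex.I * (s:ℂ) * (ξ:ℂ)) *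
      Complex.exp (-(((t * rho w t)^2/2 : ℝ) : ℂ) * (ξ:ℂ)^2)) := by
    intro ξ
    unfold Psi
    push_cast
    have : Complex.I * ((ξ:ℂ) * (s:ℂ)) = Complex.I * (s:ℂ) * (ξ:ℂ) := by ring
    rw [this]; ring
  simp_rw [e]
  rw [integral_const_mul, hg]
  have e2 : ((Real.pi : ℂ) / (((t * rho w t)^2/2 : ℝ) : ℂ)) ^ (1/2 : ℂ) = ((√(2 * Real.pi) / (t * rho w t) : ℝ) : ℂ) := by
    have h5 : (Real.pi : ℂ) / (((t * rho w t)^2/2 : ℝ) : ℂ) = ((Real.pi / ((t * rho w t)^2/2) : ℝ) : ℂ) := by push_cast; ring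
    have h6 : (1/2 : ℂ) = ((1/2 : ℝ) : ℂ) := by push_cast; ring
    rw [h5, h6, ← Complex.ofReal_cpow (by positivity), ← Real.sqrt_eq_rpow]
    congr 1
    have : Real.pi / ((t * rho w t)^2/2) = (2 * Real.pi) / (t * rho w t)^2 := by field_simp
    rw [this, Real.sqrt_div (by positivity), Real.sqrt_sq (by positivity)]
  have e3 : Complex.exp (-(s:ℂ)^2 / (4 * (((t * rho w t)^2/2 : ℝ) : ℂ))) =
     ((Real.exp (-s^2 / (4 * ((t * rho w t)^2/2))) : ℝ) : ℂ) := by push_cast; rfl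
  rw [e2, e3, ← Complex.ofReal_mul, ← Complex.ofReal_mul, ← Complex.ofReal_mul]
  congr 1
  rw [hk_zero]
  unfold Kt
  have e4 : Real.exp (-s^2/(2*t^2)) = Real.exp (-(s/w)^2/2) * Real.exp (-s^2 / (4 * ((t * rho w t)^2/2))) := by
    rw [← Real.exp_add]
    congr 1
    have : -s^2 / (4 * ((t * rho w t)^2/2)) = -s^2/(2*t^2) * (1 / (rho w t)^2) := by field_simp; ring
    rw [this, h4]; field_simp; ring
  rw [e4]
  field_simp

lemma FxPsi_int (hfm : Measurable f) (hf : ∀ v, |f v| ≤ 1) {t : ℝ} (hw : 0 < w) (ht : 0 < t) (htw : 2 * t ≤ w)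
    (c : (Fin d → ℝ) × ℝ) :
    Integrable (fun ξ => ((Psi w t ξ * w : ℝ) : ℂ) * Fx o f w ξ c) ∧
    ∫ ξ, ((Psi w t ξ * w : ℝ) : ℂ) * Fx o f w ξ c = ((√(2 * Real.pi) * It o f t c : ℝ) : ℂ) := by
  have hG := (Gam_meas o c).measurable
  have hh := (hk_cont 0).measurable
  have hI : Integrable (fun p : (Fin d → ℝ) × ℝ => ((f p.1 : ℝ) : ℂ) * ((Psi w t p.2 : ℂ) * 
      Complex.exp (Complex.I * ((p.2 * (Gam o c p.1 - p.1 o) : ℝ) : ℂ)) * ((hk 0 ((Gam o c p.1 - p.1 o) / w) : ℝ) : ℂ)))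
      ((Pc d).prod volume) := by
    have hb : Integrable (fun p : (Fin d → ℝ) × ℝ => (1:ℝ) * (Psi w t p.2 * hC 0)) ((Pc d).prod volume) :=
      (integrable_const (1:ℝ)).mul_prod ((Psi_int hw ht htw).1.mul_const _)
    refine hb.mono' ?_ (ae_of_all _ fun p => ?_)
    · have h1 : Measurable (fun p : (Fin d → ℝ) × ℝ => hk 0 ((Gam o c p.1 - p.1 o)/w)) := hh.comp (by fun_prop)
      have h2 : Measurable (fun p : (Fin d → ℝ) × ℝ => Psi w t p.2) := by unfold Psi; fun_prop
      apply Measurable.aestronglyMeasurable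
      fun_prop
    · rw [norm_mul, norm_mul, norm_mul, norm_exp_I, mul_one, Complex.norm_real, Complex.norm_real, Complex.norm_real,
       Real.norm_eq_abs, Real.norm_eq_abs, Real.norm_eq_abs, abs_of_nonneg Psi_nonneg]
      have : 0 ≤ Psi w t p.2 := Psi_nonneg
      gcongr
      · exact hf _
      · exact hk_le _ _
  have e : ∀ ξ : ℝ, ∫ v, ((f v : ℝ) : ℂ) * ((Psi w t ξ : ℂ) * 
      Complex.exp (Complex.I * ((ξ * (Gam o c v - v o) : ℝ) : ℂ)) * ((hk 0 ((Gam o c v - v o) / w) : ℝ) : ℂ)) ∂(Pc d)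
      = ((Psi w t ξ * w : ℝ) : ℂ) * Fx o f w ξ c := by
    intro ξ
    unfold Fx
    rw [← integral_const_mul]
    congr 1
    ext v
    push_cast
    have : (w:ℂ) ≠ 0 := by exact_mod_cast hw.ne'
    field_simp
  have h1 := hI.integral_prod_right
  simp only [e] at h1
  refine ⟨h1, ?_⟩
  have h2 := integral_integral_swap (f := fun v ξ => ((f v : ℝ) : ℂ) * ((Psi w t ξ : ℂ) * 
      Complex.exp (Complex.I * ((ξ * (Gam o c v - v o) : ℝ) : ℂ)) * ((hk 0 ((Gam o c v - v o) / w) : ℝ) : ℂ))) hI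
  simp only [e] at h2
  rw [← h2]
  simp only [integral_const_mul, K_repr hw ht htw]
  unfold It
  rw [← integral_const_mul, ← integral_complex_ofReal]
  congr 1
  ext v
  push_cast; ring

lemma Psi_low {t t' ξ : ℝ} (hw : 0 < w) (ht : 0 < t) (ht' : 0 < t') (htt : t' ≤ t) (htw : 2 * t ≤ w) :
    |Psi w t' ξ - Psi w t ξ| ≤ 2 * (t/w)^2 + 2 * t^2 * ξ^2 := by
  obtain ⟨h1, h2, h3, -⟩ := rho_pos hw ht htw
  obtain ⟨h1', h2', h3', -⟩ := rho_pos hw ht' (by linarith : 2 * t' ≤ w)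
  have hk : (t'/w)^2 ≤ (t/w)^2 := by gcongr
  have ex : ∀ s : ℝ, 0 < s → s ≤ t → 1 ≤ rho w s → rho w s ≤ 2 →
     Real.exp (-((s * rho w s)^2/2) * ξ^2) ≤ 1 ∧ 1 - 2 * t^2 * ξ^2 ≤ Real.exp (-((s * rho w s)^2/2) * ξ^2) := by
    intro s hs hst r1 r2
    constructor
    · apply Real.exp_le_one_iff.2
      have : 0 ≤ ((s * rho w s)^2/2) * ξ^2 := by positivity
      linarith
    · have := Real.add_one_le_exp (-((s * rho w s)^2/2) * ξ^2)
      refine le_trans ?_ this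
      have : (s * rho w s)^2 ≤ (t * 2)^2 := by gcongr
      nlinarith [sq_nonneg ξ]
  obtain ⟨a1, a2⟩ := ex t ht le_rfl h1 h3
  obtain ⟨b1, b2⟩ := ex t' ht' htt h1' h3'
  have a0 := Real.exp_pos (-((t * rho w t)^2/2) * ξ^2)
  have b0 := Real.exp_pos (-((t' * rho w t')^2/2) * ξ^2)
  unfold Psi
  generalize Real.exp (-((t * rho w t)^2/2) * ξ^2) = E at *
  generalize Real.exp (-((t' * rho w t')^2/2) * ξ^2) = E' at *
  have i1 : 0 ≤ (rho w t - 1) * E := mul_nonneg (by linarith) a0.le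
  have i2 : (rho w t - 1) * E ≤ (t/w)^2 * 1 := by
    apply mul_le_mul (by linarith) a1 a0.le (sq_nonneg _)
  have i1' : 0 ≤ (rho w t' - 1) * E' := mul_nonneg (by linarith) b0.le
  have i2' : (rho w t' - 1) * E' ≤ (t/w)^2 * 1 := by
    apply mul_le_mul (by linarith) b1 b0.le (sq_nonneg _)
  have k0 := sq_nonneg (t/w)
  rw [abs_le]
  constructor <;> linarith

lemma Psi_high {t t' ξ h : ℝ} (hw : 0 < w) (ht : 0 < t) (ht' : 0 < t') (htt : t' ≤ t) (htw : 2 * t ≤ w) (h0 : 0 ≤ h)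
    (hξ : h ≤ |ξ|) :
    |Psi w t' ξ - Psi w t ξ| ≤ 4 * Real.exp (-(t'*h)^2/4) * Real.exp (-(t'^2/4) * ξ^2) := by
  have ex : ∀ s : ℝ, 0 < s → t' ≤ s → s ≤ t → Psi w s ξ ≤ 2 * Real.exp (-(t'*h)^2/4) * Real.exp (-(t'^2/4) * ξ^2) := by
    intro s hs h1 h2
    obtain ⟨r1, r2, r3, -⟩ := rho_pos hw hs (by linarith : 2 * s ≤ w)
    unfold Psi
    rw [mul_assoc, ← Real.exp_add]
    gcongr
    have i1 : t'^2 ≤ (s * rho w s)^2 := by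
      gcongr
      nlinarith
    have i2 : h^2 ≤ ξ^2 := by rw [← sq_abs ξ]; gcongr
    nlinarith [mul_le_mul_of_nonneg_right i1 (sq_nonneg ξ), mul_le_mul_of_nonneg_left i2 (sq_nonneg t')]
  have e1 := ex t ht htt le_rfl
  have e2 := ex t' ht' le_rfl htt
  have p1 : 0 ≤ Psi w t ξ := Psi_nonneg
  have p2 : 0 ≤ Psi w t' ξ := Psi_nonneg
  rw [abs_le]; constructor <;> linarith

/-- The Littlewood–Paley difference bounded by the middle frequencies. -/
lemma LP_est (hi : i ≠ o) (hfm : Measurable f) (hf : ∀ v, |f v| ≤ 1) {t t' lo hg Bm : ℝ} (hw : 0 < w) (ht : 0 < t) (ht' : 0 < t')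
    (htt : t' ≤ t) (htw : 2 * t ≤ w) (hlo : 0 ≤ lo) (hhg : 0 ≤ hg) (hBm : 0 ≤ Bm)
    (X : Finset (Cfg o)) (wt : Cfg o → ℝ) (hwt : ∀ c, 0 ≤ wt c)
    (hmid : ∀ ξ : ℝ, lo ≤ |ξ| → |ξ| ≤ hg → ∑ c ∈ X, wt c * ‖Fx o f w ξ c.1‖ ≤ Bm) :
    ∑ c ∈ X, wt c * |It o f t' c.1 - It o f t c.1| ≤
      w * (Bm * (√(2 * Real.pi) / t' + √(2 * Real.pi) / t) + 4 * hC 0 * (∑ c ∈ X, wt c) *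
       (2 * lo * (2 * (t/w)^2 + 2 * t^2 * lo^2) + 4 * Real.exp (-(t'*hg)^2/4) * √(Real.pi / (t'^2/4)))) := by
  have htw' : 2 * t' ≤ w := by linarith
  set Wt := ∑ c ∈ X, wt c with hWt
  have hWt0 : 0 ≤ Wt := Finset.sum_nonneg fun c _ => hwt c
  have hC0 := hC_nonneg 0
  have hpi : 1 ≤ √(2 * Real.pi) := by
    rw [Real.one_le_sqrt]; linarith [Real.pi_gt_three]
  have h_int : ∀ c : Cfg o, Integrable (fun ξ => ((Psi w t' ξ * w : ℝ) : ℂ) * Fx o f w ξ c.1 - ((Psi w t ξ * w : ℝ) : ℂ) * Fx o f w ξ c.1) :=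
    fun c => (FxPsi_int hfm hf hw ht' htw' c.1).1.sub (FxPsi_int hfm hf hw ht htw c.1).1
  have hrep : ∀ c : Cfg o, |It o f t' c.1 - It o f t c.1| ≤ ∫ ξ, |Psi w t' ξ - Psi w t ξ| * w * ‖Fx o f w ξ c.1‖ := by
    intro c
    have h1 : ∫ ξ, (((Psi w t' ξ * w : ℝ) : ℂ) * Fx o f w ξ c.1 - ((Psi w t ξ * w : ℝ) : ℂ) * Fx o f w ξ c.1) =
       ((√(2 * Real.pi) * (It o f t' c.1 - It o f t c.1) : ℝ) : ℂ) := by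
      rw [integral_sub (FxPsi_int hfm hf hw ht' htw' c.1).1 (FxPsi_int hfm hf hw ht htw c.1).1,
        (FxPsi_int hfm hf hw ht' htw' c.1).2, (FxPsi_int hfm hf hw ht htw c.1).2]
      push_cast; ring
    have h2 := norm_integral_le_integral_norm (μ := volume) (fun ξ : ℝ => (((Psi w t' ξ * w : ℝ) : ℂ) * Fx o f w ξ c.1 - ((Psi w t ξ * w : ℝ) : ℂ) * Fx o f w ξ c.1))
    rw [h1, Complex.norm_real, Real.norm_eq_abs, abs_mul, abs_of_pos (by linarith : 0 < √(2 * Real.pi))] at h2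
    refine le_trans (le_mul_of_one_le_left (abs_nonneg _) hpi) (h2.trans (le_of_eq ?_))
    congr 1
    ext ξ
    rw [← sub_mul, ← Complex.ofReal_sub, norm_mul, Complex.norm_real, Real.norm_eq_abs, ← sub_mul, abs_mul, abs_of_pos hw]
  have hint2 : ∀ c : Cfg o, Integrable (fun ξ => |Psi w t' ξ - Psi w t ξ| * w * ‖Fx o f w ξ c.1‖) := by
    intro c
    refine (h_int c).norm.congr (ae_of_all _ fun ξ => ?_)
    simp only
    rw [← sub_mul, ← Complex.ofReal_sub, norm_mul, Complex.norm_real, Real.norm_eq_abs, ← sub_mul, abs_mul, abs_of_pos hw]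
  set κ := 2 * (t/w)^2 + 2 * t^2 * lo^2 with hκ
  have hκ0 : 0 ≤ κ := by positivity
  have hpt : ∀ ξ, ∑ c ∈ X, wt c * (|Psi w t' ξ - Psi w t ξ| * w * ‖Fx o f w ξ c.1‖) ≤
     w * (Bm * (Psi w t' ξ + Psi w t ξ)) + w * (4 * hC 0 * Wt) * (indicator (Icc (-lo) lo) (fun _ => κ) ξ) +
      w * (4 * hC 0 * Wt) * (4 * Real.exp (-(t'*hg)^2/4)) * Real.exp (-(t'^2/4) * ξ^2) := by
    intro ξ
    have e : ∑ c ∈ X, wt c * (|Psi w t' ξ - Psi w t ξ| * w * ‖Fx o f w ξ c.1‖) =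
      w * |Psi w t' ξ - Psi w t ξ| * ∑ c ∈ X, wt c * ‖Fx o f w ξ c.1‖ := by
      rw [Finset.mul_sum]; apply Finset.sum_congr rfl; intro c _; ring
    rw [e]
    have p1 : 0 ≤ Psi w t ξ := Psi_nonneg
    have p2 : 0 ≤ Psi w t' ξ := Psi_nonneg
    have triv : ∑ c ∈ X, wt c * ‖Fx o f w ξ c.1‖ ≤ 4 * hC 0 * Wt := by
      rw [hWt, Finset.mul_sum]
      apply Finset.sum_le_sum
      intro c _
      rw [mul_comm]
      exact mul_le_mul_of_nonneg_right (Fx_bd hi hfm hf hw c.1) (hwt c)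
    have t1 : 0 ≤ w * (Bm * (Psi w t' ξ + Psi w t ξ)) := by positivity
    have t2 : 0 ≤ w * (4 * hC 0 * Wt) * (indicator (Icc (-lo) lo) (fun _ => κ) ξ) :=
      mul_nonneg (by positivity) (indicator_nonneg (fun _ _ => hκ0) _)
    have t3 : 0 ≤ w * (4 * hC 0 * Wt) * (4 * Real.exp (-(t'*hg)^2/4)) * Real.exp (-(t'^2/4) * ξ^2) := by positivity
    have s0 : 0 ≤ ∑ c ∈ X, wt c * ‖Fx o f w ξ c.1‖ := Finset.sum_nonneg fun c _ => mul_nonneg (hwt c) (norm_nonneg _)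
    rcases le_or_gt lo |ξ| with h1 | h1
    · rcases le_or_gt |ξ| hg with h2 | h2
      · have := hmid ξ h1 h2
        have ha : |Psi w t' ξ - Psi w t ξ| ≤ Psi w t' ξ + Psi w t ξ := by
          rw [abs_le]; constructor <;> linarith
        calc _ ≤ w * (Psi w t' ξ + Psi w t ξ) * Bm := by gcongr
          _ = w * (Bm * (Psi w t' ξ + Psi w t ξ)) := by ring
          _ ≤ _ := by linarith
      · have := Psi_high hw ht ht' htt htw hhg h2.le
        calc _ ≤ w * (4 * Real.exp (-(t'*hg)^2/4) * Real.exp (-(t'^2/4) * ξ^2)) * (4 * hC 0 * Wt) := by gcongr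
          _ = w * (4 * hC 0 * Wt) * (4 * Real.exp (-(t'*hg)^2/4)) * Real.exp (-(t'^2/4) * ξ^2) := by ring
          _ ≤ _ := by linarith
    · have hm : ξ ∈ Icc (-lo) lo := abs_le.1 h1.le
      rw [indicator_of_mem hm] at t2 ⊢
      have h3 := Psi_low (ξ := ξ) hw ht ht' htt htw
      have h4 : |Psi w t' ξ - Psi w t ξ| ≤ κ := by
        refine h3.trans ?_
        rw [hκ, ← sq_abs ξ]
        gcongr
      calc _ ≤ w * κ * (4 * hC 0 * Wt) := by gcongr
        _ = w * (4 * hC 0 * Wt) * κ := by ring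
        _ ≤ _ := by linarith
  obtain ⟨P1, P2⟩ := Psi_int hw ht htw
  obtain ⟨P1', P2'⟩ := Psi_int hw ht' htw'
  have g0 : 0 < t'^2/4 := by positivity
  have I1 : Integrable (fun ξ => w * (Bm * (Psi w t' ξ + Psi w t ξ))) := ((P1'.add P1).const_mul Bm).const_mul w
  have I2 : Integrable (fun ξ => w * (4 * hC 0 * Wt) * (indicator (Icc (-lo) lo) (fun _ => κ) ξ)) := by
    apply Integrable.const_mul
    rw [integrable_indicator_iff measurableSet_Icc]
    exact integrableOn_const (by simp)
  have I3 : Integrable (fun ξ => w * (4 * hC 0 * Wt) * (4 * Real.exp (-(t'*hg)^2/4)) * Real.exp (-(t'^2/4) * ξ^2)) :=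
    (integrable_exp_neg_mul_sq g0).const_mul _
  have I12 : Integrable (fun ξ => w * (Bm * (Psi w t' ξ + Psi w t ξ)) + w * (4 * hC 0 * Wt) * (indicator (Icc (-lo) lo) (fun _ => κ) ξ)) := I1.add I2
  have I123 : Integrable (fun ξ => w * (Bm * (Psi w t' ξ + Psi w t ξ)) + w * (4 * hC 0 * Wt) * (indicator (Icc (-lo) lo) (fun _ => κ) ξ) +
      w * (4 * hC 0 * Wt) * (4 * Real.exp (-(t'*hg)^2/4)) * Real.exp (-(t'^2/4) * ξ^2)) := I12.add I3
  calc _ ≤ ∑ c ∈ X, wt c * ∫ ξ, |Psi w t' ξ - Psi w t ξ| * w * ‖Fx o f w ξ c.1‖ := by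
        apply Finset.sum_le_sum
        intro c _
        exact mul_le_mul_of_nonneg_left (hrep c) (hwt c)
    _ = ∫ ξ, ∑ c ∈ X, wt c * (|Psi w t' ξ - Psi w t ξ| * w * ‖Fx o f w ξ c.1‖) := by
        rw [integral_finsetSum _ fun c _ => (hint2 c).const_mul _]
        simp_rw [integral_const_mul]
    _ ≤ _ := integral_mono (integrable_finsetSum _ fun c _ => (hint2 c).const_mul _) I123 hpt
    _ = _ := by
        rw [integral_add I12 I3, integral_add I1 I2, integral_const_mul, integral_const_mul, integral_add P1' P1, P2, P2',
          integral_const_mul, integral_indicator_const _ measurableSet_Icc, integral_const_mul, integral_gaussian,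
          Real.volume_real_Icc_of_le (by linarith)]
        rw [smul_eq_mul]; ring

end MW

namespace MW
open MeasureTheory Metric Set

open Classical in
/-- Greedy weights: every point lies in a saturated cell. -/
lemma greedy {ι κ : Type} (cl : ℕ → ι → κ) (b : ℕ → ℝ) (hb : ∀ j, 0 ≤ b j) (J : ℕ) (X : Finset ι) :
    ∃ w : ι → ℝ, (∀ x, 0 ≤ w x) ∧ (∀ j ≤ J, ∀ c, ∑ y ∈ X.filter (fun y => cl j y = c), w y ≤ b j) ∧
      ∀ x ∈ X, ∃ j ≤ J, b j ≤ ∑ y ∈ X.filter (fun y => cl j y = cl j x), w y := by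
  induction X using Finset.induction_on with
  | empty => exact ⟨fun _ => 0, by simp, by simpa using fun j _ _ => hb j, by simp⟩
  | insert x X hx ih =>
    obtain ⟨w, h0, h1, h2⟩ := ih
    obtain ⟨j0, hj0, hmin⟩ := Finset.exists_min_image (Finset.range (J+1))
      (fun j => b j - ∑ y ∈ X.filter (fun y => cl j y = cl j x), w y) ⟨0, by simp⟩
    set δ := b j0 - ∑ y ∈ X.filter (fun y => cl j0 y = cl j0 x), w y with hδ
    have hj0' : j0 ≤ J := by simpa [Nat.lt_succ_iff] using hj0
    have hδ0 : 0 ≤ δ := sub_nonneg.2 (h1 j0 hj0' _)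
    have hsum : ∀ j c, ∑ y ∈ X.filter (fun y => cl j y = c), Function.update w x δ y =
        ∑ y ∈ X.filter (fun y => cl j y = c), w y := by
      intro j c
      apply Finset.sum_congr rfl
      intro y hy
      rw [Function.update_of_ne]
      rintro rfl
      exact hx (Finset.mem_filter.1 hy).1
    have hsum2 : ∀ j, ∑ y ∈ (insert x X).filter (fun y => cl j y = cl j x), Function.update w x δ y =
        δ + ∑ y ∈ X.filter (fun y => cl j y = cl j x), w y := by
      intro j
      rw [Finset.filter_insert, if_pos rfl, Finset.sum_insert (by simp [hx]), hsum]
      simp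
    have hsum3 : ∀ j c, cl j x ≠ c → ∑ y ∈ (insert x X).filter (fun y => cl j y = c), Function.update w x δ y =
        ∑ y ∈ X.filter (fun y => cl j y = c), w y := by
      intro j c hc
      rw [Finset.filter_insert, if_neg hc, hsum]
    refine ⟨Function.update w x δ, ?_, ?_, ?_⟩
    · intro y
      by_cases h : y = x
      · subst h; simpa using hδ0
      · rw [Function.update_of_ne h]; exact h0 y
    · intro j hj c
      by_cases h : cl j x = c
      · subst h
        rw [hsum2]
        have := hmin j (by simpa [Nat.lt_succ_iff] using hj)
        linarith
      · rw [hsum3 j c h]; exact h1 j hj c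
    · intro y hy
      rcases Finset.mem_insert.1 hy with rfl | hy
      · exact ⟨j0, hj0', by rw [hsum2]; linarith⟩
      · obtain ⟨j, hj, hj2⟩ := h2 y hy
        refine ⟨j, hj, ?_⟩
        by_cases h : cl j x = cl j y
        · rw [← h] at hj2 ⊢
          rw [hsum2]; linarith
        · rw [hsum3 j _ h]; exact hj2

open Classical in
/-- Finite Frostman lemma. -/
lemma frostman {ι κ : Type} (cl : ℕ → ι → κ) (hcl : ∀ j j' x y, j ≤ j' → cl j' x = cl j' y → cl j x = cl j y)
    (b : ℕ → ℝ) (hb : ∀ j, 0 ≤ b j) (J : ℕ) (X : Finset ι) :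
    ∃ w : ι → ℝ, (∀ x, 0 ≤ w x) ∧ (∀ j ≤ J, ∀ c, ∑ y ∈ X.filter (fun y => cl j y = c), w y ≤ b j) ∧
      ∃ kp : ι → ℕ, (∀ x ∈ X, kp x ≤ J) ∧
       ∑ c ∈ X.image (fun x => (kp x, cl (kp x) x)), b c.1 ≤ ∑ x ∈ X, w x := by
  obtain ⟨w, h0, h1, h2⟩ := greedy cl b hb J X
  have h3 : ∀ x : ι, ∃ j, x ∈ X → j ≤ J ∧ b j ≤ ∑ y ∈ X.filter (fun y => cl j y = cl j x), w y ∧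
     ∀ j' < j, ¬ b j' ≤ ∑ y ∈ X.filter (fun y => cl j' y = cl j' x), w y := by
    intro x
    by_cases hx : x ∈ X
    · have hex : ∃ j, j ≤ J ∧ b j ≤ ∑ y ∈ X.filter (fun y => cl j y = cl j x), w y := by
        obtain ⟨j, a, b⟩ := h2 x hx; exact ⟨j, a, b⟩
      refine ⟨Nat.find hex, fun _ => ⟨(Nat.find_spec hex).1, (Nat.find_spec hex).2, ?_⟩⟩
      intro j' hj' hc
      exact Nat.find_min hex hj' ⟨hj'.le.trans (Nat.find_spec hex).1, hc⟩
    · exact ⟨0, fun h => absurd h hx⟩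
  choose kp hkp using h3
  refine ⟨w, h0, h1, kp, fun x hx => (hkp x hx).1, ?_⟩
  calc _ ≤ ∑ c ∈ X.image (fun x => (kp x, cl (kp x) x)), ∑ y ∈ X.filter (fun y => cl c.1 y = c.2), w y := by
        apply Finset.sum_le_sum
        intro c hc
        obtain ⟨x, hx, rfl⟩ := Finset.mem_image.1 hc
        exact (hkp x hx).2.1
    _ = ∑ y ∈ (X.image (fun x => (kp x, cl (kp x) x))).biUnion (fun c => X.filter (fun y => cl c.1 y = c.2)), w y := by
        rw [Finset.sum_biUnion]
        intro c hc c' hc' hne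
        obtain ⟨x, hx, rfl⟩ := Finset.mem_image.1 (Finset.mem_coe.1 hc)
        obtain ⟨x', hx', rfl⟩ := Finset.mem_image.1 (Finset.mem_coe.1 hc')
        rw [Function.onFun, Finset.disjoint_left]
        intro y hy hy'
        apply hne
        have e1 := (Finset.mem_filter.1 hy).2
        have e2 := (Finset.mem_filter.1 hy').2
        simp only at e1 e2
        have key : ∀ x x', x ∈ X → x' ∈ X → cl (kp x) y = cl (kp x) x → cl (kp x') y = cl (kp x') x' →
            kp x ≤ kp x' → kp x = kp x' := by
          intro x x' hx hx' e1 e2 hle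
          by_contra hn
          have hlt := lt_of_le_of_ne hle hn
          have := hcl _ _ _ _ hle e2
          have k1 := (hkp x hx).2.1
          have k2 := (hkp x' hx').2.2 _ hlt
          rw [← this, e1] at k2
          exact k2 k1
        have hk : kp x = kp x' := by
          rcases le_total (kp x) (kp x') with h | h
          · exact key x x' hx hx' e1 e2 h
          · exact (key x' x hx' hx e2 e1 h).symm
        rw [Prod.mk.injEq]
        refine ⟨hk, ?_⟩
        rw [← e1, ← e2, hk]
    _ ≤ _ := by
        apply Finset.sum_le_sum_of_subset_of_nonneg
        · intro y hy
          rw [Finset.mem_biUnion] at hy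
          obtain ⟨c, _, hy⟩ := hy
          exact (Finset.mem_filter.1 hy).1
        · intro y _ _; exact h0 y

end MW

namespace MW
open MeasureTheory Metric Set
variable {d : ℕ} {o i : Fin d}

noncomputable def cellc (j : ℕ) (x : Fin d → ℝ) : Fin d → ℤ := fun a => ⌊2^j * x a⌋

lemma cellc_nest (j j' : ℕ) (x y : Fin d → ℝ) (h : j ≤ j') (e : cellc j' x = cellc j' y) : cellc j x = cellc j y := by
  funext a
  have := congrFun e a
  unfold cellc at *
  obtain ⟨m, rfl⟩ := Nat.exists_eq_add_of_le h
  have key : ∀ z : ℝ, ⌊2^j * z⌋ = ⌊2^(j+m) * z⌋ / ((2^m : ℕ):ℤ) := by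
    intro z
    rw [← Int.floor_div_natCast]
    congr 1
    push_cast
    field_simp
    ring
  rw [key, key, this]

lemma floor_near {ρ x y : ℝ} (hρ : 0 < ρ) (h : |x - y| ≤ 1/ρ) : ⌊ρ * y⌋ ∈ Finset.Icc (⌊ρ * x⌋ - 1) (⌊ρ * x⌋ + 1) := by
  have h1 := abs_le.1 h
  have e : ρ * (1/ρ) = 1 := by field_simp
  have h2 : ρ * y ≤ ρ * x + 1 := by nlinarith [mul_le_mul_of_nonneg_left h1.1 hρ.le]
  have h3 : ρ * x - 1 ≤ ρ * y := by nlinarith [mul_le_mul_of_nonneg_left h1.2 hρ.le]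
  rw [Finset.mem_Icc]
  constructor
  · have := Int.floor_le_floor h3
    rwa [Int.floor_sub_one] at this
  · have := Int.floor_le_floor h2
    rwa [Int.floor_add_one] at this

lemma sum_biUnion_le' {ι κ : Type} [DecidableEq ι] (N : Finset κ) (F : κ → Finset ι) (w : ι → ℝ) (hw : ∀ x, 0 ≤ w x) :
    ∑ y ∈ N.biUnion F, w y ≤ ∑ z ∈ N, ∑ y ∈ F z, w y := by
  classical
  induction N using Finset.induction_on with
  | empty => simp
  | insert z N hz ih =>
    rw [Finset.biUnion_insert, Finset.sum_insert hz]
    have := Finset.sum_union_inter (s₁ := F z) (s₂ := N.biUnion F) (f := w)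
    have h2 : 0 ≤ ∑ y ∈ F z ∩ N.biUnion F, w y := Finset.sum_nonneg fun y _ => hw y
    linarith

open Classical in
/-- weight of a sup-ball -/
lemma ball_weight {J : ℕ} {b : ℕ → ℝ} (X : Finset (Cfg o)) (w : Cfg o → ℝ) (hw : ∀ c, 0 ≤ w c)
    (hX : ∀ j ≤ J, ∀ z, ∑ y ∈ X.filter (fun y => cellc j y.1.1 = z), w y ≤ b j) (j : ℕ) (hj : j ≤ J) (x : Fin d → ℝ) :
    ∑ y ∈ X.filter (fun y => ∀ a, |x a - y.1.1 a| ≤ 1/2^j), w y ≤ 3^d * b j := by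
  set N := Fintype.piFinset (fun a => Finset.Icc (cellc j x a - 1) (cellc j x a + 1)) with hN
  have hcard : N.card = 3^d := by
    rw [hN, Fintype.card_piFinset]
    simp only [Int.card_Icc]
    rw [Finset.prod_congr rfl (g := fun _ => 3)]
    · simp
    · intro a _
      have : cellc j x a + 1 + 1 - (cellc j x a - 1) = 3 := by ring
      rw [this]; rfl
  calc _ ≤ ∑ y ∈ N.biUnion (fun z => X.filter (fun y => cellc j y.1.1 = z)), w y := by
        apply Finset.sum_le_sum_of_subset_of_nonneg
        · intro y hy
          rw [Finset.mem_filter] at hy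
          rw [Finset.mem_biUnion]
          refine ⟨cellc j y.1.1, ?_, Finset.mem_filter.2 ⟨hy.1, rfl⟩⟩
          rw [hN, Fintype.mem_piFinset]
          intro a
          exact floor_near (by positivity) (hy.2 a)
        · intro y _ _; exact hw y
    _ ≤ ∑ z ∈ N, ∑ y ∈ X.filter (fun y => cellc j y.1.1 = z), w y :=
        sum_biUnion_le' _ _ w hw
    _ ≤ ∑ z ∈ N, b j := Finset.sum_le_sum fun z _ => hX j hj z
    _ = _ := by rw [Finset.sum_const, hcard]; simp

lemma qq_diff_upd {c c' : (Fin d → ℝ) × ℝ} {a : Fin d} (hao : a ≠ o) (hai : a ≠ i) (v : Fin d → ℝ) (s : ℝ) :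
    qq o i c (Function.update v a s) - qq o i c' (Function.update v a s) =
    qq o i c (Function.update v a 0) - qq o i c' (Function.update v a 0) + (2 * (c.1 a - c'.1 a)) * s := by
  unfold qq
  have hm : a ∈ (Finset.univ.erase o).erase i := by simp [hao, hai]
  have key : ∀ (c : (Fin d → ℝ) × ℝ) (s : ℝ), ∑ e ∈ (Finset.univ.erase o).erase i, (c.1 e - Function.update v a s e)^2 =
    (c.1 a - s)^2 + ∑ e ∈ ((Finset.univ.erase o).erase i).erase a, (c.1 e - v e)^2 := by
    intro c s
    rw [← Finset.add_sum_erase _ _ hm]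
    congr 1
    · simp
    · apply Finset.sum_congr rfl
      intro e he
      rw [Function.update_of_ne (Finset.ne_of_mem_erase he)]
  rw [key, key, key, key]
  ring

/-- probability bound -/
lemma qq_prob (c c' : Cfg o) {τ : ℝ} (hτ : 0 < τ) (hn : nearC o i τ c.1 c'.1) (x : ℝ)
    (hx : τ < x) (hD : ¬ ∀ a, |c.1.1 a - c'.1.1 a| ≤ x) :
    (Pc d).real {v | |qq o i c.1 v - qq o i c'.1 v| ≤ τ} ≤ τ / x := by
  push Not at hD
  obtain ⟨a, ha⟩ := hD
  have hao : a ≠ o := by rintro rfl; linarith [hn.2]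
  have hai : a ≠ i := by rintro rfl; linarith [hn.1]
  have hne : c.1.1 a - c'.1.1 a ≠ 0 := by
    intro h; rw [h] at ha; simp at ha; linarith
  have := prob_affine (d := d) a (A := fun v => qq o i c.1 v - qq o i c'.1 v) (c := τ)
    (((qq_meas o i c.1).sub (qq_meas o i c'.1)).measurable) (β := 2 * (c.1.1 a - c'.1.1 a)) (by simpa using hne) hτ.le
    (fun v s => qq_diff_upd hao hai v s)
  refine this.trans ?_
  rw [abs_mul, abs_two, mul_div_mul_left _ _ (by norm_num)]
  gcongr
  linarith

lemma cfg_diff (c c' : Cfg o) (a : Fin d) : |c.1.1 a - c'.1.1 a| ≤ 1/8 := by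
  by_cases h : a = o
  · subst h
    have h1 := abs_le.1 c.2.h2
    have h2 := abs_le.1 c'.2.h2
    rw [abs_le]; constructor <;> linarith
  · have h1 := abs_le.1 (c.2.h1 a h)
    have h2 := abs_le.1 (c'.2.h1 a h)
    rw [abs_le]; constructor <;> linarith

open Classical in
lemma prob_dyadic (c c' : Cfg o) (T : ℕ) (hn : nearC o i (1/2^T) c.1 c'.1) :
    (Pc d).real {v | |qq o i c.1 v - qq o i c'.1 v| ≤ 1/2^T} ≤
     ∑ j ∈ Finset.range (T+1), if (∀ a, |c.1.1 a - c'.1.1 a| ≤ 1/2^j) then 2 * 2^j / (2:ℝ)^T else 0 := by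
  have hnn : ∀ j ∈ Finset.range (T+1), (0:ℝ) ≤ if (∀ a, |c.1.1 a - c'.1.1 a| ≤ 1/2^j) then 2 * 2^j / (2:ℝ)^T else 0 := by
    intro j _
    split_ifs <;> positivity
  by_cases h : ∀ a, |c.1.1 a - c'.1.1 a| ≤ 1/2^T
  · refine le_trans ?_ (Finset.single_le_sum hnn (Finset.mem_range.2 (Nat.lt_succ_self T)))
    rw [if_pos h]
    have : 2 * 2^T / (2:ℝ)^T = 2 := by field_simp
    rw [this]
    exact measureReal_le_one.trans (by norm_num)
  · have hex : ∃ j, ¬ ∀ a, |c.1.1 a - c'.1.1 a| ≤ 1/2^j := ⟨T, h⟩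
    set j := Nat.find hex with hj
    have h1 : ¬ ∀ a, |c.1.1 a - c'.1.1 a| ≤ 1/2^j := Nat.find_spec hex
    have hjT : j ≤ T := Nat.find_min' hex h
    have hj0 : j ≠ 0 := by
      intro h0
      rw [h0] at h1
      apply h1
      intro a
      have := cfg_diff c c' a
      simp; linarith
    obtain ⟨l, hl⟩ := Nat.exists_eq_succ_of_ne_zero hj0
    have h2 : ∀ a, |c.1.1 a - c'.1.1 a| ≤ 1/2^l := by
      have := Nat.find_min hex (show l < j by omega)
      exact not_not.1 this
    refine le_trans ?_ (Finset.single_le_sum hnn (Finset.mem_range.2 (show l < T + 1 by omega)))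
    rw [if_pos h2]
    rw [hl] at h1
    rcases Nat.lt_or_ge (l+1) T with hlT | hlT
    · refine (qq_prob c c' (by positivity) hn (1/2^(l+1)) ?_ h1).trans (le_of_eq ?_)
      · apply one_div_lt_one_div_of_lt (by positivity)
        exact pow_lt_pow_right₀ (by norm_num) hlT
      · field_simp; ring
    · have : T = l + 1 := by omega
      rw [this]
      have : 2 * 2^l / (2:ℝ)^(l+1) = 1 := by rw [pow_succ]; field_simp
      rw [this]
      exact measureReal_le_one

open Classical in
/-- Multiplicity estimate. -/
lemma mult_est {J T K : ℕ} {e ν γ : ℝ} (he0 : 0 < e) (he1 : e ≤ 1) (X : Finset (Cfg o)) (w : Cfg o → ℝ) (hw : ∀ c, 0 ≤ w c)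
    (hX : ∀ j ≤ J, ∀ z, ∑ y ∈ X.filter (fun y => cellc j y.1.1 = z), w y ≤ (e/2)^j) (hT : T ≤ J)
    (hK : e^K ≤ γ) (hν : 2^K * ν ≤ γ) (c : Cfg o) 
    (hc : ∑ c' ∈ X.filter (fun c' => nearC o i (1/2^T) c.1 c'.1), w c' ≤ ν) :
    ∑ c' ∈ X.filter (fun c' => nearC o i (1/2^T) c.1 c'.1), w c' *
       (Pc d).real {v | |qq o i c.1 v - qq o i c'.1 v| ≤ 1/2^T} ≤ (T+1) * (2 * 3^d * γ / 2^T) := by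
  have h3 : (1:ℝ) ≤ 3^d := one_le_pow₀ (by norm_num)
  have hγ : 0 < γ := lt_of_lt_of_le (by positivity) hK
  calc _ ≤ ∑ c' ∈ X.filter (fun c' => nearC o i (1/2^T) c.1 c'.1), ∑ j ∈ Finset.range (T+1), 
        (2 * 2^j / (2:ℝ)^T) * (if (∀ a, |c.1.1 a - c'.1.1 a| ≤ 1/2^j) then w c' else 0) := by
        apply Finset.sum_le_sum
        intro c' hc'
        refine (mul_le_mul_of_nonneg_left (prob_dyadic c c' T (Finset.mem_filter.1 hc').2) (hw c')).trans (le_of_eq ?_)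
        rw [Finset.mul_sum]
        apply Finset.sum_congr rfl
        intro j _
        split_ifs <;> ring
    _ = ∑ j ∈ Finset.range (T+1), (2 * 2^j / (2:ℝ)^T) * ∑ c' ∈ (X.filter (fun c' => nearC o i (1/2^T) c.1 c'.1)).filter
         (fun c' => ∀ a, |c.1.1 a - c'.1.1 a| ≤ 1/2^j), w c' := by
        rw [Finset.sum_comm]
        apply Finset.sum_congr rfl
        intro j _
        rw [← Finset.mul_sum]
        congr 1
        exact (Finset.sum_filter _ _).symm
    _ ≤ ∑ j ∈ Finset.range (T+1), (2 * 3^d * γ / 2^T) := by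
        apply Finset.sum_le_sum
        intro j hj
        have hjT : j ≤ T := by simpa [Nat.lt_succ_iff] using hj
        suffices h : 2^j * ∑ c' ∈ (X.filter (fun c' => nearC o i (1/2^T) c.1 c'.1)).filter
         (fun c' => ∀ a, |c.1.1 a - c'.1.1 a| ≤ 1/2^j), w c' ≤ 3^d * γ by
          calc _ = 2 / 2^T * (2^j * ∑ c' ∈ (X.filter (fun c' => nearC o i (1/2^T) c.1 c'.1)).filter
         (fun c' => ∀ a, |c.1.1 a - c'.1.1 a| ≤ 1/2^j), w c') := by ring
            _ ≤ 2 / 2^T * (3^d * γ) := by gcongr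
            _ = _ := by ring
        rcases le_total K j with hKj | hKj
        · have h1 : ∑ c' ∈ (X.filter (fun c' => nearC o i (1/2^T) c.1 c'.1)).filter
             (fun c' => ∀ a, |c.1.1 a - c'.1.1 a| ≤ 1/2^j), w c' ≤ 3^d * (e/2)^j := by
            refine le_trans ?_ (ball_weight X w hw hX j (hjT.trans hT) c.1.1)
            apply Finset.sum_le_sum_of_subset_of_nonneg
            · intro y hy
              rw [Finset.mem_filter, Finset.mem_filter] at hy
              exact Finset.mem_filter.2 ⟨hy.1.1, hy.2⟩
            · intro y _ _; exact hw y
          calc _ ≤ 2^j * (3^d * (e/2)^j) := by gcongr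
            _ = 3^d * e^j := by rw [div_pow]; field_simp
            _ ≤ 3^d * e^K := by gcongr 3^d * ?_; exact pow_le_pow_of_le_one he0.le he1 hKj
            _ ≤ _ := by gcongr
        · have h1 : ∑ c' ∈ (X.filter (fun c' => nearC o i (1/2^T) c.1 c'.1)).filter
             (fun c' => ∀ a, |c.1.1 a - c'.1.1 a| ≤ 1/2^j), w c' ≤ ν := by
            refine le_trans ?_ hc
            apply Finset.sum_le_sum_of_subset_of_nonneg (Finset.filter_subset _ _)
            intro y _ _; exact hw y
          have h0 : 0 ≤ ∑ c' ∈ (X.filter (fun c' => nearC o i (1/2^T) c.1 c'.1)).filter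
             (fun c' => ∀ a, |c.1.1 a - c'.1.1 a| ≤ 1/2^j), w c' := Finset.sum_nonneg fun y _ => hw y
          calc _ ≤ 2^K * ν := by gcongr; norm_num
            _ ≤ γ := hν
            _ ≤ _ := le_mul_of_one_le_left hγ.le h3
    _ = _ := by rw [Finset.sum_const, Finset.card_range, nsmul_eq_mul]; push_cast; ring

end MW

namespace MW
open MeasureTheory Metric Set
variable {d : ℕ} {o i : Fin d}

lemma nb_card (p : ℤ × ℤ) : (Finset.Icc (p.1 - 1) (p.1 + 1) ×ˢ Finset.Icc (p.2 - 1) (p.2 + 1)).card = 9 := by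
  rw [Finset.card_product, Int.card_Icc, Int.card_Icc]
  have h : ∀ x : ℤ, x + 1 + 1 - (x - 1) = 3 := fun x => by ring
  rw [h, h]; rfl

open Classical in
lemma pair_count {T : ℕ} {ν : ℝ} (X Z : Finset (Cfg o)) (w : Cfg o → ℝ) (hw : ∀ c, 0 ≤ w c)
    (hZ : ∀ c ∈ Z, ν ≤ ∑ c' ∈ X.filter (fun c' => nearC o i (1/2^T) c.1 c'.1), w c') :
    (Z.image (fun c : Cfg o => (cellc T c.1.1 i, cellc T c.1.1 o))).card * ν ≤ 9 * ∑ c ∈ X, w c := by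
  set pr : Cfg o → ℤ × ℤ := fun c : Cfg o => (cellc T c.1.1 i, cellc T c.1.1 o) with hpr
  set Nb : ℤ × ℤ → Finset (ℤ × ℤ) := fun p => Finset.Icc (p.1 - 1) (p.1 + 1) ×ˢ Finset.Icc (p.2 - 1) (p.2 + 1) with hNb
  calc _ = ∑ p ∈ Z.image pr, ν := by rw [Finset.sum_const, nsmul_eq_mul]
    _ ≤ ∑ p ∈ Z.image pr, ∑ y ∈ X, (if pr y ∈ Nb p then w y else 0) := by
        apply Finset.sum_le_sum
        intro p hp
        obtain ⟨c, hc, rfl⟩ := Finset.mem_image.1 hp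
        refine (hZ c hc).trans ?_
        rw [← Finset.sum_filter]
        apply Finset.sum_le_sum_of_subset_of_nonneg
        · intro y hy
          rw [Finset.mem_filter] at hy ⊢
          refine ⟨hy.1, ?_⟩
          rw [hNb, Finset.mem_product]
          exact ⟨floor_near (by positivity) hy.2.1, floor_near (by positivity) hy.2.2⟩
        · intro y _ _; exact hw y
    _ = ∑ y ∈ X, ∑ p ∈ Z.image pr, (if pr y ∈ Nb p then w y else 0) := Finset.sum_comm
    _ ≤ ∑ y ∈ X, 9 * w y := by
        apply Finset.sum_le_sum
        intro y _
        rw [← Finset.sum_filter, Finset.sum_const, nsmul_eq_mul]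
        apply mul_le_mul_of_nonneg_right _ (hw y)
        have : ((Z.image pr).filter (fun p => pr y ∈ Nb p)).card ≤ (Nb (pr y)).card := by
          apply Finset.card_le_card
          intro p hp
          rw [Finset.mem_filter] at hp
          have := hp.2
          simp only [hNb, Finset.mem_product, Finset.mem_Icc] at this ⊢
          omega
        rw [nb_card] at this
        exact_mod_cast this
    _ = _ := by rw [Finset.mul_sum]

open Classical in
lemma badall {J T : ℕ} {b ν : ℝ} (hd : ∃ i, i ≠ o) (hν : 0 < ν) (hν1 : ν ≤ 1) (hb : 0 ≤ b)
    (X Z : Finset (Cfg o)) (hZX : Z ⊆ X) (w : Cfg o → ℝ) (hw : ∀ c, 0 ≤ w c)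
    (hX : ∀ z, ∑ y ∈ X.filter (fun y => cellc T y.1.1 = z), w y ≤ b) (hW : ∑ c ∈ X, w c ≤ 1)
    (hZ : ∀ c ∈ Z, ∀ i, i ≠ o → ν ≤ ∑ c' ∈ X.filter (fun c' => nearC o i (1/2^T) c.1 c'.1), w c') :
    ∑ c ∈ Z, w c ≤ (9/ν)^d * b := by
  have hcard : (((Z.image (fun c : Cfg o => cellc T c.1.1)).card : ℕ) : ℝ) ≤ (9/ν)^d := by
    have h1 : (Z.image (fun c : Cfg o => cellc T c.1.1)).card ≤ 
       (Fintype.piFinset (fun i : {i // i ≠ o} => Z.image (fun c : Cfg o => (cellc T c.1.1 i.1, cellc T c.1.1 o)))).card := by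
      apply Finset.card_le_card_of_injOn (fun z i => (z i.1, z o))
      · intro z hz
        obtain ⟨c, hc, rfl⟩ := Finset.mem_image.1 (Finset.mem_coe.1 hz)
        rw [Finset.mem_coe, Fintype.mem_piFinset]
        intro i
        exact Finset.mem_image.2 ⟨c, hc, rfl⟩
      · intro z _ z' _ hzz
        obtain ⟨i0, hi0⟩ := hd
        funext a
        by_cases ha : a = o
        · subst ha
          exact congrArg Prod.snd (congrFun hzz ⟨i0, hi0⟩)
        · exact congrArg Prod.fst (congrFun hzz ⟨a, ha⟩)
    rw [Fintype.card_piFinset] at h1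
    have h9 : 1 ≤ 9 / ν := by rw [le_div_iff₀ hν]; linarith
    calc _ ≤ ((∏ i : {i // i ≠ o}, (Z.image (fun c : Cfg o => (cellc T c.1.1 i.1, cellc T c.1.1 o))).card : ℕ) : ℝ) := by
          exact_mod_cast h1
      _ = ∏ i : {i // i ≠ o}, ((Z.image (fun c : Cfg o => (cellc T c.1.1 i.1, cellc T c.1.1 o))).card : ℝ) := by push_cast; rfl
      _ ≤ ∏ i : {i // i ≠ o}, (9/ν) := by
          apply Finset.prod_le_prod
          · intro _ _; positivity
          · intro i _
            have := pair_count X Z w hw (fun c hc => hZ c hc i.1 i.2)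
            rw [le_div_iff₀ hν]
            linarith
      _ = (9/ν)^(Fintype.card {i // i ≠ o}) := by rw [Finset.prod_const, Finset.card_univ]
      _ ≤ (9/ν)^d := by
          apply pow_le_pow_right₀ h9
          simp
  calc _ ≤ ∑ y ∈ (Z.image (fun c : Cfg o => cellc T c.1.1)).biUnion (fun z => X.filter (fun y => cellc T y.1.1 = z)), w y := by
        apply Finset.sum_le_sum_of_subset_of_nonneg
        · intro y hy
          rw [Finset.mem_biUnion]
          exact ⟨_, Finset.mem_image_of_mem _ hy, Finset.mem_filter.2 ⟨hZX hy, rfl⟩⟩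
        · intro y _ _; exact hw y
    _ ≤ ∑ z ∈ Z.image (fun c : Cfg o => cellc T c.1.1), ∑ y ∈ X.filter (fun y => cellc T y.1.1 = z), w y := sum_biUnion_le' _ _ w hw
    _ ≤ ∑ z ∈ Z.image (fun c : Cfg o => cellc T c.1.1), b := Finset.sum_le_sum fun z _ => hX z
    _ = ((Z.image (fun c : Cfg o => cellc T c.1.1)).card : ℝ) * b := by rw [Finset.sum_const, nsmul_eq_mul]
    _ ≤ _ := by gcongr

lemma cell_zero (c c' : Cfg o) : cellc 0 c.1.1 = cellc 0 c'.1.1 := by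
  funext a
  unfold cellc
  simp only [pow_zero, one_mul]
  by_cases h : a = o
  · subst h
    have h1 := abs_le.1 c.2.h2
    have h2 := abs_le.1 c'.2.h2
    unfold Rd at h1 h2
    have e : ∀ x : ℝ, -(1/16) ≤ x + 100 * ((d:ℝ)+1) - 1/2 → x + 100 * ((d:ℝ)+1) - 1/2 ≤ 1/16 → ⌊x⌋ = -(100 * ((d:ℤ)+1)) := by
      intro x h1 h2
      rw [Int.floor_eq_iff]
      push_cast
      constructor <;> linarith
    rw [e _ h1.1 h1.2, e _ h2.1 h2.2]
  · have h1 := abs_le.1 (c.2.h1 a h)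
    have h2 := abs_le.1 (c'.2.h1 a h)
    have e : ∀ x : ℝ, -(1/16) ≤ x - 1/2 → x - 1/2 ≤ 1/16 → ⌊x⌋ = 0 := by
      intro x h1 h2
      rw [Int.floor_eq_iff]
      push_cast
      constructor <;> linarith
    rw [e _ h1.1 h1.2, e _ h2.1 h2.2]

open Classical in
/-- pigeonhole -/
lemma pigeon {T : ℕ} {b ν : ℝ} (hd : ∃ i, i ≠ o) (hν : 0 < ν) (hν1 : ν ≤ 1) (hb : 0 ≤ b)
    (X : Finset (Cfg o)) (w : Cfg o → ℝ) (hw : ∀ c, 0 ≤ w c)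
    (hX : ∀ z, ∑ y ∈ X.filter (fun y => cellc T y.1.1 = z), w y ≤ b) (hW : ∑ c ∈ X, w c ≤ 1) :
    (∃ i, i ≠ o ∧ ∑ c ∈ X, w c ≤ (d + 1) * ∑ c ∈ X.filter (fun c : Cfg o => ∑ c' ∈ X.filter (fun c' => nearC o i (1/2^T) c.1 c'.1), w c' ≤ ν), w c) ∨
      ∑ c ∈ X, w c ≤ (d + 1) * ((9/ν)^d * b) := by
  by_contra hcon
  push Not at hcon
  obtain ⟨h1, h2⟩ := hcon
  set G : Fin d → Finset (Cfg o) := fun i => X.filter (fun c : Cfg o => ∑ c' ∈ X.filter (fun c' => nearC o i (1/2^T) c.1 c'.1), w c' ≤ ν) with hG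
  set Z := X.filter (fun c : Cfg o => ∀ i, i ≠ o → ν ≤ ∑ c' ∈ X.filter (fun c' => nearC o i (1/2^T) c.1 c'.1), w c') with hZ
  have hZw : ∑ c ∈ Z, w c ≤ (9/ν)^d * b := 
    badall (J := 0) hd hν hν1 hb X Z (Finset.filter_subset _ _) w hw hX hW (fun c hc => (Finset.mem_filter.1 hc).2)
  have hcov : ∑ c ∈ X, w c ≤ ∑ c ∈ Z, w c + ∑ i ∈ Finset.univ.erase o, ∑ c ∈ G i, w c := by
    calc _ ≤ ∑ c ∈ Z ∪ (Finset.univ.erase o).biUnion G, w c := by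
          apply Finset.sum_le_sum_of_subset_of_nonneg
          · intro c hc
            rw [Finset.mem_union]
            by_cases h : ∀ i, i ≠ o → ν ≤ ∑ c' ∈ X.filter (fun c' => nearC o i (1/2^T) c.1 c'.1), w c'
            · exact Or.inl (Finset.mem_filter.2 ⟨hc, h⟩)
            · push Not at h
              obtain ⟨i, hi, h⟩ := h
              exact Or.inr (Finset.mem_biUnion.2 ⟨i, by simp [hi], Finset.mem_filter.2 ⟨hc, h.le⟩⟩)
          · intro y _ _; exact hw y
      _ ≤ ∑ c ∈ Z, w c + ∑ c ∈ (Finset.univ.erase o).biUnion G, w c := by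
          have := Finset.sum_union_inter (s₁ := Z) (s₂ := (Finset.univ.erase o).biUnion G) (f := w)
          have h2 : 0 ≤ ∑ y ∈ Z ∩ (Finset.univ.erase o).biUnion G, w y := Finset.sum_nonneg fun y _ => hw y
          linarith
      _ ≤ _ := by
          gcongr
          exact sum_biUnion_le' _ _ w hw
  set W := ∑ c ∈ X, w c with hWd
  have hd1 : (0:ℝ) < d + 1 := by positivity
  have k1 : ∑ c ∈ Z, w c < W / (d+1) := by rw [lt_div_iff₀ hd1]; nlinarith
  have hW0 : 0 ≤ W := Finset.sum_nonneg fun y _ => hw y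
  have k2 : ∑ i ∈ Finset.univ.erase o, ∑ c ∈ G i, w c ≤ d * (W / (d+1)) := by
    calc _ ≤ ∑ i ∈ Finset.univ.erase o, W / (d+1) := by
          apply Finset.sum_le_sum
          intro i hi
          have := h1 i (Finset.ne_of_mem_erase hi)
          rw [le_div_iff₀ hd1]; linarith
      _ ≤ ∑ i : Fin d, W / (d+1) := Finset.sum_le_sum_of_subset_of_nonneg (Finset.erase_subset _ _) (fun _ _ _ => by positivity)
      _ = _ := by simp
  have : W / (d+1) + d * (W/(d+1)) = W := by field_simp; ring
  linarith

end MW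

namespace MW
open MeasureTheory Metric Set
variable {d : ℕ} {o i : Fin d} {f : (Fin d → ℝ) → ℝ} {w : ℝ}

open Classical in
lemma mid2 (hi : i ≠ o) (hfm : Measurable f) (hf : ∀ v, |f v| ≤ 1) {r L b A H g P n : ℕ} (hr : 3 ≤ r)
    (hA : A = 8*r^2) (hb : b = 3*r^2) (hH : H + 3*r^2 = r^2*L) (hbH : b ≤ H) (hP : P + 1 = 7*r + 22*r^2)
    (hn1 : 729 ≤ n) (hn2 : 8*(L+4) ≤ n) (hn3 : 100 * Rd d^3 ≤ n) (hn4 : BdL L ≤ n) (hn5 : 45 * (BdL L)^(P+1) ≤ n)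
    (hn6 : 2^(7*r) * (L+2) * (8 * 9^3 * 4640^9) * 2 ≤ n)
    (hw : w = (n:ℝ)^((A:ℤ) - H))
    (X : Finset (Cfg o)) (wt : Cfg o → ℝ) (hwt : ∀ c, 0 ≤ wt c) {τ : ℝ} (hτ : (n:ℝ)^((b:ℤ)+1-H) ≤ τ)
    (hEW : ∀ c ∈ X, ∑ c' ∈ X.filter (fun c' => nearC o i τ c.1 c'.1), wt c' *
       (Pc d).real {v | |qq o i c.1 v - qq o i c'.1 v| ≤ τ} ≤ (n:ℝ)^((b:ℤ)+3-g-H))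
    (ξ : ℝ) (hlo : (n:ℝ)^((H:ℤ)-b) ≤ |ξ|) (hhi : |ξ| ≤ (n:ℝ)^((H:ℤ)+b)) :
    ∑ c ∈ X, wt c * ‖Fx o f w ξ c.1‖ ≤ 2 * (n:ℝ)^(-(A:ℤ)-3) * ∑ c ∈ X, wt c +
      (n:ℝ)^(2*(b:ℤ)+8+A-g+48*r*L+(A+3)*P) := by
  have hn729 : (729:ℝ) ≤ n := by exact_mod_cast hn1
  have n0 : (0:ℝ) < n := by linarith
  have nne : (n:ℝ) ≠ 0 := n0.ne'
  have n1 : (1:ℝ) ≤ n := by linarith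
  have nn1 : 1 ≤ n := by omega
  have hξ0 : 0 < |ξ| := lt_of_lt_of_le (by positivity) hlo
  have hr2 : 3 * r ≤ r^2 := by nlinarith
  set t := 1/|ξ| with ht
  have t0 : 0 < t := by positivity
  have tub : t ≤ (n:ℝ)^((b:ℤ)-H) := by
    rw [ht, show (b:ℤ)-H = -((H:ℤ)-b) by ring, zpow_neg, one_div]
    gcongr
  have tlb : (n:ℝ)^(-((H:ℤ)+b)) ≤ t := by
    rw [ht, zpow_neg, one_div]
    gcongr
  have t1 : t ≤ 1 := tub.trans (zpow_le_one_of_nonpos₀ n1 (by omega))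
  have hBnn : 0 ≤ BdL L := by
    unfold BdL
    have : 0 ≤ ∑ j ∈ Finset.range (L+4), hC j := Finset.sum_nonneg fun j _ => hC_nonneg j
    linarith
  have key := mid_est (i := i) (o := o) (f := f) (w := w) (ξ := ξ) hi hfm hf (t := t) (ep := 4 * (n:ℝ)^(-(3*(r:ℤ)^2))) (M := n^(r^2)) (L := L)
    t0 t1 (by rw [ht]; field_simp) (by rw [hw]; positivity) (by positivity) ?_ ?_ ?_ (m := n^r) (S := n^(3*r^2-2*r)) (pw := 7*r) (q := 22*r^2) (P := P)
    ?_ ?_ ?_ ?_ ?_ ?_ (Q := (n:ℝ)) n0 ?_ hP X wt hwt (Y := (n:ℝ)^((b:ℤ)+7+A-g-H)) (lam := (n:ℝ)^(-(A:ℤ)-3))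
    (EW := (n:ℝ)^((b:ℤ)+3-g-H)) (τ := τ) (by positivity) (by positivity) ?_ hEW
  · refine key.trans ?_
    have e1 : BdL L / (n:ℝ)^((b:ℤ)+7+A-g-H) * (n:ℝ)^((b:ℤ)+3-g-H) ≤ (n:ℝ)^(-(A:ℤ)-3) := by
      rw [div_mul_eq_mul_div, mul_div_assoc, ← zpow_sub₀ nne]
      calc _ ≤ (n:ℝ)^(1:ℤ) * (n:ℝ)^((b:ℤ)+3-g-H - ((b:ℤ)+7+A-g-H)) := by gcongr; simpa using hn4
        _ = _ := by rw [← zpow_add₀ nne]; congr 1; ring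
    have hW : 0 ≤ ∑ c ∈ X, wt c := Finset.sum_nonneg fun c _ => hwt c
    have e2 : (n:ℝ)^((b:ℤ)+7+A-g-H) * (((2^(7*r) * (L + 2) * (8 * 9^3 * 4640^9) * ((n^r:ℕ):ℝ)^40) * ((n:ℝ)^(7*r) + 1))^L * 
        (45 * (BdL L)^(7*r+22*r^2) / t)) / ((n:ℝ)^(-(A:ℤ)-3))^P ≤ (n:ℝ)^(2*(b:ℤ)+8+A-g+48*r*L+(A+3)*P) := by
      have hK : (2^(7*r) * (L + 2) * (8 * 9^3 * 4640^9) * ((n^r:ℕ):ℝ)^40) * ((n:ℝ)^(7*r) + 1) ≤ (n:ℝ)^(48*r) := by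
        have a1 : ((n^r:ℕ):ℝ)^40 = (n:ℝ)^(40*r) := by push_cast; rw [← pow_mul, mul_comm r]
        have a2 : (n:ℝ)^(7*r) + 1 ≤ 2 * (n:ℝ)^(7*r) := by
          have : 1 ≤ (n:ℝ)^(7*r) := one_le_pow₀ n1
          linarith
        have a3 : (2^(7*r) * (L+2) * (8 * 9^3 * 4640^9) * 2 : ℝ) ≤ n := by exact_mod_cast hn6
        rw [a1]
        calc _ ≤ (2^(7*r) * (L + 2) * (8 * 9^3 * 4640^9) * (n:ℝ)^(40*r)) * (2 * (n:ℝ)^(7*r)) := by gcongr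
          _ = (2^(7*r) * (L + 2) * (8 * 9^3 * 4640^9) * 2) * ((n:ℝ)^(40*r) * (n:ℝ)^(7*r)) := by ring
          _ ≤ (n:ℝ) * ((n:ℝ)^(40*r) * (n:ℝ)^(7*r)) := by gcongr
          _ = (n:ℝ)^(47*r+1) := by ring
          _ ≤ _ := pow_le_pow_right₀ n1 (by omega)
      have hPE : 45 * (BdL L)^(7*r+22*r^2) / t ≤ (n:ℝ)^((H:ℤ)+b+1) := by
        rw [ht, div_div_eq_mul_div, div_one, ← hP, zpow_add₀ nne, mul_comm, zpow_one]
        gcongr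
      have hl : ((n:ℝ)^(-(A:ℤ)-3))^P = (n:ℝ)^((-(A:ℤ)-3)*P) := by rw [zpow_mul, zpow_natCast]
      rw [hl]
      have hK2 : ((2^(7*r) * (L + 2) * (8 * 9^3 * 4640^9) * ((n^r:ℕ):ℝ)^40) * ((n:ℝ)^(7*r) + 1))^L ≤ (n:ℝ)^(48*(r:ℤ)*L) := by
        calc _ ≤ ((n:ℝ)^(48*r))^L := pow_le_pow_left₀ (by positivity) hK L
          _ = _ := by rw [← pow_mul, ← zpow_natCast]; push_cast; rfl
      calc _ ≤ (n:ℝ)^((b:ℤ)+7+A-g-H) * ((n:ℝ)^(48*(r:ℤ)*L) * (n:ℝ)^((H:ℤ)+b+1)) / (n:ℝ)^((-(A:ℤ)-3)*P) := by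
            gcongr
        _ = _ := by
            rw [← zpow_add₀ nne, ← zpow_add₀ nne, ← zpow_sub₀ nne]
            congr 1; ring
    have e3 := mul_le_mul_of_nonneg_right e1 hW
    linarith
  · calc 4 ≤ n^1 := by rw [pow_one]; omega
      _ ≤ n^(r^2) := Nat.pow_le_pow_right nn1 (by nlinarith)
  · calc (1:ℝ) = ((n^(r^2):ℕ):ℝ)^L * (n:ℝ)^(-((H:ℤ)+b)) := by
          push_cast
          rw [← pow_mul, ← zpow_natCast, ← zpow_add₀ nne, hb]
          have : ((r^2*L : ℕ):ℤ) + -((H:ℤ)+((3*r^2:ℕ):ℤ)) = 0 := by rw [← hH]; push_cast; ring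
          rw [this, zpow_zero]
      _ ≤ _ := by gcongr
  · calc 4 * ((n^(r^2):ℕ):ℝ)^2 * t ≤ 4 * ((n^(r^2):ℕ):ℝ)^2 * (n:ℝ)^((b:ℤ)-H) := by gcongr
      _ = 4 * (n:ℝ)^(2*(r:ℤ)^2+b-H) := by
          push_cast
          rw [← pow_mul, ← zpow_natCast, mul_assoc, ← zpow_add₀ nne]
          congr 2; push_cast; ring
      _ = _ := by
          rw [hw, mul_assoc, ← zpow_add₀ nne, hA, hb]
          congr 2; push_cast; ring
  · calc 2 ≤ n^1 := by rw [pow_one]; omega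
      _ ≤ n^r := Nat.pow_le_pow_right nn1 (by omega)
  · rw [← pow_mul, ← pow_mul, ← pow_add]; congr 1; omega
  · calc 48 * (n^r)^2 ≤ n * n^(r*2) := by rw [← pow_mul]; gcongr; omega
      _ = n^(r*2+1) := by ring
      _ ≤ _ := Nat.pow_le_pow_right nn1 (by omega)
  · omega
  · rw [← pow_mul, ← pow_mul]; exact Nat.pow_le_pow_right nn1 (by nlinarith)
  · push_cast
    have a1 : (4:ℝ) / (n:ℝ)^(r^2) = 4 * (n:ℝ)^(-((r:ℤ)^2)) := by
      rw [zpow_neg, div_eq_mul_inv]; congr 2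
    have a2 : (1:ℝ) / (2 * (n:ℝ)^r) = 1/2 * (n:ℝ)^(-(r:ℤ)) := by
      rw [zpow_neg, zpow_natCast]; field_simp
    have hr2' : 3 * (r:ℤ) ≤ (r:ℤ)^2 := by exact_mod_cast hr2
    have hr3 : (3:ℤ) ≤ r := by exact_mod_cast hr
    have a3 : (n:ℝ)^(-((r:ℤ)^2)) ≤ (n:ℝ)^(-(r:ℤ)-1) := zpow_le_zpow_right₀ n1 (by linarith)
    have a4 : (n:ℝ)^(-(3*(r:ℤ)^2)) ≤ (n:ℝ)^(-(r:ℤ)-1) := zpow_le_zpow_right₀ n1 (by linarith)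
    rw [a1, a2]
    have a5 : (n:ℝ)^(-(r:ℤ)) = n * (n:ℝ)^(-(r:ℤ)-1) := by
      rw [← zpow_one_add₀ nne]; congr 1; ring
    have a6 : (8*((L:ℝ)+4)) ≤ n := by exact_mod_cast hn2
    rw [a5]
    calc _ ≤ 4 * (n:ℝ)^(-(r:ℤ)-1) + ((L:ℝ)+3) * (4 * (n:ℝ)^(-(r:ℤ)-1)) := by gcongr
      _ = 1/2 * ((8*((L:ℝ)+4)) * (n:ℝ)^(-(r:ℤ)-1)) := by ring
      _ ≤ _ := by gcongr
  · push_cast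
    rw [← pow_mul]
    calc (729:ℝ) * (n:ℝ)^(r^2*21) ≤ n * (n:ℝ)^(r^2*21) := by gcongr
      _ = (n:ℝ)^(r^2*21+1) := by ring
      _ ≤ _ := pow_le_pow_right₀ n1 (by nlinarith)
  · refine le_trans ?_ hτ
    calc 100 * Rd d^3 * t ≤ n * (n:ℝ)^((b:ℤ)-H) := by gcongr
      _ = _ := by rw [← zpow_one_add₀ nne]; congr 1; ring

end MW

namespace MW
open MeasureTheory Metric Set
variable {d : ℕ} {o i : Fin d} {f : (Fin d → ℝ) → ℝ}

lemma exp_neg_le {x : ℝ} (hx : 0 < x) : Real.exp (-x) ≤ 2 / x^2 := by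
  have := Real.pow_div_factorial_le_exp x hx.le 2
  rw [Real.exp_neg, le_div_iff₀ (by positivity), inv_mul_le_iff₀ (Real.exp_pos _)]
  have h2 : ((Nat.factorial 2 : ℕ) : ℝ) = 2 := by norm_num [Nat.factorial]
  rw [h2] at this
  linarith

set_option maxHeartbeats 1000000 in
open Classical in
lemma LP2 (hi : i ≠ o) (hfm : Measurable f) (hf : ∀ v, |f v| ≤ 1) {r L b A H g P n : ℕ} (hr : 3 ≤ r)
    (hA : A = 8*r^2) (hb : b = 3*r^2) (hH : H + 3*r^2 = r^2*L) (hbH : b ≤ H) (hP : P + 1 = 7*r + 22*r^2)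
    (hn1 : 729 ≤ n) (hn2 : 8*(L+4) ≤ n) (hn3 : 100 * Rd d^3 ≤ n) (hn4 : BdL L ≤ n) (hn5 : 45 * (BdL L)^(P+1) ≤ n)
    (hn6 : 2^(7*r) * (L+2) * (8 * 9^3 * 4640^9) * 2 ≤ n) (hn7 : 3 * (2^H+1) ≤ n) (hn8 : 16 * hC 0 * (8 + 512 * 32^H) ≤ n)
    (X : Finset (Cfg o)) (wt : Cfg o → ℝ) (hwt : ∀ c, 0 ≤ wt c) {τ : ℝ} (hτ : (n:ℝ)^((b:ℤ)+1-H) ≤ τ)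
    (hEW : ∀ c ∈ X, ∑ c' ∈ X.filter (fun c' => nearC o i τ c.1 c'.1), wt c' *
       (Pc d).real {v | |qq o i c.1 v - qq o i c'.1 v| ≤ τ} ≤ (n:ℝ)^((b:ℤ)+3-g-H))
    (hdiff : ∀ c ∈ X, 1/(n:ℝ) ≤ |It o f (1/((n:ℝ)^H * 2^H)) c.1 - It o f (1/(n:ℝ)^H) c.1|) :
    ∑ c ∈ X, wt c ≤ 2 * (n:ℝ)^(2*(A:ℤ)+2*b+10-g+48*r*L+(A+3)*P) := by
  have hn729 : (729:ℝ) ≤ n := by exact_mod_cast hn1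
  have n0 : (0:ℝ) < n := by linarith
  have nne : (n:ℝ) ≠ 0 := n0.ne'
  have n1 : (1:ℝ) ≤ n := by linarith
  set W := ∑ c ∈ X, wt c with hW
  have hW0 : 0 ≤ W := Finset.sum_nonneg fun c _ => hwt c
  have hr2 : 9 ≤ r^2 := by nlinarith
  have hC0 := hC_nonneg 0
  set E : ℤ := 2*(b:ℤ)+8+A-g+48*r*L+(A+3)*P with hE
  set t : ℝ := 1/(n:ℝ)^H with ht
  set t' : ℝ := 1/((n:ℝ)^H * 2^H) with ht'
  have t0 : 0 < t := by positivity
  have t0' : 0 < t' := by positivity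
  have h2H : (1:ℝ) ≤ 2^H := one_le_pow₀ (by norm_num)
  have tz : t = (n:ℝ)^(-(H:ℤ)) := by rw [ht, zpow_neg, zpow_natCast, one_div]
  have t't : t' = t / 2^H := by rw [ht, ht', div_div]
  set w : ℝ := (n:ℝ)^((A:ℤ) - H) with hw
  have w0 : 0 < w := by positivity
  have hwt' : w = (n:ℝ)^(A:ℤ) * t := by rw [tz, ← zpow_add₀ nne, hw]; congr 1
  have LP := LP_est (i := i) (o := o) (f := f) (w := w) (t := t) (t' := t') (lo := (n:ℝ)^((H:ℤ)-b)) (hg := (n:ℝ)^((H:ℤ)+b))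
    (Bm := 2 * (n:ℝ)^(-(A:ℤ)-3) * W + (n:ℝ)^E) hi hfm hf w0 t0 t0' (by rw [t't]; exact div_le_self t0.le h2H) 
    ?_ (by positivity) (by positivity) (by positivity) X wt hwt
    (fun ξ h1 h2 => mid2 hi hfm hf hr hA hb hH hbH hP hn1 hn2 hn3 hn4 hn5 hn6 hw X wt hwt hτ hEW ξ h1 h2)
  swap
  · rw [hwt']
    have : (2:ℝ) ≤ (n:ℝ)^(A:ℤ) := by
      rw [zpow_natCast]
      calc (2:ℝ) ≤ (n:ℝ)^1 := by linarith
        _ ≤ _ := pow_le_pow_right₀ n1 (by omega)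
    gcongr
  have low : W / n ≤ ∑ c ∈ X, wt c * |It o f t' c.1 - It o f t c.1| := by
    rw [hW, Finset.sum_div]
    apply Finset.sum_le_sum
    intro c hc
    rw [div_eq_mul_one_div]
    exact mul_le_mul_of_nonneg_left (hdiff c hc) (hwt c)
  rw [← hW] at LP
  have hpi1 := Real.pi_gt_three
  have hpi2 := Real.pi_lt_d2
  have s2 : √(2 * Real.pi) ≤ 3 := by
    rw [Real.sqrt_le_left (by norm_num)]; linarith
  -- mid part
  have m1 : w * (√(2*Real.pi)/t' + √(2*Real.pi)/t) ≤ (n:ℝ)^((A:ℤ)+1) := by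
    calc _ ≤ w * (3/t' + 3/t) := by gcongr
      _ = (3*(2^H+1)) * (n:ℝ)^(A:ℤ) := by rw [t't, hwt']; field_simp
      _ ≤ n * (n:ℝ)^(A:ℤ) := by gcongr; exact_mod_cast hn7
      _ = _ := by rw [← zpow_one_add₀ nne]; congr 1; ring
  have m2 : w * (2 * (n:ℝ)^((H:ℤ)-b) * (2 * (t/w)^2 + 2 * t^2 * ((n:ℝ)^((H:ℤ)-b))^2)) ≤ 8 * (n:ℝ)^(-2:ℤ) := by
    have a1 : t / w = (n:ℝ)^(-(A:ℤ)) := by rw [hwt', zpow_neg]; field_simp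
    have a2 : t * (n:ℝ)^((H:ℤ)-b) = (n:ℝ)^(-(b:ℤ)) := by rw [tz, ← zpow_add₀ nne]; congr 1; ring
    have a3 : w * (n:ℝ)^((H:ℤ)-b) = (n:ℝ)^((A:ℤ)-b) := by rw [hw, ← zpow_add₀ nne]; congr 1; ring
    have a4 : (n:ℝ)^(-(A:ℤ)) ≤ (n:ℝ)^(-(b:ℤ)) := zpow_le_zpow_right₀ n1 (by rw [hA, hb]; push_cast; nlinarith)
    calc _ = (w * (n:ℝ)^((H:ℤ)-b)) * (4 * (t/w)^2 + 4 * (t * (n:ℝ)^((H:ℤ)-b))^2) := by ring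
      _ ≤ (n:ℝ)^((A:ℤ)-b) * (4 * ((n:ℝ)^(-(b:ℤ)))^2 + 4 * ((n:ℝ)^(-(b:ℤ)))^2) := by
          rw [a1, a2, a3]; gcongr
      _ = 8 * ((n:ℝ)^((A:ℤ)-b) * ((n:ℝ)^(-(b:ℤ)) * (n:ℝ)^(-(b:ℤ)))) := by ring
      _ = 8 * (n:ℝ)^((A:ℤ)-b+(-(b:ℤ)+(-(b:ℤ)))) := by rw [← zpow_add₀ nne, ← zpow_add₀ nne]
      _ ≤ _ := by
          gcongr
          · rw [hA, hb]; push_cast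
            have : (9:ℤ) ≤ (r:ℤ)^2 := by exact_mod_cast hr2
            linarith
  have m3 : w * (4 * Real.exp (-(t' * (n:ℝ)^((H:ℤ)+b))^2/4) * √(Real.pi/(t'^2/4))) ≤ 512 * 32^H * (n:ℝ)^(-2:ℤ) := by
    have a1 : t' * (n:ℝ)^((H:ℤ)+b) = (n:ℝ)^(b:ℤ) / 2^H := by
      rw [t't, tz, div_mul_eq_mul_div, ← zpow_add₀ nne]; congr 2; ring
    have a2 : √(Real.pi/(t'^2/4)) ≤ 4/t' := by
      rw [Real.sqrt_le_left (by positivity), div_div_eq_mul_div, div_pow 4 t' 2]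
      have q4 : Real.pi * 4 ≤ 4^2 := by linarith
      exact div_le_div_of_nonneg_right q4 (by positivity)
    have a3 : Real.exp (-(t' * (n:ℝ)^((H:ℤ)+b))^2/4) ≤ 32 * 16^H * (n:ℝ)^(-4*(b:ℤ)) := by
      rw [neg_div, a1]
      refine (exp_neg_le (by positivity)).trans (le_of_eq ?_)
      have : (n:ℝ)^(-4*(b:ℤ)) = 1/((n:ℝ)^(b:ℤ))^4 := by
        rw [← zpow_natCast ((n:ℝ)^(b:ℤ)), ← zpow_mul, one_div, ← zpow_neg]
        congr 1; push_cast; ring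
      rw [this, show (16:ℝ)^H = ((2:ℝ)^H)^4 by rw [← pow_mul, mul_comm, pow_mul]; norm_num]
      have q1 : (n:ℝ)^(b:ℤ) ≠ 0 := by positivity
      field_simp
      norm_num
    calc _ ≤ w * (4 * (32 * 16^H * (n:ℝ)^(-4*(b:ℤ))) * (4/t')) := by gcongr
      _ = 512 * 32^H * ((n:ℝ)^(A:ℤ) * (n:ℝ)^(-4*(b:ℤ))) := by
          rw [t't, hwt', show (32:ℝ)^H = 16^H * 2^H by rw [← mul_pow]; norm_num]
          field_simp; norm_num
      _ = 512 * 32^H * (n:ℝ)^((A:ℤ)+(-4*(b:ℤ))) := by rw [← zpow_add₀ nne]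
      _ ≤ _ := by
          gcongr
          · rw [hA, hb]; push_cast
            have : (9:ℤ) ≤ (r:ℤ)^2 := by exact_mod_cast hr2
            linarith
  have z2 : (n:ℝ)^(-2:ℤ) = 1/(n*n) := by rw [zpow_neg, one_div]; congr 1; rw [← sq]; rfl
  have tot : W / n ≤ (n:ℝ)^((A:ℤ)+1) * (2 * (n:ℝ)^(-(A:ℤ)-3) * W + (n:ℝ)^E) + 
      4 * hC 0 * W * (8 * (n:ℝ)^(-2:ℤ) + 512 * 32^H * (n:ℝ)^(-2:ℤ)) := by
    refine low.trans (LP.trans ?_)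
    set Bm := 2 * (n:ℝ)^(-(A:ℤ)-3) * W + (n:ℝ)^E with hBm
    have hBm0 : 0 ≤ Bm := by positivity
    have k1 := mul_le_mul_of_nonneg_right m1 hBm0
    have k2 := mul_le_mul_of_nonneg_left (add_le_add m2 m3) (show 0 ≤ 4 * hC 0 * W by positivity)
    linarith
  have c1 : (n:ℝ)^((A:ℤ)+1) * (2 * (n:ℝ)^(-(A:ℤ)-3) * W + (n:ℝ)^E) = 2 * W * (n:ℝ)^(-2:ℤ) + (n:ℝ)^((A:ℤ)+1+E) := by
    rw [zpow_add₀ nne ((A:ℤ)+1) E, show (-2:ℤ) = ((A:ℤ)+1) + (-(A:ℤ)-3) by ring, zpow_add₀ nne ((A:ℤ)+1) (-(A:ℤ)-3)]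
    ring
  rw [c1, z2] at tot
  have c2 : (n:ℝ)^(2*(A:ℤ)+2*b+10-g+48*r*L+(A+3)*P) = n * (n:ℝ)^((A:ℤ)+1+E) := by
    rw [← zpow_one_add₀ nne]; congr 1; rw [hE]; ring
  rw [c2]
  have c3 : 2 * W * (1/((n:ℝ)*n)) ≤ W/(4*n) := by
    rw [show 2 * W * (1/((n:ℝ)*n)) = W * (2/(n*n)) by ring, show W/(4*n) = W * (1/(4*n)) by ring]
    refine mul_le_mul_of_nonneg_left ?_ hW0
    rw [div_le_div_iff₀ (by positivity) (by positivity)]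
    have q5 := mul_le_mul_of_nonneg_right hn729 n0.le
    linarith
  have c4 : 4 * hC 0 * W * (8 * (1/((n:ℝ)*n)) + 512 * 32^H * (1/((n:ℝ)*n))) ≤ W/(4*n) := by
    rw [show 4 * hC 0 * W * (8 * (1/((n:ℝ)*n)) + 512 * 32^H * (1/((n:ℝ)*n))) = W * ((16 * hC 0 * (8 + 512 * 32^H)) / (4*(n*n))) by field_simp; ring,
      show W/(4*n) = W * (1/(4*n)) by ring]
    refine mul_le_mul_of_nonneg_left ?_ hW0
    rw [div_le_div_iff₀ (by positivity) (by positivity)]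
    have q5 := mul_le_mul_of_nonneg_right hn8 (show (0:ℝ) ≤ 4 * n by positivity)
    linarith
  have c5 : W / n - W/(4*n) - W/(4*n) ≤ (n:ℝ)^((A:ℤ)+1+E) := by linarith
  have c6 : W / n - W/(4*n) - W/(4*n) = W/(2*n) := by field_simp; ring
  rw [c6, div_le_iff₀ (by positivity)] at c5
  linarith

end MW

namespace MW
open MeasureTheory Metric Set
variable {d : ℕ} {o i : Fin d} {f : (Fin d → ℝ) → ℝ}

set_option maxHeartbeats 1000000 in
open Classical in
lemma G3a (hd : ∃ i, i ≠ o) (hfm : Measurable f) (hf : ∀ v, |f v| ≤ 1) {N0 r L b A H g P n k : ℕ} (hN0 : 1 ≤ N0) (hr : 3 ≤ r)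
    (hA : A = 8*r^2) (hb : b = 3*r^2) (hH : H + 3*r^2 = r^2*L) (hP : P + 1 = 7*r + 22*r^2)
    (hg : 2*A+2*b+12+48*r*L+(A+3)*P ≤ g) (hH2 : 2*(N0*g)*d+b+3 ≤ H) (hnk : n = 2^k)
    (hn1 : 729 ≤ n) (hn2 : 8*(L+4) ≤ n) (hn3 : 100 * Rd d^3 ≤ n) (hn4 : BdL L ≤ n) (hn5 : 45 * (BdL L)^(P+1) ≤ n)
    (hn6 : 2^(7*r) * (L+2) * (8 * 9^3 * 4640^9) * 2 ≤ n) (hn7 : 3 * (2^H+1) ≤ n) (hn8 : 16 * hC 0 * (8 + 512 * 32^H) ≤ n)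
    (hn9 : (H+1)*(2*3^d) ≤ n) (hn10 : (d+1)*2 ≤ n) (hn11 : (d+1)*9^d ≤ n)
    {e : ℝ} (he0 : 0 < e) (heN : e^N0 = 1/2)
    (X : Finset (Cfg o)) (w : Cfg o → ℝ) (hw : ∀ c, 0 ≤ w c) 
    (hX : ∀ j ≤ k*H, ∀ z, ∑ y ∈ X.filter (fun y => cellc j y.1.1 = z), w y ≤ (e/2)^j)
    (hdiff : ∀ c ∈ X, 1/(n:ℝ) ≤ |It o f (1/((n:ℝ)^H * 2^H)) c.1 - It o f (1/(n:ℝ)^H) c.1|) :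
    ∑ c ∈ X, w c ≤ 1/(n:ℝ) := by
  have hn729 : (729:ℝ) ≤ n := by exact_mod_cast hn1
  have n0 : (0:ℝ) < n := by linarith
  have nne : (n:ℝ) ≠ 0 := n0.ne'
  have n1 : (1:ℝ) ≤ n := by linarith
  have he1 : e ≤ 1 := by
    by_contra h
    push Not at h
    have := one_lt_pow₀ h (show N0 ≠ 0 by omega)
    rw [heN] at this; norm_num at this
  have hnR : (n:ℝ) = 2^k := by rw [hnk]; push_cast; rfl
  set T := k*(H-b-1) with hT
  have h2T : (2:ℝ)^T = (n:ℝ)^(H-b-1) := by rw [hT, pow_mul, hnR]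
  have hTz : 1/(2:ℝ)^T = (n:ℝ)^((b:ℤ)+1-H) := by
    rw [h2T, one_div, ← zpow_natCast, ← zpow_neg]; congr 1; omega
  have hTJ : T ≤ k*H := Nat.mul_le_mul_left _ (by omega)
  set ν : ℝ := (n:ℝ)^(-(2*((N0*g:ℕ):ℤ))) with hν
  have hν0 : 0 < ν := by positivity
  have hν1 : ν ≤ 1 := zpow_le_one_of_nonpos₀ n1 (by omega)
  have hW1 : ∑ c ∈ X, w c ≤ 1 := by
    rcases X.eq_empty_or_nonempty with h | ⟨c0, hc0⟩
    · rw [h]; simp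
    · have := hX 0 (Nat.zero_le _) (cellc 0 c0.1.1)
      rw [pow_zero, Finset.filter_true_of_mem (fun c _ => cell_zero c c0)] at this
      exact this
  have hle : (n:ℝ)^(-1:ℤ) = 1/(n:ℝ) := by rw [zpow_neg_one, one_div]
  rcases pigeon (T := T) hd hν0 hν1 (b := (e/2)^T) (by positivity) X w hw (hX T hTJ) hW1 with ⟨i, hi, hpi⟩ | hbad
  · set X' := X.filter (fun c : Cfg o => ∑ c' ∈ X.filter (fun c' => nearC o i (1/2^T) c.1 c'.1), w c' ≤ ν) with hX'
    have hsub : X' ⊆ X := Finset.filter_subset _ _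
    have hEW : ∀ c ∈ X', ∑ c' ∈ X'.filter (fun c' => nearC o i (1/2^T) c.1 c'.1), w c' *
       (Pc d).real {v | |qq o i c.1 v - qq o i c'.1 v| ≤ 1/2^T} ≤ (n:ℝ)^((b:ℤ)+3-g-H) := by
      intro c hc
      refine (mult_est (J := k*H) (K := k*(N0*g)) (e := e) (ν := ν) (γ := (n:ℝ)^(-(g:ℤ))) he0 he1 X' w hw ?_ hTJ ?_ ?_ c ?_).trans ?_
      · intro j hj z
        refine le_trans ?_ (hX j hj z)
        exact Finset.sum_le_sum_of_subset_of_nonneg (Finset.filter_subset_filter _ hsub) (fun y _ _ => hw y)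
      · rw [show k*(N0*g) = N0*(k*g) by ring, pow_mul, heN, one_div, inv_pow, pow_mul, ← hnR, zpow_neg, zpow_natCast]
      · rw [pow_mul, ← hnR, hν, ← zpow_natCast, ← zpow_add₀ nne]
        apply zpow_le_zpow_right₀ n1
        have : g ≤ N0 * g := Nat.le_mul_of_pos_left g hN0
        omega
      · refine le_trans ?_ (Finset.mem_filter.1 hc).2
        exact Finset.sum_le_sum_of_subset_of_nonneg (Finset.filter_subset_filter _ hsub) (fun y _ _ => hw y)
      · have a1 : (T:ℝ) + 1 ≤ n * (H+1) := by
          have : T + 1 ≤ n * (H + 1) := by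
            have hk : k < n := by rw [hnk]; exact Nat.lt_two_pow_self
            calc T + 1 ≤ k * H + n := by omega
              _ ≤ n * H + n := by gcongr
              _ = _ := by ring
          exact_mod_cast this
        have a2 : ((H:ℝ)+1)*(2*3^d) ≤ n := by exact_mod_cast hn9
        calc _ = ((T:ℝ)+1) * (2*3^d*((n:ℝ)^(-(g:ℤ)) * (1/2^T))) := by ring
          _ ≤ (n*(H+1)) * (2*3^d*((n:ℝ)^(-(g:ℤ)) * (1/2^T))) := by gcongr
          _ = n * (((H:ℝ)+1)*(2*3^d)) * ((n:ℝ)^(-(g:ℤ)) * (1/2^T)) := by ring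
          _ ≤ n * n * ((n:ℝ)^(-(g:ℤ)) * (1/2^T)) := by gcongr
          _ = (n:ℝ)^(1:ℤ) * (n:ℝ)^(1:ℤ) * ((n:ℝ)^(-(g:ℤ)) * (n:ℝ)^((b:ℤ)+1-H)) := by rw [hTz, zpow_one]
          _ = _ := by
            rw [← zpow_add₀ nne, ← zpow_add₀ nne, ← zpow_add₀ nne]; congr 1; ring
    have hfin := LP2 (i := i) (o := o) (g := g) hi hfm hf hr hA hb hH (by omega) hP hn1 hn2 hn3 hn4 hn5 hn6 hn7 hn8 X' w hw
      (τ := 1/2^T) (le_of_eq hTz.symm) hEW (fun c hc => hdiff c (hsub hc))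
    have a3 : (n:ℝ)^(2*(A:ℤ)+2*b+10-g+48*r*L+(A+3)*P) ≤ (n:ℝ)^(-2:ℤ) := by
      apply zpow_le_zpow_right₀ n1
      have : 2*(A:ℤ)+2*b+12+48*r*L+(A+3)*P ≤ g := by exact_mod_cast hg
      linarith
    have a4 : ((d:ℝ)+1)*2 ≤ n := by exact_mod_cast hn10
    calc _ ≤ ((d:ℝ)+1) * ∑ c ∈ X', w c := hpi
      _ ≤ ((d:ℝ)+1) * (2 * (n:ℝ)^(-2:ℤ)) := by gcongr; linarith
      _ = (((d:ℝ)+1)*2) * (n:ℝ)^(-2:ℤ) := by ring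
      _ ≤ n * (n:ℝ)^(-2:ℤ) := by gcongr
      _ = _ := by rw [← zpow_one_add₀ nne, ← hle]; norm_num
  · refine hbad.trans ?_
    have a1 : (e/2)^T ≤ (n:ℝ)^((b:ℤ)+1-H) := by
      rw [← hTz, div_pow]
      gcongr
      exact pow_le_one₀ he0.le he1
    have a2 : (9/ν)^d = 9^d * (n:ℝ)^(2*((N0*g:ℕ):ℤ)*d) := by
      rw [hν, zpow_neg, div_inv_eq_mul, mul_pow, ← zpow_natCast ((n:ℝ)^_), ← zpow_mul]
    have a4 : ((d:ℝ)+1)*9^d ≤ n := by exact_mod_cast hn11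
    calc _ ≤ ((d:ℝ)+1) * (9^d * (n:ℝ)^(2*((N0*g:ℕ):ℤ)*d) * (n:ℝ)^((b:ℤ)+1-H)) := by rw [a2]; gcongr
      _ = (((d:ℝ)+1) * 9^d) * ((n:ℝ)^(2*((N0*g:ℕ):ℤ)*d) * (n:ℝ)^((b:ℤ)+1-H)) := by ring
      _ ≤ n * ((n:ℝ)^(2*((N0*g:ℕ):ℤ)*d) * (n:ℝ)^((b:ℤ)+1-H)) := by gcongr
      _ = (n:ℝ)^(1+(2*((N0*g:ℕ):ℤ)*d + ((b:ℤ)+1-H))) := by rw [← zpow_add₀ nne, ← zpow_one_add₀ nne]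
      _ ≤ (n:ℝ)^(-1:ℤ) := by
          apply zpow_le_zpow_right₀ n1
          have : 2*((N0*g:ℕ):ℤ)*d+b+3 ≤ H := by exact_mod_cast hH2
          linarith
      _ = _ := hle

open Classical in
theorem G3 (o : Fin d) (hd : ∃ i, i ≠ o) (N0 : ℕ) (hN0 : 1 ≤ N0) : ∃ H : ℕ, 1 ≤ H ∧ ∃ k1 : ℕ, ∀ k ≥ k1, ∀ f : (Fin d → ℝ) → ℝ,
    Measurable f → (∀ v, |f v| ≤ 1) → ∀ e : ℝ, 0 < e → e^N0 = 1/2 → ∀ (X : Finset (Cfg o)) (w : Cfg o → ℝ), (∀ c, 0 ≤ w c) →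
    (∀ j ≤ k*H, ∀ z, ∑ y ∈ X.filter (fun y => cellc j y.1.1 = z), w y ≤ (e/2)^j) →
    (∀ c ∈ X, 1/(2:ℝ)^k ≤ |It o f (1/2^((k+1)*H)) c.1 - It o f (1/2^(k*H)) c.1|) → 
    ∑ c ∈ X, w c ≤ 1/2^k := by
  have hd1 : 1 ≤ d := by have := o.2; omega
  obtain ⟨r, hr⟩ : ∃ r, r = 400*d*N0 := ⟨_, rfl⟩
  have hdN : 1 ≤ d * N0 := Nat.mul_pos hd1 hN0
  have hr400 : 400 ≤ r := by rw [hr, mul_assoc]; omega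
  obtain ⟨A, hA⟩ : ∃ A, A = 8*r^2 := ⟨_, rfl⟩
  obtain ⟨b, hb⟩ : ∃ A, A = 3*r^2 := ⟨_, rfl⟩
  obtain ⟨P, hP⟩ : ∃ P, P + 1 = 7*r+22*r^2 := ⟨7*r+22*r^2-1, by omega⟩
  obtain ⟨l, hl⟩ : ∃ l, l = 2*A+2*b+300+(A+3)*P := ⟨_, rfl⟩
  obtain ⟨H, hHl⟩ : ∃ H, H = r^2*l := ⟨_, rfl⟩
  obtain ⟨g, hgl⟩ : ∃ H, H = 100*r*l := ⟨_, rfl⟩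
  have hg : 2*A+2*b+12+48*r*(l+3)+(A+3)*P ≤ g := by
    have h1 : 2*A+2*b+12+(A+3)*P ≤ l := by omega
    have h2 : l ≤ r * l := Nat.le_mul_of_pos_left l (by omega)
    have h3 : 300 * r ≤ l * r := Nat.mul_le_mul_right r (by omega)
    rw [hgl]; nlinarith
  have hH2 : 2*(N0*g)*d+b+3 ≤ H := by
    have h1 : H = 4 * (d * N0) * g := by rw [hHl, hgl, sq]; nth_rewrite 1 [hr]; ring
    have h2 : b + 3 ≤ g := by omega
    have h3 : g ≤ d * N0 * g := Nat.le_mul_of_pos_left g hdN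
    rw [h1]; nlinarith
  have hev : ∀ C : ℝ, ∃ k0 : ℕ, ∀ k ≥ k0, C ≤ ((2^k : ℕ) : ℝ) := by
    intro C
    obtain ⟨k0, hk0⟩ := pow_unbounded_of_one_lt C (show (1:ℝ) < 2 by norm_num)
    refine ⟨k0, fun k hk => hk0.le.trans ?_⟩
    push_cast
    exact pow_le_pow_right₀ (by norm_num) hk
  obtain ⟨k1, h1⟩ := hev 729
  obtain ⟨k2, h2⟩ := hev ((8*(l+3+4) : ℕ))
  obtain ⟨k3, h3⟩ := hev (100 * Rd d^3)
  obtain ⟨k4, h4⟩ := hev (BdL (l+3))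
  obtain ⟨k5, h5⟩ := hev (45 * (BdL (l+3))^(P+1))
  obtain ⟨k6, h6⟩ := hev ((2^(7*r) * (l+3+2) * (8 * 9^3 * 4640^9) * 2 : ℕ))
  obtain ⟨k7, h7⟩ := hev ((3 * (2^H+1) : ℕ))
  obtain ⟨k8, h8⟩ := hev (16 * hC 0 * (8 + 512 * 32^H))
  obtain ⟨k9, h9⟩ := hev (((H+1)*(2*3^d) : ℕ))
  obtain ⟨k10, h10⟩ := hev (((d+1)*2 : ℕ))
  obtain ⟨k11, h11⟩ := hev (((d+1)*9^d : ℕ))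
  refine ⟨H, by omega, k1+k2+k3+k4+k5+k6+k7+k8+k9+k10+k11, ?_⟩
  intro k hk f hfm hf e he heN X w hw hX hdiff
  have := G3a (n := 2^k) (k := k) (L := l+3) (H := H) hd hfm hf hN0 (show 3 ≤ r by omega) hA hb (by rw [hHl]; ring) hP hg hH2 rfl
    (by exact_mod_cast h1 k (by omega)) (by exact_mod_cast h2 k (by omega)) (h3 k (by omega)) (h4 k (by omega)) (h5 k (by omega))
    (Nat.cast_le.1 (h6 k (by omega))) (by exact_mod_cast h7 k (by omega)) (h8 k (by omega)) (by exact_mod_cast h9 k (by omega))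
    (by exact_mod_cast h10 k (by omega)) (by exact_mod_cast h11 k (by omega)) he heN X w hw hX ?_
  · rw [Nat.cast_pow, Nat.cast_ofNat] at this; exact this
  · intro c hc
    have h := hdiff c hc
    rw [Nat.cast_pow, Nat.cast_ofNat, ← pow_mul, ← pow_add, show k * H + H = (k+1)*H by ring]
    exact h

end MW

namespace MW
open MeasureTheory Metric Set
variable {d : ℕ} {o i : Fin d}

lemma Kt_cont (t : ℝ) : Continuous (Kt t) := by unfold Kt; fun_prop

lemma Kt_nonneg {t : ℝ} (ht : 0 < t) (s : ℝ) : 0 ≤ Kt t s := by unfold Kt; positivity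

lemma Kt_le {t : ℝ} (ht : 0 < t) (s : ℝ) : Kt t s ≤ 1 / t := by
  unfold Kt
  gcongr
  rw [Real.exp_le_one_iff]
  have : 0 ≤ s^2/(2*t^2) := by positivity
  rw [neg_div]; linarith

lemma Kt_ge {t s : ℝ} (ht : 0 < t) (hs : |s| ≤ t) : 1 / (2 * t) ≤ Kt t s := by
  unfold Kt
  have h1 : s^2 ≤ t^2 := by rw [← sq_abs]; gcongr
  have h2 : -s^2/(2*t^2) ≥ -(1/2) := by
    rw [neg_div]
    have : s^2/(2*t^2) ≤ 1/2 := by rw [div_le_iff₀ (by positivity)]; linarith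
    linarith
  have h3 : (1:ℝ)/2 ≤ Real.exp (-s^2/(2*t^2)) := by
    have := Real.add_one_le_exp (-s^2/(2*t^2))
    linarith
  rw [show 1/(2*t) = (1/2)/t by field_simp]
  gcongr

lemma ItU_integrable {U : Set (Fin d → ℝ)} (hU : MeasurableSet U) {t : ℝ} (ht : 0 < t) (c : (Fin d → ℝ) × ℝ) :
    Integrable (fun v => U.indicator (fun _ => (1:ℝ)) v * Kt t (Gam o c v - v o)) (Pc d) := by
  apply Integrable.of_bound (C := 1/t)
  · apply Measurable.aestronglyMeasurable
    apply (measurable_const.indicator hU).mul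
    apply (Kt_cont t).measurable.comp
    exact ((Gam_meas o c).measurable.sub (measurable_pi_apply o))
  · filter_upwards with v
    rw [Real.norm_eq_abs, abs_mul, abs_of_nonneg (Kt_nonneg ht _)]
    have h1 : |U.indicator (fun _ => (1:ℝ)) v| ≤ 1 := by
      by_cases h : v ∈ U <;> simp [h]
    calc _ ≤ 1 * (1/t) := mul_le_mul h1 (Kt_le ht _) (Kt_nonneg ht _) zero_le_one
      _ = _ := one_mul _

lemma It_le {U : Set (Fin d → ℝ)} (hU : MeasurableSet U) (hfin : volume U ≠ ⊤) {t : ℝ} (ht : 0 < t) (c : (Fin d → ℝ) × ℝ) :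
    It o (U.indicator fun _ => 1) t c ≤ (volume U).toReal / t := by
  unfold It
  calc _ ≤ ∫ v, U.indicator (fun _ => (1:ℝ)) v * (1/t) ∂(Pc d) := by
        apply integral_mono (ItU_integrable hU ht c)
        · exact ((integrable_const (1:ℝ)).indicator hU).mul_const _
        · intro v
          apply mul_le_mul_of_nonneg_left (Kt_le ht _)
          exact indicator_nonneg (fun _ _ => zero_le_one) v
    _ = (Pc d U).toReal * (1/t) := by
        rw [integral_mul_const, integral_indicator_const _ hU]
        simp [Measure.real]
    _ ≤ _ := by
        rw [mul_one_div]
        exact div_le_div_of_nonneg_right (ENNReal.toReal_mono hfin (Pc_le d U)) ht.le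

lemma It_ge {U : Set (Fin d → ℝ)} (hU : IsOpen U) (c : (Fin d → ℝ) × ℝ) (hc : IsCfg o c)
    (hs : {p : Fin d → ℝ | ∑ a, (p a - c.1 a)^2 = c.2^2} ⊆ U) :
    ∃ t0 > (0:ℝ), ∀ t, 0 < t → t ≤ t0 → 1 ≤ It o (U.indicator fun _ => 1) t c := by
  set g : (Fin d → ℝ) → (Fin d → ℝ) := fun v => Function.update v o (Gam o c v) with hg
  have hgc : Continuous g := continuous_id.update o (Gam_meas o c)
  have hK : IsCompact (g '' (Icc (0 : Fin d → ℝ) 1)) := isCompact_Icc.image hgc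
  have hsub : g '' (Icc (0 : Fin d → ℝ) 1) ⊆ U := by
    rintro _ ⟨v, hv, rfl⟩
    apply hs
    have hv' : ∀ a, v a ∈ Icc (0:ℝ) 1 := fun a => ⟨hv.1 a, hv.2 a⟩
    have h1 := hc.sum_le hv' _ (Finset.Subset.refl _)
    have h2 := abs_le.1 hc.h3
    have h3 := Rd_ge d
    have h4 := Rd_ge' d
    have h5 : (d:ℝ) ≤ c.2^2 := by nlinarith
    rw [mem_ofPred_eq, ← Finset.add_sum_erase _ _ (Finset.mem_univ o)]
    have : ∑ a ∈ Finset.univ.erase o, (g v a - c.1 a)^2 = ∑ a ∈ Finset.univ.erase o, (c.1 a - v a)^2 := by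
      apply Finset.sum_congr rfl
      intro a ha
      rw [hg]
      simp only
      rw [Function.update_of_ne (Finset.ne_of_mem_erase ha)]
      ring
    rw [this]
    simp only [hg, Function.update_self]
    unfold Gam
    rw [add_sub_cancel_left, Real.sq_sqrt (by linarith)]
    ring
  obtain ⟨δ, hδ, hth⟩ := hK.exists_thickening_subset_open hU hsub
  refine ⟨min (δ/2) (1/4), by positivity, fun t ht htt => ?_⟩
  have ht1 : t < δ := by have := htt.trans (min_le_left _ _); linarith
  have ht2 : t ≤ 1/4 := htt.trans (min_le_right _ _)
  obtain ⟨h1, h2⟩ := slice1 o (ItU_integrable (o := o) hU.measurableSet ht c)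
  unfold It
  rw [h2]
  have key : ∀ᵐ v ∂(Pc d), (1:ℝ) ≤ ∫ s in (0:ℝ)..1, U.indicator (fun _ => (1:ℝ)) (Function.update v o s) *
      Kt t (Gam o c (Function.update v o s) - Function.update v o s o) := by
    filter_upwards [Pc_ae d] with v hv
    have hG := hc.Gam_mem hv
    simp only [Gam_upd_o, Function.update_self]
    set G := Gam o c v with hGd
    have hmeas : Measurable (fun s : ℝ => U.indicator (fun _ => (1:ℝ)) (Function.update v o s) * Kt t (G - s)) := by
      apply Measurable.mul
      · exact (measurable_const.indicator hU.measurableSet).comp (measurable_update v)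
      · exact (Kt_cont t).measurable.comp (measurable_const.sub measurable_id)
    have hnn : ∀ s, 0 ≤ U.indicator (fun _ => (1:ℝ)) (Function.update v o s) * Kt t (G - s) := fun s =>
      mul_nonneg (indicator_nonneg (fun _ _ => zero_le_one) _) (Kt_nonneg ht _)
    have h_int : IntegrableOn (fun s : ℝ => U.indicator (fun _ => (1:ℝ)) (Function.update v o s) * Kt t (G - s)) (Ioc 0 1) := by
      apply Measure.integrableOn_of_bounded (M := 1/t) (by simp) hmeas.aestronglyMeasurable
      filter_upwards with s
      rw [Real.norm_eq_abs, abs_of_nonneg (hnn s)]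
      have h1 : U.indicator (fun _ => (1:ℝ)) (Function.update v o s) ≤ 1 := by
        by_cases h : Function.update v o s ∈ U <;> simp [h]
      calc _ ≤ 1 * (1/t) := mul_le_mul h1 (Kt_le ht _) (Kt_nonneg ht _) zero_le_one
        _ = _ := one_mul _
    rw [intervalIntegral.integral_of_le zero_le_one]
    have hss : Ioc (G - t) (G + t) ⊆ Ioc 0 1 := by
      intro s hs
      exact ⟨by linarith [hs.1, hG.1], by linarith [hs.2, hG.2]⟩
    calc (1:ℝ) = ∫ s in Ioc (G - t) (G + t), 1/(2*t) := by
          rw [setIntegral_const]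
          simp only [Measure.real, Real.volume_Ioc]
          rw [ENNReal.toReal_ofReal (by linarith), smul_eq_mul]
          field_simp
          ring
      _ ≤ ∫ s in Ioc (G - t) (G + t), U.indicator (fun _ => (1:ℝ)) (Function.update v o s) * Kt t (G - s) := by
          apply setIntegral_mono_on (integrableOn_const (by simp) enorm_ne_top) (h_int.mono_set hss) measurableSet_Ioc
          intro s hs
          have hU' : Function.update v o s ∈ U := by
            apply hth
            rw [mem_thickening_iff]
            refine ⟨g v, ⟨v, ⟨fun a => (hv a).1, fun a => (hv a).2⟩, rfl⟩, ?_⟩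
            refine lt_of_le_of_lt ((dist_pi_le_iff ht.le).2 fun a => ?_) ht1
            by_cases ha : a = o
            · subst ha
              simp only [hg, Function.update_self]
              rw [Real.dist_eq, abs_le]
              exact ⟨by linarith [hs.1], by linarith [hs.2]⟩
            · simp only [hg]
              rw [Function.update_of_ne ha, Function.update_of_ne ha, dist_self]
              exact ht.le
          rw [indicator_of_mem hU', one_mul]
          apply Kt_ge ht
          rw [abs_le]
          exact ⟨by linarith [hs.2], by linarith [hs.1]⟩
      _ ≤ _ := by
          apply setIntegral_mono_set h_int
          · filter_upwards with s using hnn s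
          · exact hss.eventuallyLE
  calc (1:ℝ) = ∫ v, (1:ℝ) ∂(Pc d) := by simp
    _ ≤ _ := integral_mono_ae (integrable_const _) h1 key

end MW

namespace MW
open MeasureTheory Metric Set
variable {d : ℕ} {o i : Fin d}

lemma cover (o : Fin d) (hd : ∃ i, i ≠ o) (N0 : ℕ) (hN0 : 1 ≤ N0) : ∃ H, 1 ≤ H ∧ ∃ k1, ∀ k ≥ k1,
    ∀ f : (Fin d → ℝ) → ℝ, Measurable f → (∀ v, |f v| ≤ 1) → ∀ e : ℝ, 0 < e → e^N0 = 1/2 →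
    ∃ C : Finset (ℕ × (Fin d → ℤ)), ∑ p ∈ C, (e/2)^p.1 ≤ 1/2^k ∧
    ∀ c : (Fin d → ℝ) × ℝ, IsCfg o c → 1/(2:ℝ)^k ≤ |It o f (1/2^((k+1)*H)) c - It o f (1/2^(k*H)) c| →
      ∃ p ∈ C, cellc p.1 c.1 = p.2 := by
  classical
  obtain ⟨H, hH, k1, hk⟩ := G3 o hd N0 hN0
  refine ⟨H, hH, k1, fun k hkk f hfm hf e he heN => ?_⟩
  set Sk : Set (Cfg o) := {c | 1/(2:ℝ)^k ≤ |It o f (1/2^((k+1)*H)) c.1 - It o f (1/2^(k*H)) c.1|} with hSk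
  set cl : ℕ → Cfg o → (Fin d → ℤ) := fun j c => cellc j c.1.1 with hcl
  have hfin : (cl (k*H) '' Sk).Finite := by
    apply (Set.finite_Icc (fun _ : Fin d => ⌊(2:ℝ)^(k*H) * (-(Rd d + 1))⌋) (fun _ => ⌊(2:ℝ)^(k*H) * (Rd d + 1)⌋)).subset
    rintro _ ⟨c, -, rfl⟩
    have hR := Rd_ge d
    have hb : ∀ a, |c.1.1 a| ≤ Rd d + 1 := by
      intro a
      rw [abs_le]
      by_cases ha : a = o
      · subst ha
        have := abs_le.1 c.2.h2
        constructor <;> linarith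
      · have := abs_le.1 (c.2.h1 a ha)
        constructor <;> linarith
    constructor <;> intro a
    · apply Int.floor_le_floor
      have := (abs_le.1 (hb a)).1
      gcongr
    · apply Int.floor_le_floor
      have := (abs_le.1 (hb a)).2
      gcongr
  obtain ⟨X', hX'S, hbij⟩ := Set.exists_subset_bijOn Sk (cl (k*H))
  have hXf : X'.Finite := hbij.finite_iff_finite.2 hfin
  set X := hXf.toFinset with hX
  obtain ⟨w, hw0, hw1, kp, hkp, hsum⟩ := frostman cl (fun j j' x y h e => cellc_nest j j' _ _ h e) (fun j => (e/2)^j)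
    (fun j => by positivity) (k*H) X
  refine ⟨X.image (fun x => (kp x, cl (kp x) x)), ?_, ?_⟩
  · refine le_trans (le_of_eq_of_le ?_ hsum) (hk k hkk f hfm hf e he heN X w hw0 ?_ ?_)
    · apply Finset.sum_congr _ (fun _ _ => rfl)
      congr!
    · intro j hj z
      refine le_of_eq_of_le ?_ (hw1 j hj z)
      apply Finset.sum_congr _ (fun _ _ => rfl)
      congr!
    · intro c hc
      exact hX'S (hXf.mem_toFinset.1 hc)
  · intro c hc hcd
    obtain ⟨c', hc'⟩ : ∃ c' : Cfg o, c'.1 = c := ⟨⟨c, hc⟩, rfl⟩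
    have hmem : c' ∈ Sk := by rw [hSk, mem_ofPred_eq, hc']; exact hcd
    have := mem_image_of_mem (cl (k*H)) hmem
    obtain ⟨y, hy, hye⟩ := hbij.surjOn this
    have hyX : y ∈ X := hXf.mem_toFinset.2 hy
    refine ⟨_, Finset.mem_image_of_mem _ hyX, ?_⟩
    rw [← hc']
    exact (cellc_nest _ _ _ _ (hkp y hyX) hye).symm

/-- A null set contains no positive measure of normalized spheres. -/
lemma cover2 (o : Fin d) (hd : ∃ i, i ≠ o) (N0 : ℕ) (hN0 : 1 ≤ N0) (B : Set (Fin d → ℝ)) (hB : volume B = 0)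
    (e : ℝ) (he : 0 < e) (heN : e^N0 = 1/2) : ∃ k1, ∀ k0 ≥ k1, ∃ C : ℕ → Finset (ℕ × (Fin d → ℤ)),
      (∀ m, ∑ p ∈ C m, (e/2)^p.1 ≤ 1/2^(k0+m)) ∧
      ∀ x, (∃ r, IsCfg o (x, r) ∧ {p : Fin d → ℝ | ∑ a, (p a - x a)^2 = r^2} ⊆ B) →
        ∃ m, ∃ p ∈ C m, cellc p.1 x = p.2 := by
  obtain ⟨H, hH, k1, hk⟩ := cover o hd N0 hN0
  refine ⟨max k1 2, fun k0 hk0 => ?_⟩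
  have hk01 : k1 ≤ k0 := (le_max_left _ _).trans hk0
  have hk02 : 2 ≤ k0 := (le_max_right _ _).trans hk0
  obtain ⟨U, hBU, hUo, hUv⟩ := B.exists_isOpen_lt_of_lt (μ := volume) (ENNReal.ofReal ((1/4) * (1/2^(k0*H)))) (by rw [hB]; simp)
  have hfin : volume U ≠ ⊤ := ne_top_of_lt hUv
  have hUr : (volume U).toReal ≤ (1/4) * (1/2^(k0*H)) := ENNReal.toReal_le_of_le_ofReal (by positivity) hUv.le
  set f : (Fin d → ℝ) → ℝ := U.indicator fun _ => 1 with hf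
  have hfm : Measurable f := measurable_const.indicator hUo.measurableSet
  have hfb : ∀ v, |f v| ≤ 1 := by intro v; by_cases h : v ∈ U <;> simp [hf, h]
  choose C hC1 hC2 using fun m => hk (k0 + m) (by omega) f hfm hfb e he heN
  refine ⟨C, hC1, ?_⟩
  rintro x ⟨r, hc, hsp⟩
  by_contra hcon
  have hsm : ∀ m, |It o f (1/2^((k0+m+1)*H)) (x, r) - It o f (1/2^((k0+m)*H)) (x, r)| < 1/(2:ℝ)^(k0+m) := by
    intro m
    by_contra h
    exact hcon ⟨m, hC2 m _ hc (not_lt.1 h)⟩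
  obtain ⟨t0, ht0, hge⟩ := It_ge hUo (x, r) hc (hsp.trans hBU)
  have h0 : It o f (1/2^(k0*H)) (x, r) ≤ 1/4 := by
    refine (It_le hUo.measurableSet hfin (by positivity) _).trans ?_
    rw [div_le_iff₀ (by positivity)]
    exact hUr
  have htel : ∀ m, It o f (1/2^((k0+m)*H)) (x, r) ≤ 1/4 + (1/2^k0) * (2 - 2/2^m) := by
    intro m
    induction m with
    | zero => simpa using h0
    | succ m ih =>
      have h1 := (abs_lt.1 (hsm m)).2
      have : 1/4 + (1/2^k0) * (2 - 2/2^(m+1)) = 1/4 + (1/2^k0) * (2 - 2/2^m) + 1/(2:ℝ)^(k0+m) := by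
        rw [pow_succ, pow_add]; field_simp; ring
      rw [this, ← add_assoc k0 m 1]
      linarith
  obtain ⟨m, hm⟩ := exists_pow_lt_of_lt_one ht0 (show (1/2:ℝ) < 1 by norm_num)
  have hle : 1/(2:ℝ)^((k0+m)*H) ≤ t0 := by
    refine le_trans ?_ hm.le
    rw [one_div_pow]
    apply one_div_le_one_div_of_le (by positivity)
    apply pow_le_pow_right₀ (by norm_num)
    nlinarith
  have h2 := hge _ (by positivity) hle
  have h3 := htel m
  have h4 : (1/2^k0 : ℝ) ≤ 1/4 := by
    apply one_div_le_one_div_of_le (by norm_num)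
    calc (4:ℝ) = 2^2 := by norm_num
      _ ≤ 2^k0 := pow_le_pow_right₀ (by norm_num) hk02
  have h5 : (0:ℝ) < 2/2^m := by positivity
  have h6 : (0:ℝ) < 1/2^k0 := by positivity
  have h7 : (1/2^k0 : ℝ) * (2 - 2/2^m) ≤ (1/2^k0) * 2 := by gcongr; linarith
  linarith

end MW

namespace MW
open MeasureTheory Metric Set
variable {d : ℕ} {o i : Fin d}

lemma cell_ediam (p : ℕ × (Fin d → ℤ)) : Metric.ediam {x : Fin d → ℝ | cellc p.1 x = p.2} ≤ ENNReal.ofReal (1/2^p.1) := by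
  apply Metric.ediam_le
  intro x hx y hy
  rw [edist_pi_le_iff]
  intro a
  rw [edist_dist]
  apply ENNReal.ofReal_le_ofReal
  have h1 : ⌊(2:ℝ)^p.1 * x a⌋ = ⌊(2:ℝ)^p.1 * y a⌋ := congrFun (hx.trans hy.symm) a
  have h2 := Int.abs_sub_lt_one_of_floor_eq_floor h1
  rw [← mul_sub, abs_mul, abs_of_pos (by positivity)] at h2
  rw [Real.dist_eq, le_div_iff₀ (by positivity)]
  linarith

open scoped NNReal ENNReal in
lemma dim_norm (o : Fin d) (hd : ∃ i, i ≠ o) (N0 : ℕ) (hN0 : 1 ≤ N0) (B : Set (Fin d → ℝ)) (hB : volume B = 0) :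
    dimH {x | ∃ r, IsCfg o (x, r) ∧ {p : Fin d → ℝ | ∑ a, (p a - x a)^2 = r^2} ⊆ B} ≤ ((1 + 1/(N0:ℝ≥0) : ℝ≥0) : ℝ≥0∞) := by
  classical
  set S' := {x | ∃ r, IsCfg o (x, r) ∧ {p : Fin d → ℝ | ∑ a, (p a - x a)^2 = r^2} ⊆ B} with hS'
  set s : ℝ≥0 := 1 + 1/(N0:ℝ≥0) with hs
  have hsr : (s:ℝ) = 1 + 1/(N0:ℝ) := by simp [hs]
  have hN : (0:ℝ) < N0 := by exact_mod_cast hN0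
  have hs0 : (0:ℝ) < s := by rw [hsr]; positivity
  set e : ℝ := (2:ℝ)^(-(1/(N0:ℝ))) with he
  have he0 : 0 < e := by positivity
  have heN : e^N0 = 1/2 := by
    rw [he, ← Real.rpow_natCast, ← Real.rpow_mul (by norm_num)]
    rw [show -(1/(N0:ℝ)) * N0 = -1 by field_simp, Real.rpow_neg_one]; norm_num
  have he1 : e ≤ 1 := by
    rw [he]; apply Real.rpow_le_one_of_one_le_of_nonpos (by norm_num)
    have : 0 < 1/(N0:ℝ) := by positivity
    linarith
  have he2 : 1/2 ≤ e := by
    rw [← heN]; exact pow_le_of_le_one he0.le he1 (by omega)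
  have hes : ∀ j : ℕ, (1/2^j : ℝ)^(s:ℝ) = (e/2)^j := by
    intro j
    have : e/2 = (1/2:ℝ)^(s:ℝ) := by
      rw [hsr, he, Real.rpow_add (by norm_num), Real.rpow_one, one_div (2:ℝ), Real.inv_rpow (by norm_num), Real.rpow_neg (by norm_num)]
      ring
    rw [this, ← one_div_pow, ← Real.rpow_natCast (1/2), ← Real.rpow_natCast ((1/2:ℝ)^(s:ℝ)),
      ← Real.rpow_mul (by norm_num), ← Real.rpow_mul (by norm_num), mul_comm]
  obtain ⟨k1, hk⟩ := cover2 o hd N0 hN0 B hB e he0 heN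
  choose C hC1 hC2 using fun n : ℕ => hk (k1 + n) (by omega)
  set T : ℕ → (ℕ × (ℕ × (Fin d → ℤ))) → Set (Fin d → ℝ) := fun n q =>
    if q.2 ∈ C n q.1 then {x | cellc q.2.1 x = q.2.2} else ∅ with hT
  have hterm : ∀ n m, ∀ p ∈ C n m, (e/2)^p.1 ≤ 1/2^(k1+n+m) := fun n m p hp =>
    (Finset.single_le_sum (f := fun p : ℕ × (Fin d → ℤ) => (e/2)^p.1) (fun _ _ => by positivity) hp).trans (hC1 n m)
  apply dimH_le_of_hausdorffMeasure_ne_top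
  have hr : Filter.Tendsto (fun n : ℕ => ENNReal.ofReal (√((1/2)^n))) Filter.atTop (nhds 0) := by
    have h1 : Filter.Tendsto (fun n : ℕ => √((1/2:ℝ)^n)) Filter.atTop (nhds (√0)) :=
      (Real.continuous_sqrt.tendsto 0).comp (tendsto_pow_atTop_nhds_zero_of_lt_one (by norm_num) (by norm_num))
    have := (ENNReal.continuous_ofReal.tendsto _).comp h1
    rw [Real.sqrt_zero, ENNReal.ofReal_zero] at this
    exact this
  have key := Measure.hausdorffMeasure_le_liminf_tsum (s:ℝ) S' _ hr T ?_ ?_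
  · refine ne_top_of_le_ne_top (b := 2) (by simp) (key.trans ?_)
    refine Filter.liminf_le_of_le (by isBoundedDefault) ?_
    intro b hb
    obtain ⟨n, hn⟩ := hb.exists
    refine hn.trans ?_
    rw [ENNReal.tsum_prod']
    calc _ ≤ ∑' m : ℕ, (2⁻¹ : ℝ≥0∞)^m := by
          apply ENNReal.tsum_le_tsum
          intro m
          rw [tsum_eq_sum (s := C n m)]
          · calc _ ≤ ∑ p ∈ C n m, ENNReal.ofReal ((e/2)^p.1) := by
                  apply Finset.sum_le_sum
                  intro p hp
                  simp only [hT, if_pos hp]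
                  rw [← hes, ← ENNReal.ofReal_rpow_of_pos (by positivity)]
                  exact ENNReal.rpow_le_rpow (cell_ediam p) hs0.le
              _ = ENNReal.ofReal (∑ p ∈ C n m, (e/2)^p.1) := by
                  rw [ENNReal.ofReal_sum_of_nonneg]; intro _ _; positivity
              _ ≤ ENNReal.ofReal (2⁻¹^m) := by
                  apply ENNReal.ofReal_le_ofReal
                  refine (hC1 n m).trans ?_
                  rw [inv_pow, ← one_div]
                  apply one_div_le_one_div_of_le (by positivity)
                  exact pow_le_pow_right₀ (by norm_num) (by omega)
              _ = _ := by
                  rw [ENNReal.ofReal_pow (by norm_num), ENNReal.ofReal_inv_of_pos (by norm_num)]; simp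
          · intro p hp
            simp only [hT, if_neg hp]
            simp [hs0]
      _ = 2 := by rw [ENNReal.tsum_geometric, ENNReal.one_sub_inv_two, inv_inv]
  · filter_upwards with n q
    by_cases hq : q.2 ∈ C n q.1
    · simp only [hT, if_pos hq]
      refine (cell_ediam _).trans (ENNReal.ofReal_le_ofReal ?_)
      apply Real.le_sqrt_of_sq_le
      calc (1/2^q.2.1 : ℝ)^2 = (1/4)^q.2.1 := by
            rw [← one_div_pow, ← pow_mul, mul_comm, pow_mul]; norm_num
        _ ≤ (e/2)^q.2.1 := by
            apply pow_le_pow_left₀ (by norm_num); linarith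
        _ ≤ 1/2^(k1+n+q.1) := hterm n _ _ hq
        _ ≤ (1/2)^n := by
            rw [one_div_pow]
            apply one_div_le_one_div_of_le (by positivity)
            exact pow_le_pow_right₀ (by norm_num) (by omega)
    · simp only [hT, if_neg hq]; simp
  · filter_upwards with n x hx
    obtain ⟨m, p, hp, hpx⟩ := hC2 n x hx
    rw [mem_iUnion]
    refine ⟨(m, p), ?_⟩
    simp only [hT, if_pos hp]
    exact hpx

open scoped NNReal ENNReal in
lemma dim_norm_le_one (o : Fin d) (hd : ∃ i, i ≠ o) (B : Set (Fin d → ℝ)) (hB : volume B = 0) :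
    dimH {x | ∃ r, IsCfg o (x, r) ∧ {p : Fin d → ℝ | ∑ a, (p a - x a)^2 = r^2} ⊆ B} ≤ 1 := by
  have h := fun m : ℕ => dim_norm o hd (m+1) (by omega) B hB
  have hlim : Filter.Tendsto (fun m : ℕ => ((1 + 1/((m+1:ℕ):ℝ≥0) : ℝ≥0) : ℝ≥0∞)) Filter.atTop (nhds 1) := by
    rw [← ENNReal.coe_one, ENNReal.tendsto_coe]
    have := (tendsto_one_div_add_atTop_nhds_zero_nat (𝕜 := ℝ≥0)).const_add 1
    simpa using this
  exact ge_of_tendsto' hlim h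

end MW

namespace MW
open MeasureTheory Metric Set

lemma piece {n : ℕ} (o : Fin n) (hd : ∃ i, i ≠ o) (B : Set (EuclideanSpace ℝ (Fin n))) (hB : volume B = 0)
    (ρ : ℝ) (hρ : 0 < ρ) (c : EuclideanSpace ℝ (Fin n)) :
    dimH {x : EuclideanSpace ℝ (Fin n) | ∃ r > 0, sphere x r ⊆ B ∧ |r - ρ| ≤ ρ / (16 * Rd n) ∧ dist x c ≤ ρ / (16 * Rd n)} ≤ 1 := by
  have hR := Rd_ge n
  have hR0 : 0 < Rd n := by linarith
  set L : ℝ := Rd n / ρ with hL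
  have hL0 : 0 < L := by positivity
  have hLe : L * (ρ / (16 * Rd n)) = 1/16 := by rw [hL]; field_simp
  have hLρ : L * ρ = Rd n := by rw [hL]; field_simp
  set τ : Fin n → ℝ := fun a => if a = o then 1/2 - Rd n else 1/2 with hτ
  set w : Fin n → ℝ := fun a => c a - L⁻¹ * τ a with hw
  set ψ : (Fin n → ℝ) → EuclideanSpace ℝ (Fin n) := fun y => WithLp.toLp 2 (L⁻¹ • y + w) with hψ
  have hψa : ∀ y a, ψ y a = L⁻¹ * y a + (c a - L⁻¹ * τ a) := fun y a => rfl
  have hB' : volume (ψ ⁻¹' B) = 0 := by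
    have h1 : volume ((MeasurableEquiv.toLp 2 (Fin n → ℝ)) ⁻¹' B) = 0 := by
      rw [(PiLp.volume_preserving_toLp (Fin n)).measure_preimage_equiv, hB]
    have h2 : ψ ⁻¹' B = (fun y : Fin n → ℝ => L⁻¹ • y) ⁻¹' ((fun y => y + w) ⁻¹' ((MeasurableEquiv.toLp 2 (Fin n → ℝ)) ⁻¹' B)) := rfl
    rw [h2, Measure.addHaar_preimage_smul _ (by positivity), measure_preimage_add_right, h1, mul_zero]
  have hlip : ∃ K, LipschitzWith K ψ := by
    set A : (Fin n → ℝ) →L[ℝ] EuclideanSpace ℝ (Fin n) :=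
      ((EuclideanSpace.equiv (Fin n) ℝ).symm : (Fin n → ℝ) →L[ℝ] EuclideanSpace ℝ (Fin n)) with hA
    have : ψ = fun y => (L⁻¹ • A) y + WithLp.toLp 2 w := by
      funext y
      rfl
    rw [this]
    exact ⟨_, (L⁻¹ • A).lipschitz.add (LipschitzWith.const _)⟩
  obtain ⟨K, hK⟩ := hlip
  refine le_trans (dimH_mono ?_) ((hK.dimH_image_le _).trans (dim_norm_le_one o hd (ψ ⁻¹' B) hB'))
  rintro x ⟨r, hr, hsp, hrρ, hxc⟩
  have hcoord : ∀ a, |x a - c a| ≤ ρ / (16 * Rd n) := by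
    intro a
    have h1 : ‖(x - c) a‖ ≤ ‖x - c‖ := PiLp.norm_apply_le (x - c) a
    rw [dist_eq_norm] at hxc
    exact h1.trans hxc
  have hLc : ∀ a, |L * (x a - c a)| ≤ 1/16 := by
    intro a
    rw [abs_mul, abs_of_pos hL0, ← hLe]
    exact mul_le_mul_of_nonneg_left (hcoord a) hL0.le
  refine ⟨fun a => L * (x a - c a) + τ a, ⟨L * r, ⟨?_, ?_, ?_⟩, ?_⟩, ?_⟩
  · intro a ha
    simp only [hτ, if_neg ha]
    simpa using hLc a
  · simp only [hτ, if_true]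
    have := hLc o
    rw [show L * (x o - c o) + (1/2 - Rd n) + Rd n - 1/2 = L * (x o - c o) by ring]
    exact this
  · simp only
    rw [← hLρ, ← mul_sub, abs_mul, abs_of_pos hL0, ← hLe]
    exact mul_le_mul_of_nonneg_left hrρ hL0.le
  · intro p hp
    apply hsp
    rw [mem_ofPred_eq] at hp
    rw [mem_sphere, EuclideanSpace.dist_eq]
    rw [Real.sqrt_eq_iff_mul_self_eq_of_pos hr, ← sq]
    have : ∀ a, dist (ψ p a) (x a) ^ 2 = (L⁻¹)^2 * (p a - (L * (x a - c a) + τ a))^2 := by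
      intro a
      rw [hψa, Real.dist_eq, sq_abs]
      field_simp
      ring
    simp only [this]
    rw [← Finset.mul_sum, hp]
    field_simp
  · ext a
    rw [hψa]
    field_simp
    ring

end MW

open MeasureTheory Metric

/-- **Mitsis–Wolff theorem.** If `n ≥ 2`, `S ⊆ ℝⁿ` has Hausdorff dimension `> 1` and
`B` contains a sphere centered at every point of `S`, then `B` has positive Lebesgue
outer measure. -/
theorem mitsis_wolff (n : ℕ) (hn : 2 ≤ n)
    (S B : Set (EuclideanSpace ℝ (Fin n)))
    (hS : 1 < dimH S)
    (hB : ∀ x ∈ S, ∃ r > (0 : ℝ), Metric.sphere x r ⊆ B) :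
    0 < volume B := by
  by_contra hcon
  have hB0 : volume B = 0 := by simpa using hcon
  have hR := MW.Rd_ge n
  have hR0 : 0 < MW.Rd n := by linarith
  have hd : ∃ i : Fin n, i ≠ ⟨0, by omega⟩ := ⟨⟨1, by omega⟩, by simp [Fin.ext_iff]⟩
  have hP := fun (q : {q : ℚ // 0 < q}) (m : ℕ) => MW.piece _ hd B hB0 (q.1 : ℝ) (by exact_mod_cast q.2)
    (TopologicalSpace.denseSeq (EuclideanSpace ℝ (Fin n)) m)
  refine absurd hS (not_lt.2 ?_)
  refine (dimH_mono (t := ⋃ q : {q : ℚ // 0 < q}, ⋃ m : ℕ, {x : EuclideanSpace ℝ (Fin n) | ∃ r > 0, sphere x r ⊆ B ∧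
    |r - ((q.1 : ℚ) : ℝ)| ≤ ((q.1 : ℚ) : ℝ) / (16 * MW.Rd n) ∧
    dist x (TopologicalSpace.denseSeq (EuclideanSpace ℝ (Fin n)) m) ≤ ((q.1 : ℚ) : ℝ) / (16 * MW.Rd n)}) ?_).trans ?_
  · intro x hx
    obtain ⟨r, hr, hsp⟩ := hB x hx
    have hδ : 0 < 1 / (16 * MW.Rd n) := by positivity
    obtain ⟨q, hq1, hq2⟩ := exists_rat_btwn (show r < r * (1 + 1 / (16 * MW.Rd n)) by nlinarith)
    have hq0 : (0:ℝ) < q := hr.trans hq1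
    obtain ⟨m, hm⟩ := (TopologicalSpace.denseRange_denseSeq (EuclideanSpace ℝ (Fin n))).exists_dist_lt x
      (show 0 < (q:ℝ) / (16 * MW.Rd n) by positivity)
    simp only [Set.mem_iUnion]
    refine ⟨⟨q, by exact_mod_cast hq0⟩, m, r, hr, hsp, ?_, hm.le⟩
    simp only
    rw [abs_le, div_eq_mul_one_div]
    constructor <;> nlinarith
  · rw [dimH_iUnion]
    refine iSup_le fun q => ?_
    rw [dimH_iUnion]
    exact iSup_le fun m => hP q m
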